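/- Let f be a transcendental meromorphic function in the plane whose Schwarzian derivative S_f is a rational function. Then f has finitely many multiple points and the inverse function f⁻¹ has finitely many transcendental singularities. -/

import Mathlib

open Filter Set Topology Bornology MeasureTheory

noncomputable section

/-! ### The extended plane and the chordal metric

ℂ∞ is modelled as `Option ℂ`, with `none` denoting the point ∞. -/

/-- The chordal metric χ on the extended complex plane ℂ∞ (`none` = ∞). -/
def chordal : Option ℂ → Option ℂ → ℝ
  | Option.none, Option.none => 0
  | Option.none, Option.some w => 1 / Real.sqrt (1 + ‖w‖ ^ 2)
  | Option.some z, Option.none => 1 / Real.sqrt (1 + ‖z‖ ^ 2)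
  | Option.some z, Option.some w =>
      ‖z - w‖ / Real.sqrt ((1 + ‖z‖ ^ 2) * (1 + ‖w‖ ^ 2))

/-! ### Meromorphic functions in the plane -/

/-- `f` is meromorphic on the plane with pole set `P`: poles form a discrete closed set,
`f` is analytic off `P`, and `|f| → ∞` at each point of `P`. -/
def MeroPlane (f : ℂ → ℂ) (P : Set ℂ) : Prop :=
  (∀ K : Set ℂ, IsCompact K → (P ∩ K).Finite) ∧
  (∀ z ∉ P, AnalyticAt ℂ f z) ∧
  ∀ p ∈ P, Tendsto (fun z => ‖f z‖) (nhdsWithin p Pᶜ) atTop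

/-- `f` coincides with a rational function away from its poles. -/
def RationalFn (f : ℂ → ℂ) (P : Set ℂ) : Prop :=
  ∃ p q : Polynomial ℂ, q ≠ 0 ∧ ∀ z ∉ P, q.eval z ≠ 0 → f z = p.eval z / q.eval z

/-- `f` is a transcendental meromorphic function in the plane, with pole set `P`. -/
def TranscMeroPlane (f : ℂ → ℂ) (P : Set ℂ) : Prop :=
  MeroPlane f P ∧ ¬ RationalFn f P

/-- `f` has a pole of order `m` at `z₀`. -/
def PoleOrder (f : ℂ → ℂ) (z₀ : ℂ) (m : ℕ) : Prop :=
  0 < m ∧ ∃ g : ℂ → ℂ, AnalyticAt ℂ g z₀ ∧ g z₀ ≠ 0 ∧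
    ∀ᶠ z in nhdsWithin z₀ {z₀}ᶜ, f z = g z / (z - z₀) ^ m

/-- `f` has a zero of order `m` at `z₀`. -/
def ZeroOrder (f : ℂ → ℂ) (z₀ : ℂ) (m : ℕ) : Prop :=
  0 < m ∧ ∃ g : ℂ → ℂ, AnalyticAt ℂ g z₀ ∧ g z₀ ≠ 0 ∧
    ∀ᶠ z in nhds z₀, f z = (z - z₀) ^ m * g z

/-- `z₀` is a multiple point of `f` of multiplicity `μ`: either a pole of `f` of order `μ ≥ 2`,
or a point of analyticity where `f'` has a zero of order `μ - 1`. -/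
def MultiplePointWithMult (f : ℂ → ℂ) (z₀ : ℂ) (μ : ℕ) : Prop :=
  2 ≤ μ ∧ (PoleOrder f z₀ μ ∨ (AnalyticAt ℂ f z₀ ∧ ZeroOrder (deriv f) z₀ (μ - 1)))

/-- `z₀` is a multiple point of `f`. -/
def MultiplePoint (f : ℂ → ℂ) (z₀ : ℂ) : Prop :=
  ∃ μ, MultiplePointWithMult f z₀ μ

open scoped Classical in
/-- The value of `f` at `z` as an element of ℂ∞, given the pole set `P`. -/
def valueAt (f : ℂ → ℂ) (P : Set ℂ) (z : ℂ) : Option ℂ :=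
  if z ∈ P then none else some (f z)

/-- The set of critical values of `f` in ℂ∞ (values at multiple points). -/
def CriticalValues (f : ℂ → ℂ) (P : Set ℂ) : Set (Option ℂ) :=
  {w | ∃ z, MultiplePoint f z ∧ w = valueAt f P z}

/-! ### Transcendental singularities of the inverse function -/

/-- A path tending to infinity on which `f → a`; such a path determines a transcendental
singularity of `f⁻¹` over `a`. -/
def AsymptoticPath (f : ℂ → ℂ) (P : Set ℂ) (a : Option ℂ) (γ : ℝ → ℂ) : Prop :=
  ContinuousOn γ (Ici 0) ∧
  Tendsto (fun t => ‖γ t‖) atTop atTop ∧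
  Tendsto (fun t => chordal (valueAt f P (γ t)) a) atTop (nhds 0)

/-- `C` is a connected component of the set `S`. -/
def IsComponentOf (C S : Set ℂ) : Prop :=
  ∃ x ∈ S, C = connectedComponentIn S x

/-- The paths `γ₁`, `γ₂`, with asymptotic values `a₁`, `a₂` respectively, determine
distinct transcendental singularities of `f⁻¹`. -/
def DistinctSingularities (f : ℂ → ℂ) (P : Set ℂ) (a₁ a₂ : Option ℂ) (γ₁ γ₂ : ℝ → ℂ) : Prop :=
  a₁ ≠ a₂ ∨ ∃ t : ℝ, 0 < t ∧ ∃ C₁ C₂ : Set ℂ,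
    IsComponentOf C₁ {z | chordal (valueAt f P z) a₁ < t} ∧
    IsComponentOf C₂ {z | chordal (valueAt f P z) a₂ < t} ∧
    Disjoint C₁ C₂ ∧
    IsBounded (γ₁ '' Ici 0 \ C₁) ∧ IsBounded (γ₂ '' Ici 0 \ C₂)

/-- The inverse function of `f` has finitely many transcendental singularities: there is a
bound `n` on the size of any family of pairwise distinct transcendental singularities. -/
def FinitelyManyTranscSing (f : ℂ → ℂ) (P : Set ℂ) : Prop :=
  ∃ n : ℕ, ∀ m : ℕ, ∀ a : Fin m → Option ℂ, ∀ γ : Fin m → ℝ → ℂ,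
    (∀ i, AsymptoticPath f P (a i) (γ i)) →
    (∀ i j, i ≠ j → DistinctSingularities f P (a i) (a j) (γ i) (γ j)) →
    m ≤ n

/-- The Schwarzian derivative `S_f = f'''/f' - (3/2)(f''/f')²`. -/
def schwarzian (f : ℂ → ℂ) (z : ℂ) : ℂ :=
  deriv (deriv (deriv f)) z / deriv f z - (3 / 2) * (deriv (deriv f) z / deriv f z) ^ 2

/-- `w` is a singular value of `f⁻¹`: a critical value or an asymptotic value of `f`. -/
def SingularValue (f : ℂ → ℂ) (P : Set ℂ) (w : Option ℂ) : Prop :=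
  w ∈ CriticalValues f P ∨ ∃ γ : ℝ → ℂ, AsymptoticPath f P w γ

/-! ### Nevanlinna theory -/

open scoped Classical in
/-- The order of the pole of `f` at `z` (junk value `0` if there is no pole). -/
def poleOrderAt (f : ℂ → ℂ) (z : ℂ) : ℕ :=
  if h : ∃ m, PoleOrder f z m then h.choose else 0

/-- `n(t, f)`: the number of poles of `f` of modulus at most `t`, counted with multiplicity. -/
def nCount (f : ℂ → ℂ) (t : ℝ) : ℕ :=
  ∑ᶠ z ∈ {w : ℂ | ‖w‖ ≤ t}, poleOrderAt f z

/-- `N(r, f)`: the integrated counting function of the poles of `f`. -/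
def nevN (f : ℂ → ℂ) (r : ℝ) : ℝ :=
  (nCount f 0 : ℝ) * Real.log r + ∫ t in (0:ℝ)..r, ((nCount f t : ℝ) - (nCount f 0 : ℝ)) / t

/-- `m(r, f)`: the Nevanlinna proximity function. -/
def nevm (f : ℂ → ℂ) (r : ℝ) : ℝ :=
  (1 / (2 * Real.pi)) * ∫ θ in (0:ℝ)..(2 * Real.pi),
    Real.log (max 1 (‖f (r * Complex.exp (θ * Complex.I))‖))

/-- `T(r, f)`: the Nevanlinna characteristic. -/
def nevT (f : ℂ → ℂ) (r : ℝ) : ℝ := nevm f r + nevN f r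

/-- The order of growth `ρ(f) = limsup_{r→∞} log T(r,f)/log r`, as an extended real. -/
def growthOrder (f : ℂ → ℂ) : EReal :=
  Filter.limsup (fun r : ℝ => ((Real.log (nevT f r) / Real.log r : ℝ) : EReal)) atTop

/-- ∞ is a Borel exceptional value of `f`. -/
def BorelExceptionalInfty (f : ℂ → ℂ) : Prop :=
  Filter.limsup (fun r : ℝ => ((Real.log (nevN f r) / Real.log r : ℝ) : EReal)) atTop <
  Filter.limsup (fun r : ℝ => ((Real.log (nevT f r) / Real.log r : ℝ) : EReal)) atTop

/-! ### Meromorphic functions near infinity and the Wiman-Valiron property -/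

/-- `A` is meromorphic in `R ≤ |z| < ∞` with pole set `P`. -/
def MeroAnnulus (A : ℂ → ℂ) (R : ℝ) (P : Set ℂ) : Prop :=
  P ⊆ {z : ℂ | R ≤ ‖z‖} ∧
  (∀ K : Set ℂ, IsCompact K → (P ∩ K).Finite) ∧
  (∀ z : ℂ, R < ‖z‖ → z ∉ P → AnalyticAt ℂ A z) ∧
  ∀ p ∈ P, Tendsto (fun z => ‖A z‖) (nhdsWithin p Pᶜ) atTop

/-- `A` (meromorphic near ∞ with pole set `P`) has an essential singularity at infinity:
it is not the case that the poles are bounded and `A(z) ~ c zⁿ` as `z → ∞`. -/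
def EssSingAtInfty (A : ℂ → ℂ) (P : Set ℂ) : Prop :=
  ¬ (IsBounded P ∧ ∃ (n : ℤ) (c : ℂ), c ≠ 0 ∧
      Tendsto (fun z : ℂ => A z / z ^ n)
        (Filter.comap (fun z : ℂ => ‖z‖) atTop ⊓ Filter.principal Pᶜ) (nhds c))

/-- The logarithmic rectangle `D(z_r, L)` of Definition 2.1. -/
def WVDisk (z₀ : ℂ) (Nr phir L : ℝ) : Set ℂ :=
  {z : ℂ | ∃ τ : ℂ, z = z₀ * Complex.exp τ ∧
    |τ.re| ≤ L * phir / Nr ∧ |τ.im| ≤ L * phir / Nr}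

/-- Data witnessing the Wiman-Valiron property for `A`, meromorphic in `R ≤ |z| < ∞`:
an unbounded set `F1 ⊆ [R,∞)`, functions `N : F1 → [2,∞)`, `phi : F1 → [1,∞)` and points
`zr r` with `|zr r| = r`, such that `N(r) → ∞`, `phi(r)/N(r) → 0`, `phi(r)/log N(r) → ∞`,
`phi(r) = o(log⁺ |A(zr r)|)`, and `A(z) ~ (z/zr r)^{N(r)} A(zr r)` on `D(zr r, 8)`,
uniformly as `r → ∞` in `F1`.  (For `z = zr r · e^τ` one has `(z/zr r)^{N(r)} = e^{N(r)τ}`.) -/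
structure WVData (A : ℂ → ℂ) (R : ℝ) where
  F1 : Set ℝ
  N : ℝ → ℝ
  phi : ℝ → ℝ
  zr : ℝ → ℂ
  F1_sub : F1 ⊆ Ici R
  F1_unbounded : ∀ c : ℝ, ∃ r ∈ F1, c < r
  N_ge : ∀ r ∈ F1, 2 ≤ N r
  phi_ge : ∀ r ∈ F1, 1 ≤ phi r
  N_tendsto : Tendsto N (atTop ⊓ Filter.principal F1) atTop
  phi_over_N : Tendsto (fun r => phi r / N r) (atTop ⊓ Filter.principal F1) (nhds 0)
  phi_over_logN : Tendsto (fun r => phi r / Real.log (N r)) (atTop ⊓ Filter.principal F1) atTop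
  zr_abs : ∀ r ∈ F1, ‖zr r‖ = r
  phi_small : Tendsto (fun r => phi r / Real.log (max 1 (‖A (zr r)‖)))
      (atTop ⊓ Filter.principal F1) (nhds 0)
  approx : ∀ ε : ℝ, 0 < ε → ∀ᶠ r in atTop ⊓ Filter.principal F1, ∀ τ : ℂ,
      |τ.re| ≤ 8 * phi r / N r → |τ.im| ≤ 8 * phi r / N r →
      ‖A (zr r * Complex.exp τ) - Complex.exp ((N r : ℂ) * τ) * A (zr r)‖
        ≤ ε * ‖Complex.exp ((N r : ℂ) * τ) * A (zr r)‖

/-- `A` has the Wiman-Valiron property (Definition 2.1). -/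
def HasWVProp (A : ℂ → ℂ) (R : ℝ) : Prop := Nonempty (WVData A R)

/-- The point `w_r = z_r exp(-4 phi(r)/N(r))`. -/
def WVwr {A : ℂ → ℂ} {R : ℝ} (W : WVData A R) (r : ℝ) : ℂ :=
  W.zr r * Complex.exp (((-(4 * W.phi r / W.N r) : ℝ) : ℂ))

/-- The quantity `Z_r = |2 z_r A(z_r)^{1/2} / (N(r)+2)|`. -/
def WVZr {A : ℂ → ℂ} {R : ℝ} (W : WVData A R) (r : ℝ) : ℝ :=
  2 * r * Real.sqrt (‖A (W.zr r)‖) / (W.N r + 2)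

/-- The data of an analytic branch `sqA r` of `A^{1/2}` on `D(z_r, 4)` together with the
primitive `Z r` of `A^{1/2}` with `Z r (w_r) = 2 w_r A(w_r)^{1/2}/(N+2)`; this encodes
`Z(z) = 2 w_r A(w_r)^{1/2}/(N+2) + ∫_{w_r}^z A(t)^{1/2} dt`. -/
def IsZData {A : ℂ → ℂ} {R : ℝ} (W : WVData A R) (sqA Z : ℝ → ℂ → ℂ) (r : ℝ) : Prop :=
  (∀ z ∈ WVDisk (W.zr r) (W.N r) (W.phi r) 4,
      (sqA r z) ^ 2 = A z ∧ AnalyticAt ℂ (sqA r) z ∧ HasDerivAt (Z r) (sqA r z) z) ∧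
  Z r (WVwr W r) = 2 * WVwr W r * sqA r (WVwr W r) / ((W.N r : ℂ) + 2)

/-- The closed logarithmic rectangle `J₁ = {Z : |log|Z/Z_r|| ≤ phi(r), |arg Z| ≤ π/4}`. -/
def J1 (Zr phir : ℝ) : Set ℂ :=
  {w : ℂ | w ≠ 0 ∧ |Real.log (‖w‖ / Zr)| ≤ phir ∧ |Complex.arg w| ≤ Real.pi / 4}

/-! ### ε-sets -/

/-- An ε-set: a countable union of discs `B(b_j, ρ_j)` with `|b_j| → ∞` and
`Σ ρ_j/|b_j| < ∞`. -/
def IsEpsilonSet (E : Set ℂ) : Prop :=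
  ∃ (b : ℕ → ℂ) (ρ : ℕ → ℝ), (∀ j, 0 ≤ ρ j) ∧
    Tendsto (fun j => ‖b j‖) atTop atTop ∧
    Summable (fun j => ρ j / ‖b j‖) ∧
    E = ⋃ j, Metric.ball (b j) (ρ j)



/-- right half plane -/
def HP (R : ℝ) : Set ℂ := {u : ℂ | R < u.re}

lemma HP_open (R : ℝ) : IsOpen (HP R) := isOpen_lt continuous_const Complex.continuous_re

lemma HP_convex (R : ℝ) : Convex ℝ (HP R) := convex_halfSpace_re_gt R

lemma HP_preconn (R : ℝ) : IsPreconnected (HP R) := (HP_convex R).isPreconnected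

lemma HP_primitive (R : ℝ) (g : ℂ → ℂ) (hg : DifferentiableOn ℂ g (HP R)) :
    ∃ Z : ℂ → ℂ, ∀ u ∈ HP R, HasDerivAt Z (g u) u := by
  let ψ : ℂ → ℂ := fun z => R + (1 + z) / (1 - z)
  have h1 : ∀ z ∈ Metric.ball (0:ℂ) 1, (1 - z) ≠ 0 := by
    intro z hz h
    have : z = 1 := by linear_combination -h
    simp [this] at hz
  have hψ : ∀ z ∈ Metric.ball (0:ℂ) 1, HasDerivAt ψ (2 / (1 - z) ^ 2) z := by
    intro z hz
    have := h1 z hz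
    have h2 := (((hasDerivAt_id z).const_add 1).div ((hasDerivAt_id z).const_sub 1) this).const_add (R:ℂ)
    refine h2.congr_deriv ?_
    simp only [id]; field_simp; ring
  have hψH : ∀ z ∈ Metric.ball (0:ℂ) 1, ψ z ∈ HP R := by
    intro z hz
    have h0 := h1 z hz
    show R < (ψ z).re
    rw [show (ψ z).re = R + ((1 + z).re * (1 - z).re / Complex.normSq (1 - z) + (1 + z).im * (1 - z).im / Complex.normSq (1 - z)) by
      simp only [ψ]; rw [Complex.add_re, Complex.div_re, Complex.ofReal_re]]
    have hn : 0 < Complex.normSq (1 - z) := Complex.normSq_pos.2 h0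
    have hz1 : Complex.normSq z < 1 := by
      rw [Complex.normSq_eq_norm_sq]
      have : ‖z‖ < 1 := by simpa using hz
      nlinarith [norm_nonneg z]
    rw [Complex.normSq_apply] at hz1
    have : 0 < (1 + z).re * (1 - z).re / Complex.normSq (1 - z) + (1 + z).im * (1 - z).im / Complex.normSq (1 - z) := by
      rw [← add_div]
      apply div_pos _ hn
      simp
      nlinarith
    linarith
  obtain ⟨W, hW⟩ := DifferentiableOn.isExactOn_ball (c := 0) (r := 1)
    (f := fun z => g (ψ z) * (2 / (1 - z) ^ 2)) (by
      apply DifferentiableOn.mul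
      · exact hg.comp (fun z hz => (hψ z hz).differentiableAt.differentiableWithinAt) hψH
      · intro z hz
        have := h1 z hz
        apply DifferentiableAt.differentiableWithinAt
        fun_prop (disch := simpa using this))
  refine ⟨fun u => W ((u - R - 1) / (u - R + 1)), ?_⟩
  intro u hu
  have hu' : 0 < (u - R).re := by simpa [HP] using hu
  have hne : u - R + 1 ≠ 0 := by
    intro h
    have := congrArg Complex.re h
    simp at this hu'
    linarith
  have hz : (u - R - 1) / (u - R + 1) ∈ Metric.ball (0:ℂ) 1 := by
    simp only [Metric.mem_ball, dist_zero_right, norm_div]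
    rw [div_lt_one (norm_pos_iff.2 hne)]
    apply lt_of_pow_lt_pow_left₀ 2 (norm_nonneg _)
    rw [← Complex.normSq_eq_norm_sq, ← Complex.normSq_eq_norm_sq, Complex.normSq_apply, Complex.normSq_apply]
    simp at hu' ⊢
    nlinarith
  have hd : HasDerivAt (fun u : ℂ => (u - R - 1) / (u - R + 1)) (2 / (u - R + 1) ^ 2) u := by
    have h2 := (((hasDerivAt_id u).sub_const (R:ℂ)).sub_const 1).div
      (((hasDerivAt_id u).sub_const (R:ℂ)).add_const 1) hne
    refine h2.congr_deriv ?_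
    simp only [id]; field_simp; ring
  have := (hW _ hz).comp u hd
  refine this.congr_deriv ?_
  have e1 : 1 - (u - R - 1) / (u - R + 1) = 2 / (u - R + 1) := by field_simp; ring
  have e2 : ψ ((u - R - 1) / (u - R + 1)) = u := by
    simp only [ψ, e1]; field_simp; ring
  simp only [e1, e2]; field_simp

lemma ray_norm_sq (u d : ℂ) (hd : d.re = 0) (s : ℝ) :
    ‖u + s * d‖ ^ 2 = u.re ^ 2 + (u.im + s * d.im) ^ 2 := by
  rw [← Complex.normSq_eq_norm_sq, Complex.normSq_apply]
  simp [hd]; ring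

lemma ray_mem {R : ℝ} {u d : ℂ} (hd : d.re = 0) (s : ℝ) (hu : u ∈ HP R) : u + s * d ∈ HP R := by
  simpa [HP, hd] using hu

lemma ray_dom (x1 Y : ℝ) (hx : 0 < x1) : ∃ K : ℝ, 0 < K ∧ ∀ u d : ℂ, d.re = 0 → d.im ^ 2 = 1 →
    x1 ≤ u.re → |u.im| ≤ Y → ∀ s : ℝ, 1 / ‖u + s * d‖ ^ 2 ≤ K * (1 + s ^ 2)⁻¹ := by
  refine ⟨(1 + 2 * Y ^ 2) / x1 ^ 2 + 2, by positivity, ?_⟩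
  intro u d hd hd1 hu hY s
  rw [ray_norm_sq u d hd, ← div_eq_mul_inv, div_le_div_iff₀ (by nlinarith [sq_nonneg (u.im + s * d.im)]) (by positivity)]
  have h1 : s ^ 2 ≤ 2 * (u.im + s * d.im) ^ 2 + 2 * Y ^ 2 := by
    have : u.im ^ 2 ≤ Y ^ 2 := sq_le_sq' (by linarith [neg_abs_le u.im]) (by linarith [le_abs_self u.im])
    have e : s ^ 2 = (s * d.im) ^ 2 := by rw [mul_pow, hd1, mul_one]
    rw [e]
    nlinarith [sq_nonneg (s * d.im + 2 * u.im)]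
  have h2 : x1 ^ 2 ≤ u.re ^ 2 := by nlinarith
  have h3 : (1 + 2 * Y ^ 2) ≤ (1 + 2 * Y ^ 2) / x1 ^ 2 * u.re ^ 2 := by
    rw [div_mul_eq_mul_div, le_div_iff₀ (by positivity)]
    nlinarith [sq_nonneg Y]
  have h4 : 0 ≤ (1 + 2 * Y ^ 2) / x1 ^ 2 * (u.im + s * d.im) ^ 2 := by positivity
  nlinarith [sq_nonneg u.re]

lemma ray_bound_integrable (u d : ℂ) (hd : d.re = 0) (hd1 : d.im ^ 2 = 1) (hu : 0 < u.re) :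
    Integrable (fun s : ℝ => 1 / ‖u + s * d‖ ^ 2) ∧ ∫ s : ℝ, 1 / ‖u + s * d‖ ^ 2 = Real.pi / u.re := by
  have e : ∀ s : ℝ, 1 / ‖u + s * d‖ ^ 2
      = (1 / u.re ^ 2) * (fun x : ℝ => (1 + x ^ 2)⁻¹) ((s + u.im * d.im) / u.re) := by
    intro s
    rw [ray_norm_sq u d hd]
    have : (u.im + s * d.im) ^ 2 = (s + u.im * d.im) ^ 2 := by
      have : (s + u.im * d.im) = d.im * (u.im + s * d.im) - s * (d.im ^ 2 - 1) := by ring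
      rw [this, hd1, mul_comm]; simp only [sub_self, mul_zero, sub_zero, mul_pow, hd1]; ring
    rw [this]; field_simp
  have i1 := (integrable_inv_one_add_sq.comp_div hu.ne').comp_add_right (u.im * d.im)
  constructor
  · refine Integrable.congr (i1.const_mul (1 / u.re ^ 2)) (ae_of_all _ fun s => ?_)
    exact (e s).symm
  · simp_rw [e]
    rw [integral_const_mul, integral_add_right_eq_self (fun s => (fun x : ℝ => (1 + x ^ 2)⁻¹) (s / u.re)),
      Measure.integral_comp_div (fun x : ℝ => (1 + x ^ 2)⁻¹), integral_univ_inv_one_add_sq, abs_of_pos hu]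
    simp only [smul_eq_mul]; field_simp

lemma rayInt_bound (u d : ℂ) (hd : d.re = 0) (hd1 : d.im ^ 2 = 1) (hu : 0 < u.re) (k : ℝ → ℂ) (B : ℝ)
    (hB : 0 ≤ B) (hk : ∀ s : ℝ, 0 < s → ‖k s‖ ≤ B / ‖u + s * d‖ ^ 2) :
    ‖∫ s in Ioi (0:ℝ), k s‖ ≤ B * Real.pi / u.re := by
  obtain ⟨h1, h2⟩ := ray_bound_integrable u d hd hd1 hu
  calc ‖∫ s in Ioi (0:ℝ), k s‖ ≤ ∫ s in Ioi (0:ℝ), B * (1 / ‖u + s * d‖ ^ 2) := by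
        apply norm_integral_le_of_norm_le (h1.const_mul B).integrableOn
        rw [ae_restrict_iff' measurableSet_Ioi]
        refine ae_of_all _ fun s hs => ?_
        rw [mul_one_div]; exact hk s hs
    _ ≤ ∫ s : ℝ, B * (1 / ‖u + s * d‖ ^ 2) := by
        apply setIntegral_le_integral (h1.const_mul B)
        exact ae_of_all _ fun s => by positivity
    _ = B * Real.pi / u.re := by rw [integral_const_mul, h2]; ring

lemma rayInt_integrable (u d : ℂ) (hd : d.re = 0) (hd1 : d.im ^ 2 = 1) (hu : 0 < u.re) (k : ℝ → ℂ) (B : ℝ)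
    (hc : ContinuousOn k (Ioi 0))
    (hk : ∀ s : ℝ, 0 < s → ‖k s‖ ≤ B / ‖u + s * d‖ ^ 2) : IntegrableOn k (Ioi 0) := by
  obtain ⟨h1, h2⟩ := ray_bound_integrable u d hd hd1 hu
  refine Integrable.mono' (h1.const_mul B).integrableOn (hc.aestronglyMeasurable measurableSet_Ioi) ?_
  rw [ae_restrict_iff' measurableSet_Ioi]
  refine ae_of_all _ fun s hs => ?_
  rw [mul_one_div]; exact hk s hs

lemma rayInt_diff (R : ℝ) (hR : 0 < R) (d : ℂ) (hd : d.re = 0) (hd1 : d.im ^ 2 = 1) (K : ℂ → ℝ → ℂ) (B : ℝ)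
    (hK : ∀ s : ℝ, 0 < s → DifferentiableOn ℂ (fun u => K u s) (HP R))
    (hKc : ∀ u ∈ HP R, ContinuousOn (K u) (Ioi 0)) (hB : 0 ≤ B)
    (hb : ∀ u ∈ HP R, ∀ s : ℝ, 0 < s → ‖K u s‖ ≤ B / ‖u + s * d‖ ^ 2) :
    DifferentiableOn ℂ (fun u => ∫ s in Ioi (0:ℝ), K u s) (HP R) := by
  intro u0 hu0
  apply DifferentiableAt.differentiableWithinAt
  obtain ⟨ε, hε, hball⟩ := Metric.isOpen_iff.1 (HP_open R) u0 hu0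
  obtain ⟨C, hC, hdom⟩ := ray_dom R (|u0.im| + ε) hR
  have hmem : ∀ u ∈ Metric.ball u0 ε, ∀ s : ℝ, 0 < s → ‖K u s‖ ≤ B * (C * (1 + s ^ 2)⁻¹) := by
    intro u hu s hs
    refine (hb u (hball hu) s hs).trans ?_
    rw [← mul_one_div]
    apply mul_le_mul_of_nonneg_left _ hB
    apply hdom u d hd hd1 (le_of_lt (hball hu))
    have h1 : |u.im - u0.im| ≤ ‖u - u0‖ := by simpa using Complex.abs_im_le_norm (u - u0)
    have h2 : ‖u - u0‖ < ε := by simpa [dist_eq_norm] using hu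
    have := abs_sub_abs_le_abs_sub u.im u0.im
    linarith
  have hd' : ∀ s : ℝ, 0 < s → ∀ u ∈ Metric.ball u0 (ε/2), HasDerivAt (fun u => K u s) (deriv (fun u => K u s) u) u := by
    intro s hs u hu
    exact ((hK s hs).differentiableAt ((HP_open R).mem_nhds (hball (Metric.ball_subset_ball (by linarith) hu)))).hasDerivAt
  have := hasDerivAt_integral_of_dominated_loc_of_deriv_le (μ := volume.restrict (Ioi (0:ℝ)))
    (F := K) (F' := fun u s => deriv (fun u => K u s) u) (x₀ := u0) (s := Metric.ball u0 (ε/2))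
    (bound := fun s => B * (C * (1 + s ^ 2)⁻¹) / (ε/4)) (Metric.ball_mem_nhds _ (by positivity)) ?_ ?_ ?_ ?_ ?_ ?_
  · exact this.2.differentiableAt
  · filter_upwards [(HP_open R).mem_nhds hu0] with u hu
    exact (hKc u hu).aestronglyMeasurable measurableSet_Ioi
  · exact rayInt_integrable u0 d hd hd1 (lt_trans hR hu0) _ B (hKc u0 hu0) (hb u0 hu0)
  · -- measurability of the derivative
    let a : ℕ → ℂ := fun n => ((ε/2/((n:ℝ)+1) : ℝ) : ℂ)
    have ha : Tendsto a atTop (𝓝[≠] 0) := by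
      rw [tendsto_nhdsWithin_iff]
      constructor
      · have : Tendsto (fun n : ℕ => ε/2/((n:ℝ)+1)) atTop (𝓝 0) :=
          tendsto_const_nhds.div_atTop (tendsto_atTop_add_const_right _ _ tendsto_natCast_atTop_atTop)
        have h2 := (Complex.continuous_ofReal.tendsto 0).comp this
        simpa [Function.comp_def, a] using h2
      · refine Eventually.of_forall fun n => ?_
        have : (0:ℝ) < ε/2/((n:ℝ)+1) := by positivity
        exact Complex.ofReal_ne_zero.2 this.ne'
    have haH : ∀ n, u0 + a n ∈ HP R := by
      intro n
      have : (0:ℝ) < ε/2/((n:ℝ)+1) := by positivity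
      simp only [HP, mem_ofPred_eq, Complex.add_re, a, Complex.ofReal_re] at hu0 ⊢
      linarith
    refine aestronglyMeasurable_of_tendsto_ae atTop (f := fun n s => (a n)⁻¹ • (K (u0 + a n) s - K u0 s)) ?_ ?_
    · intro n
      exact (((hKc _ (haH n)).sub (hKc u0 hu0)).const_smul ((a n)⁻¹)).aestronglyMeasurable measurableSet_Ioi
    · rw [ae_restrict_iff' measurableSet_Ioi]
      refine ae_of_all _ fun s hs => ?_
      have h := (hd' s hs u0 (Metric.mem_ball_self (by positivity))).tendsto_slope_zero
      exact h.comp ha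
  · rw [ae_restrict_iff' measurableSet_Ioi]
    refine ae_of_all _ fun s hs u hu => ?_
    have hsub : Metric.closedBall u (ε/4) ⊆ Metric.ball u0 ε := by
      intro v hv
      simp only [Metric.mem_ball, Metric.mem_closedBall] at *
      linarith [dist_triangle v u u0]
    refine Complex.norm_deriv_le_of_forall_mem_sphere_norm_le (by positivity) ?_ ?_
    · apply DifferentiableOn.diffContOnCl
      rw [closure_ball _ (by positivity)]
      exact (hK s hs).mono (hsub.trans hball)
    · intro v hv
      exact hmem v (hsub (Metric.sphere_subset_closedBall hv)) s hs
  · apply Integrable.integrableOn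
    exact ((integrable_inv_one_add_sq.const_mul C).const_mul B).div_const _
  · rw [ae_restrict_iff' measurableSet_Ioi]
    refine ae_of_all _ fun s hs u hu => hd' s hs u hu

lemma rayInt_ftc (R : ℝ) (d : ℂ) (hd : d.re = 0) (g : ℂ → ℂ) (u : ℂ) (hu : u ∈ HP R)
    (hg : ContinuousOn g (HP R))
    (hi : ∀ τ : ℝ, IntegrableOn (fun s : ℝ => g (u + s * d)) (Ioi τ)) :
    HasDerivAt (fun τ : ℝ => ∫ s in Ioi (0:ℝ), g (u + τ * d + s * d)) (-g u) 0 := by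
  have hcont : Continuous (fun s : ℝ => g (u + s * d)) := by
    rw [← continuousOn_univ]
    exact hg.comp (by fun_prop) (fun s _ => ray_mem hd s hu)
  have e : ∀ τ : ℝ, ∫ s in Ioi (0:ℝ), g (u + τ * d + s * d) =
      (∫ s in Ioi (0:ℝ), g (u + s * d)) - ∫ s in (0:ℝ)..τ, g (u + s * d) := by
    intro τ
    have h1 : ∫ s in Ioi (0:ℝ), g (u + τ * d + s * d) = ∫ s in Ioi τ, g (u + s * d) := by
      have := (measurePreserving_add_right volume τ).setIntegral_preimage_emb
        (measurableEmbedding_addRight τ) (fun s : ℝ => g (u + s * d)) (Ioi τ)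
      rw [preimage_add_const_Ioi, sub_self] at this
      rw [← this]
      congr 1; ext s; congr 1; push_cast; ring
    rw [h1]
    have := intervalIntegral.integral_Ioi_sub_Ioi' (hi 0) (hi τ)
    rw [← this]; ring
  simp_rw [e]
  have h2 := intervalIntegral.integral_hasDerivAt_right (a := 0) (b := 0)
    (hcont.intervalIntegrable 0 0) (hcont.stronglyMeasurableAtFilter _ _) hcont.continuousAt
  refine (h2.const_sub _).congr_deriv ?_
  simp


lemma exp_le_one_of_im (w : ℂ) (hw : 0 ≤ w.im) : ‖Complex.exp (2 * Complex.I * w)‖ ≤ 1 := by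
  rw [Complex.norm_exp]
  apply Real.exp_le_one_iff.2
  simp; linarith

lemma volterra (R C : ℝ) (hR : 0 < R) (hC : 0 ≤ C) (G Z Z' : ℂ → ℂ) (hG : DifferentiableOn ℂ G (HP R))
    (hZ : ∀ u ∈ HP R, HasDerivAt Z (Z' u) u) (hZ0 : ∀ u ∈ HP R, Z' u ≠ 0)
    (σ d : ℂ) (hσ : ‖σ‖ = 1) (hd : d.re = 0) (hd1 : d.im ^ 2 = 1)
    (hGb : ∀ u ∈ HP R, ‖G u‖ ≤ C / ‖u‖ ^ 2) (hCR : 4 * C * Real.pi ≤ R)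
    (mono : ∀ u ∈ HP R, ∀ s : ℝ, 0 ≤ s → 0 ≤ (Z (u + s * d) - Z u).im) :
    ∃ h J : ℂ → ℂ, (∀ u ∈ HP R, ‖h u - 1‖ ≤ 2 * C * Real.pi / u.re) ∧
      (∀ u ∈ HP R, HasDerivAt h (σ * Z' u * Complex.exp (-2 * Complex.I * Z u) * J u) u) ∧
      (∀ u ∈ HP R, HasDerivAt J (-Complex.exp (2 * Complex.I * Z u) * G u * h u) u) := by
  have hZd : DifferentiableOn ℂ Z (HP R) := fun u hu => (hZ u hu).differentiableAt.differentiableWithinAt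
  have hdne : ‖d‖ = 1 := by
    have : ‖d‖ ^ 2 = 1 := by
      rw [← Complex.normSq_eq_norm_sq, Complex.normSq_apply, hd]; linarith [hd1, sq d.im]
    nlinarith [norm_nonneg d]
  have hd0 : d ≠ 0 := by
    intro h; simp [h] at hdne
  have hdd : d * d = -1 := by
    apply Complex.ext
    · simp [hd]; nlinarith
    · simp [hd]
  let k : ℂ → ℝ → ℂ := fun u s => (σ * d / (2 * Complex.I)) *
    (G (u + s * d) * (1 - Complex.exp (2 * Complex.I * (Z (u + s * d) - Z u))))
  have hray : ∀ s : ℝ, ∀ u ∈ HP R, u + s * d ∈ HP R := fun s u hu => ray_mem hd s hu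
  have hshift : ∀ (g : ℂ → ℂ) (s : ℝ), DifferentiableOn ℂ g (HP R) →
      DifferentiableOn ℂ (fun u => g (u + s * d)) (HP R) := by
    intro g s hg
    exact hg.comp (by fun_prop) (fun u hu => hray s u hu)
  have hline : ∀ (g : ℂ → ℂ) (u : ℂ), u ∈ HP R → DifferentiableOn ℂ g (HP R) →
      Continuous (fun s : ℝ => g (u + s * d)) := by
    intro g u hu hg
    rw [← continuousOn_univ]
    exact hg.continuousOn.comp (by fun_prop) (fun s _ => hray s u hu)
  have hkb : ∀ u ∈ HP R, ∀ s : ℝ, 0 < s → ‖k u s‖ ≤ C / ‖u + s * d‖ ^ 2 := by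
    intro u hu s hs
    have h1 := exp_le_one_of_im _ (mono u hu s hs.le)
    have h2 : ‖1 - Complex.exp (2 * Complex.I * (Z (u + s * d) - Z u))‖ ≤ 2 :=
      (norm_sub_le _ _).trans (by rw [norm_one]; linarith)
    have h3 := hGb _ (hray s u hu)
    simp only [k, norm_mul, norm_div, hσ, hdne, Complex.norm_I, Complex.norm_ofNat]
    nlinarith [norm_nonneg (G (u + s * d))]
  have hkd : ∀ s : ℝ, DifferentiableOn ℂ (fun u => k u s) (HP R) := by
    intro s
    exact ((hshift G s hG).mul (((((hshift Z s hZd).sub hZd).const_mul _).cexp).const_sub 1)).const_mul _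
  have hkc : ∀ u ∈ HP R, Continuous (k u) := by
    intro u hu
    have h1 := hline G u hu hG
    have h2 := hline Z u hu hZd
    exact continuous_const.mul (h1.mul (continuous_const.sub ((continuous_const.mul (h2.sub continuous_const)).cexp)))
  let T : (ℂ → ℂ) → ℂ → ℂ := fun g u => ∫ s in Ioi (0:ℝ), k u s * g (u + s * d)
  have hTb : ∀ (g : ℂ → ℂ) (B : ℝ), 0 ≤ B → (∀ u ∈ HP R, ‖g u‖ ≤ B) → ∀ u ∈ HP R, ∀ s : ℝ, 0 < s →
      ‖k u s * g (u + s * d)‖ ≤ C * B / ‖u + s * d‖ ^ 2 := by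
    intro g B hB hg u hu s hs
    rw [norm_mul, mul_div_right_comm]
    exact mul_le_mul (hkb u hu s hs) (hg _ (hray s u hu)) (norm_nonneg _) (by positivity)
  have hTd : ∀ (g : ℂ → ℂ) (B : ℝ), 0 ≤ B → (∀ u ∈ HP R, ‖g u‖ ≤ B) → DifferentiableOn ℂ g (HP R) →
      DifferentiableOn ℂ (T g) (HP R) := by
    intro g B hB hg hgd
    refine rayInt_diff R hR d hd hd1 _ (C * B) ?_ ?_ (by positivity) (hTb g B hB hg)
    · intro s hs
      exact (hkd s).mul (hshift g s hgd)
    · intro u hu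
      exact ((hkc u hu).mul (hline g u hu hgd)).continuousOn
  have hTn : ∀ (g : ℂ → ℂ) (B : ℝ), 0 ≤ B → (∀ u ∈ HP R, ‖g u‖ ≤ B) → ∀ u ∈ HP R,
      ‖T g u‖ ≤ C * B * Real.pi / u.re := by
    intro g B hB hg u hu
    exact rayInt_bound u d hd hd1 (lt_trans hR hu) _ (C * B) (by positivity) (hTb g B hB hg u hu)
  have hT4 : ∀ (g : ℂ → ℂ) (B : ℝ), 0 ≤ B → (∀ u ∈ HP R, ‖g u‖ ≤ B) → ∀ u ∈ HP R,
      ‖T g u‖ ≤ B * (1/2) := by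
    intro g B hB hg u hu
    refine (hTn g B hB hg u hu).trans ?_
    have hu' : R < u.re := hu
    rw [div_le_iff₀ (lt_trans hR hu)]
    have : 0 ≤ C * Real.pi := by positivity
    nlinarith
  let g : ℕ → ℂ → ℂ := fun n => T^[n] (fun _ => 1)
  have hg0 : g 0 = fun _ => 1 := rfl
  have hgs : ∀ n, g (n+1) = T (g n) := fun n => Function.iterate_succ_apply' T n _
  have hgb : ∀ n, ∀ u ∈ HP R, ‖g n u‖ ≤ (1/2:ℝ)^n := by
    intro n
    induction n with
    | zero => intro u hu; simp [hg0]
    | succ n ih =>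
      intro u hu
      rw [hgs, pow_succ]
      exact hT4 (g n) _ (by positivity) ih u hu
  have hgd : ∀ n, DifferentiableOn ℂ (g n) (HP R) := by
    intro n
    induction n with
    | zero => rw [hg0]; exact differentiableOn_const _
    | succ n ih => rw [hgs]; exact hTd (g n) _ (by positivity) (hgb n) ih
  have hsum : Summable (fun n : ℕ => (1/2:ℝ)^n) := summable_geometric_two
  let h : ℂ → ℂ := fun u => ∑' n, g n u
  have hhd : DifferentiableOn ℂ h (HP R) :=
    Complex.differentiableOn_tsum_of_summable_norm hsum hgd (HP_open R) hgb
  have hgsum : ∀ u ∈ HP R, Summable (fun n => g n u) := fun u hu =>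
    Summable.of_norm_bounded hsum (fun n => hgb n u hu)
  have hhb : ∀ u ∈ HP R, ‖h u‖ ≤ 2 := by
    intro u hu
    have := tsum_of_norm_bounded (hsum.hasSum) (fun n => hgb n u hu)
    rwa [tsum_geometric_two] at this
  have hfix : ∀ u ∈ HP R, h u = 1 + T h u := by
    intro u hu
    have e1 : T h u = ∑' n, T (g n) u := by
      have e0 : ∀ s : ℝ, k u s * h (u + s * d) = ∑' n, k u s * g n (u + s * d) := by
        intro s; exact (tsum_mul_left).symm
      simp only [T, e0]
      symm
      apply (hasSum_integral_of_summable_integral_norm (μ := volume.restrict (Ioi (0:ℝ))) (F := fun n s => k u s * g n (u + s * d)) ?_ ?_).tsum_eq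
      · intro n
        exact rayInt_integrable u d hd hd1 (lt_trans hR hu) _ _
          ((hkc u hu).mul (hline (g n) u hu (hgd n))).continuousOn (hTb (g n) _ (by positivity) (hgb n) u hu)
      · have i0 : IntegrableOn (k u) (Ioi 0) := rayInt_integrable u d hd hd1 (lt_trans hR hu) _ _
            ((hkc u hu)).continuousOn (hkb u hu)
        refine Summable.of_nonneg_of_le (fun n => integral_nonneg fun s => norm_nonneg _) (f := fun n => (∫ s in Ioi (0:ℝ), ‖k u s‖) * (1/2:ℝ)^n) ?_ (hsum.mul_left _)
        intro n
        rw [← integral_mul_const]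
        apply integral_mono_of_nonneg (ae_of_all _ fun s => norm_nonneg _) (i0.norm.mul_const _)
        refine ae_of_all _ fun s => ?_
        simp only [norm_mul]
        exact mul_le_mul_of_nonneg_left (hgb n _ (hray s u hu)) (norm_nonneg _)
    rw [e1]
    have : h u = g 0 u + ∑' n, g (n+1) u := (hgsum u hu).tsum_eq_zero_add
    rw [this, hg0]; simp only [hgs]
  let e : ℂ → ℂ := fun u => Complex.exp (2 * Complex.I * Z u)
  have hed : DifferentiableOn ℂ e (HP R) := (hZd.const_mul _).cexp
  let I2 : ℂ → ℂ := fun u => ∫ s in Ioi (0:ℝ), e (u + s * d) * (G (u + s * d) * h (u + s * d))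
  let I1 : ℂ → ℂ := fun u => ∫ s in Ioi (0:ℝ), G (u + s * d) * h (u + s * d)
  have hGh : DifferentiableOn ℂ (fun u => G u * h u) (HP R) := hG.mul hhd
  have heGh : DifferentiableOn ℂ (fun u => e u * (G u * h u)) (HP R) := hed.mul hGh
  have int_ext : ∀ (f : ℝ → ℂ), Continuous f → IntegrableOn f (Ioi 0) → ∀ τ : ℝ, IntegrableOn f (Ioi τ) := by
    intro f hf hi τ
    have h1 : IntegrableOn f (Icc τ 0) := hf.continuousOn.integrableOn_Icc
    refine (h1.union hi).mono_set ?_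
    intro x hx
    by_cases h : x ≤ 0
    · left; exact ⟨le_of_lt hx, h⟩
    · right; exact not_le.1 h
  have hi1 : ∀ u ∈ HP R, IntegrableOn (fun s : ℝ => G (u + s * d) * h (u + s * d)) (Ioi 0) := by
    intro u hu
    apply rayInt_integrable u d hd hd1 (lt_trans hR hu) _ (C * 2) (hline _ u hu hGh).continuousOn
    intro s hs
    rw [norm_mul, mul_div_right_comm]
    exact mul_le_mul (hGb _ (hray s u hu)) (hhb _ (hray s u hu)) (norm_nonneg _) (by positivity)
  have hi2 : ∀ u ∈ HP R, IntegrableOn (fun s : ℝ => e (u + s * d) * (G (u + s * d) * h (u + s * d))) (Ioi 0) := by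
    intro u hu
    apply rayInt_integrable u d hd hd1 (lt_trans hR hu) _ (‖e u‖ * (C * 2)) (hline _ u hu heGh).continuousOn
    intro s hs
    rw [norm_mul, norm_mul, mul_div_assoc, mul_div_right_comm]
    have h1 := exp_le_one_of_im _ (mono u hu s hs.le)
    have h2 : ‖e (u + s * d)‖ ≤ ‖e u‖ := by
      have : e (u + s * d) = e u * Complex.exp (2 * Complex.I * (Z (u + s * d) - Z u)) := by
        simp only [e]; rw [← Complex.exp_add]; congr 1; ring
      rw [this, norm_mul]
      exact mul_le_of_le_one_right (norm_nonneg _) h1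
    exact mul_le_mul h2 (mul_le_mul (hGb _ (hray s u hu)) (hhb _ (hray s u hu)) (norm_nonneg _) (by positivity)) (by positivity) (by positivity)
  have hTh : ∀ u ∈ HP R, h u = 1 + (σ * d / (2 * Complex.I)) * (I1 u - Complex.exp (-2 * Complex.I * Z u) * I2 u) := by
    intro u hu
    rw [hfix u hu]
    congr 1
    simp only [T, I1, I2]
    rw [← integral_const_mul, ← integral_sub (hi1 u hu) ((hi2 u hu).const_mul _), ← integral_const_mul]
    congr 1; ext s
    have : Complex.exp (2 * Complex.I * (Z (u + s * d) - Z u)) = Complex.exp (-2 * Complex.I * Z u) * e (u + s * d) := by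
      simp only [e]; rw [← Complex.exp_add]; congr 1; ring
    simp only [k, this]; ring
  have hder : ∀ u ∈ HP R, deriv h u = σ * Z' u * Complex.exp (-2 * Complex.I * Z u) * (d * I2 u) := by
    intro u hu
    have hray0 : HasDerivAt (fun τ : ℝ => u + τ * d) d 0 := by
      have := (Complex.ofRealCLM.hasDerivAt (x := 0)).mul_const d
      simpa using this.const_add u
    have hl : HasDerivAt (fun τ : ℝ => h (u + τ * d)) (deriv h u * d) 0 := by
      have h1 := (hhd.differentiableAt ((HP_open R).mem_nhds hu)).hasDerivAt
      have h2 : HasDerivAt h (deriv h u) (u + (0:ℝ) * d) := by simpa using h1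
      exact h2.comp 0 hray0
    have hZl : HasDerivAt (fun τ : ℝ => Z (u + τ * d)) (Z' u * d) 0 := by
      have h2 : HasDerivAt Z (Z' u) (u + (0:ℝ) * d) := by simpa using hZ u hu
      exact h2.comp 0 hray0
    have f1 := rayInt_ftc R d hd _ u hu hGh.continuousOn (int_ext _ (hline _ u hu hGh) (hi1 u hu))
    have f2 := rayInt_ftc R d hd _ u hu heGh.continuousOn (int_ext _ (hline _ u hu heGh) (hi2 u hu))
    have hexp := (hZl.const_mul (-2 * Complex.I)).cexp
    have f3 := ((f1.sub (hexp.mul f2)).const_mul (σ * d / (2 * Complex.I))).const_add 1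
    have heq : (fun τ : ℝ => h (u + τ * d)) = fun τ : ℝ => 1 + (σ * d / (2 * Complex.I)) * (I1 (u + τ * d) - Complex.exp (-2 * Complex.I * Z (u + τ * d)) * I2 (u + τ * d)) := by
      ext τ; exact hTh _ (hray τ u hu)
    rw [heq] at hl
    have := hl.unique f3
    have hee : Complex.exp (-2 * Complex.I * Z u) * e u = 1 := by
      simp only [e]; rw [← Complex.exp_add]; simp
    have hI : Complex.I ≠ 0 := Complex.I_ne_zero
    have e3 : deriv h u * d = (σ * Z' u * Complex.exp (-2 * Complex.I * Z u) * (d * I2 u)) * d := by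
      rw [this]
      simp only [Complex.ofReal_zero, zero_mul, add_zero]
      simp only [I2]
      generalize Complex.exp (-2 * Complex.I * Z u) = E at hee ⊢
      field_simp
      linear_combination (σ * G u * h u) * hee
    exact mul_right_cancel₀ hd0 e3
  have hJd : DifferentiableOn ℂ (fun u => d * I2 u) (HP R) := by
    have : DifferentiableOn ℂ (fun u => deriv h u * (e u * (σ * Z' u)⁻¹)) (HP R) := by
      apply (hhd.deriv (HP_open R)).mul
      apply hed.mul
      apply DifferentiableOn.inv
      · apply DifferentiableOn.const_mul
        refine (hZd.deriv (HP_open R)).congr fun u hu => ((hZ u hu).deriv).symm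
      · intro u hu
        apply mul_ne_zero _ (hZ0 u hu)
        intro h; simp [h] at hσ
    refine this.congr fun u hu => ?_
    have hee : Complex.exp (-2 * Complex.I * Z u) * e u = 1 := by
      simp only [e]; rw [← Complex.exp_add]; simp
    have hσ0 : σ ≠ 0 := by intro h; simp [h] at hσ
    have := hZ0 u hu
    rw [hder u hu]
    generalize Complex.exp (-2 * Complex.I * Z u) = E at hee ⊢
    field_simp
    linear_combination (-I2 u) * hee
  refine ⟨h, fun u => d * I2 u, ?_, ?_, ?_⟩
  · intro u hu
    have : h u - 1 = T h u := by rw [hfix u hu]; ring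
    rw [this]
    refine (hTn h 2 (by norm_num) hhb u hu).trans (le_of_eq (by ring))
  · intro u hu
    rw [← hder u hu]
    exact (hhd.differentiableAt ((HP_open R).mem_nhds hu)).hasDerivAt
  · intro u hu
    have h1 := (hJd.differentiableAt ((HP_open R).mem_nhds hu)).hasDerivAt
    have hray0 : HasDerivAt (fun τ : ℝ => u + τ * d) d 0 := by
      have := (Complex.ofRealCLM.hasDerivAt (x := 0)).mul_const d
      simpa using this.const_add u
    have h2 : HasDerivAt (fun u => d * I2 u) (deriv (fun u => d * I2 u) u) (u + (0:ℝ) * d) := by simpa using h1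
    have h3 := h2.comp 0 hray0
    have f2 := rayInt_ftc R d hd _ u hu heGh.continuousOn (int_ext _ (hline _ u hu heGh) (hi2 u hu))
    have h4 := h3.unique (f2.const_mul d)
    have h5 : deriv (fun u => d * I2 u) u = -Complex.exp (2 * Complex.I * Z u) * G u * h u := by
      apply mul_right_cancel₀ hd0
      rw [h4]; simp only [e]; ring
    rw [← h5]; exact h1


lemma wkb_sol (R : ℝ) (V V1 V2 Z h J Q : ℂ → ℂ) (σ : ℂ) (hσ : σ ^ 2 = 1)
    (hV : ∀ u ∈ HP R, HasDerivAt V (V1 u) u) (hV1 : ∀ u ∈ HP R, HasDerivAt V1 (V2 u) u)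
    (hV0 : ∀ u ∈ HP R, V u ≠ 0) (hZ : ∀ u ∈ HP R, HasDerivAt Z (σ / V u ^ 2) u)
    (hQ : ∀ u ∈ HP R, Q u * V u ^ 4 = 1)
    (hh : ∀ u ∈ HP R, HasDerivAt h (1 / V u ^ 2 * Complex.exp (-2 * Complex.I * Z u) * J u) u)
    (hJ : ∀ u ∈ HP R, HasDerivAt J (-Complex.exp (2 * Complex.I * Z u) * (V u * V2 u) * h u) u) :
    ∃ w1 : ℂ → ℂ, ∀ u ∈ HP R, HasDerivAt (fun u => V u * Complex.exp (Complex.I * Z u) * h u) (w1 u) u ∧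
      HasDerivAt w1 (-Q u * (V u * Complex.exp (Complex.I * Z u) * h u)) u := by
  refine ⟨fun u => (V1 u + Complex.I * σ / V u) * Complex.exp (Complex.I * Z u) * h u
    + 1 / V u * Complex.exp (-(Complex.I * Z u)) * J u, fun u hu => ⟨?_, ?_⟩⟩
  · have h1 := ((hV u hu).mul (((hZ u hu).const_mul Complex.I).cexp)).mul (hh u hu)
    refine h1.congr_deriv ?_
    have e1 : Complex.exp (-2 * Complex.I * Z u) = (Complex.exp (Complex.I * Z u))⁻¹ ^ 2 := by
      rw [← Complex.exp_neg, ← Complex.exp_nat_mul]; congr 1; push_cast; ring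
    have hE := Complex.exp_ne_zero (Complex.I * Z u)
    have := hV0 u hu
    simp only [Pi.mul_apply]
    rw [e1, Complex.exp_neg]
    generalize Complex.exp (Complex.I * Z u) = E at *
    field_simp
  · have h1 := ((((hV1 u hu).add ((hasDerivAt_const u (Complex.I * σ)).div (hV u hu) (hV0 u hu))).mul (((hZ u hu).const_mul Complex.I).cexp)).mul (hh u hu)).add
      ((((hasDerivAt_const u (1:ℂ)).div (hV u hu) (hV0 u hu)).mul (((hZ u hu).const_mul Complex.I).neg.cexp)).mul (hJ u hu))
    refine h1.congr_deriv ?_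
    have e1 : Complex.exp (-2 * Complex.I * Z u) = (Complex.exp (Complex.I * Z u))⁻¹ ^ 2 := by
      rw [← Complex.exp_neg, ← Complex.exp_nat_mul]; congr 1; push_cast; ring
    have e2 : Complex.exp (2 * Complex.I * Z u) = (Complex.exp (Complex.I * Z u)) ^ 2 := by
      rw [← Complex.exp_nat_mul]; congr 1; push_cast; ring
    have hE := Complex.exp_ne_zero (Complex.I * Z u)
    have hv := hV0 u hu
    have hq : Q u = 1 / V u ^ 4 := by
      rw [eq_div_iff (by positivity)]; exact hQ u hu
    simp only [Pi.mul_apply, Pi.add_apply, Pi.div_apply, Pi.neg_apply]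
    rw [hq, e1, e2, Complex.exp_neg]
    generalize Complex.exp (Complex.I * Z u) = E at *
    field_simp
    linear_combination (Complex.I ^ 2 * E ^ 2 * h u) * hσ + (E ^ 2 * h u) * Complex.I_sq

def SE (R : ℝ) : Set ℂ := {u : ℂ | u ∈ Complex.slitPlane ∧ R < ‖u‖}

lemma SE_open (R : ℝ) : IsOpen (SE R) := Complex.isOpen_slitPlane.inter (isOpen_lt continuous_const continuous_norm)

lemma SE_ball {R : ℝ} {u v : ℂ} (hu : 0 < u.re) (hR : 2 * R < ‖u‖) (hv : ‖v - u‖ ≤ ‖u‖ / 4) : v ∈ SE R := by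
  have hup : 0 < ‖u‖ := norm_pos_iff.2 (by rintro rfl; simp at hu)
  refine ⟨?_, ?_⟩
  · rw [Complex.mem_slitPlane_iff]
    by_contra hc
    push Not at hc
    have h1 : ‖v - u‖ ^ 2 < ‖u‖ ^ 2 := by nlinarith [norm_nonneg (v - u)]
    rw [← Complex.normSq_eq_norm_sq, ← Complex.normSq_eq_norm_sq, Complex.normSq_apply, Complex.normSq_apply] at h1
    simp [hc.2] at h1
    nlinarith [hc.1]
  · have := norm_sub_norm_le u v
    rw [norm_sub_rev] at this
    rcases le_or_gt 0 R with h | h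
    · linarith
    · exact lt_of_lt_of_le h (norm_nonneg _)

lemma HP_norm {R : ℝ} {u : ℂ} (hu : u ∈ HP R) : R < ‖u‖ :=
  lt_of_lt_of_le hu (Complex.re_le_norm u)

lemma core_sol (R0 : ℝ) (hR0 : 0 < R0) (Q : ℂ → ℂ) (κ : ℂ) (hκ : ‖κ‖ = 1) (hκr : 7/10 ≤ κ.re)
    (hQd : DifferentiableOn ℂ Q (SE R0)) (hQ : ∀ u ∈ SE R0, ‖Q u / κ ^ 2 - 1‖ ≤ 1 / 10) :
    ∃ R : ℝ, R0 ≤ R ∧ 1 ≤ R ∧ ∃ C : ℝ, ∃ Z ω wp wm wp1 wm1 ξ : ℂ → ℂ,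
      (∀ u ∈ HP R, HasDerivAt Z (ω u) u ∧ ‖ω u - κ‖ ≤ 1 / 10) ∧
      (∀ u ∈ HP R, wp u ≠ 0 ∧ HasDerivAt wp (wp1 u) u ∧ HasDerivAt wp1 (-Q u * wp u) u) ∧
      (∀ u ∈ HP R, wm u ≠ 0 ∧ HasDerivAt wm (wm1 u) u ∧ HasDerivAt wm1 (-Q u * wm u) u) ∧
      (∀ u ∈ HP R, wp u / wm u = Complex.exp (2 * Complex.I * Z u) * ξ u ∧ 1/3 ≤ ‖ξ u‖ ∧ ‖ξ u‖ ≤ 3 ∧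
        ‖ξ u - 1‖ ≤ C / u.re) := by
  have hκ0 : κ ≠ 0 := by rintro rfl; simp at hκ
  let ω : ℂ → ℂ := fun u => κ * Complex.exp (Complex.log (Q u / κ ^ 2) / 2)
  have hslit1 : ∀ u ∈ SE R0, Q u / κ ^ 2 ∈ Complex.slitPlane := by
    intro u hu
    left
    have := (Complex.abs_re_le_norm (Q u / κ ^ 2 - 1)).trans (hQ u hu)
    have := abs_le.1 this
    simp only [Complex.sub_re, Complex.one_re] at this
    linarith
  have hωsq : ∀ u ∈ SE R0, ω u ^ 2 = Q u := by
    intro u hu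
    have h0 := Complex.slitPlane_ne_zero (hslit1 u hu)
    simp only [ω]
    rw [mul_pow, ← Complex.exp_nat_mul]
    push_cast
    rw [mul_div_cancel₀ _ (by norm_num), Complex.exp_log h0]
    field_simp
  have hωκ : ∀ u ∈ SE R0, ‖ω u - κ‖ ≤ 1 / 10 := by
    intro u hu
    have h0 := Complex.slitPlane_ne_zero (hslit1 u hu)
    set s := Complex.exp (Complex.log (Q u / κ ^ 2) / 2) with hs
    have hss : s ^ 2 = Q u / κ ^ 2 := by
      rw [hs, ← Complex.exp_nat_mul]
      push_cast
      rw [mul_div_cancel₀ _ (by norm_num), Complex.exp_log h0]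
    have hre : 0 ≤ s.re := by
      rw [hs, Complex.exp_re]
      apply mul_nonneg (Real.exp_pos _).le
      apply Real.cos_nonneg_of_mem_Icc
      have h1 := Complex.arg_le_pi (Q u / κ ^ 2)
      have h2 := Complex.neg_pi_lt_arg (Q u / κ ^ 2)
      have : (Complex.log (Q u / κ ^ 2) / 2).im = Complex.arg (Q u / κ ^ 2) / 2 := by
        rw [show (2:ℂ) = ((2:ℝ):ℂ) by norm_num, Complex.div_ofReal_im, Complex.log_im]
      rw [this]; constructor <;> linarith
    have h1 : 1 ≤ ‖s + 1‖ := by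
      refine le_trans ?_ (Complex.re_le_norm _)
      simp; exact hre
    have h2 := hQ u hu
    rw [← hss, show s ^ 2 - 1 = (s - 1) * (s + 1) by ring, norm_mul] at h2
    have : ω u - κ = κ * (s - 1) := by simp only [ω, ← hs]; ring
    rw [this, norm_mul, hκ, one_mul]
    nlinarith [norm_nonneg (s - 1)]
  have hωre : ∀ u ∈ SE R0, 6/10 ≤ (ω u).re := by
    intro u hu
    have := abs_le.1 ((Complex.abs_re_le_norm (ω u - κ)).trans (hωκ u hu))
    simp only [Complex.sub_re] at this
    linarith
  have hωsl : ∀ u ∈ SE R0, ω u ∈ Complex.slitPlane := fun u hu => Or.inl (by linarith [hωre u hu])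
  have hωd : DifferentiableOn ℂ ω (SE R0) := by
    apply DifferentiableOn.const_mul
    apply DifferentiableOn.cexp
    apply DifferentiableOn.div_const
    exact (hQd.div_const _).clog hslit1
  let V : ℂ → ℂ := fun u => Complex.exp (-Complex.log (ω u) / 2)
  have hVd : DifferentiableOn ℂ V (SE R0) := ((hωd.clog hωsl).neg.div_const _).cexp
  have hV2 : ∀ u ∈ SE R0, V u ^ 2 * ω u = 1 := by
    intro u hu
    have h0 := Complex.slitPlane_ne_zero (hωsl u hu)
    simp only [V]
    rw [← Complex.exp_nat_mul]
    push_cast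
    rw [mul_div_cancel₀ _ (by norm_num), Complex.exp_neg, Complex.exp_log h0, inv_mul_cancel₀ h0]
  have hV0 : ∀ u, V u ≠ 0 := fun u => Complex.exp_ne_zero _
  have hVb : ∀ u ∈ SE R0, ‖V u‖ ≤ 2 := by
    intro u hu
    have h1 := congrArg norm (hV2 u hu)
    rw [norm_mul, norm_pow, norm_one] at h1
    have h2 := hωre u hu
    have h3 := Complex.re_le_norm (ω u)
    by_contra hc
    push Not at hc
    nlinarith [norm_nonneg (V u), norm_nonneg (ω u)]
  set R : ℝ := 2 * R0 + 4 * 128 * Real.pi with hRdef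
  have hpi := Real.pi_gt_three
  have hRpos : 0 < R := by positivity
  have hsub : HP R ⊆ SE R0 := by
    intro u hu
    have h1 := HP_norm hu
    have h2 : R < u.re := hu
    exact ⟨Or.inl (by linarith), by linarith⟩
  have hopen := SE_open R0
  have hV1 : ∀ u ∈ HP R, HasDerivAt V (deriv V u) u := fun u hu =>
    (hVd.differentiableAt (hopen.mem_nhds (hsub hu))).hasDerivAt
  have hVd1 := hVd.deriv hopen
  have hV2' : ∀ u ∈ HP R, HasDerivAt (deriv V) (deriv (deriv V) u) u := fun u hu =>
    (hVd1.differentiableAt (hopen.mem_nhds (hsub hu))).hasDerivAt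
  have hVd2 := hVd1.deriv hopen
  have hVb2 : ∀ u ∈ HP R, ‖deriv (deriv V) u‖ ≤ 64 / ‖u‖ ^ 2 := by
    intro u hu
    have hup : 0 < ‖u‖ := by have := HP_norm hu; linarith
    have hre : 0 < u.re := lt_trans hRpos hu
    have h2R : 2 * R0 < ‖u‖ := by have := HP_norm hu; linarith
    have hball : Metric.closedBall u (‖u‖ / 4) ⊆ SE R0 := by
      intro v hv
      rw [mem_closedBall_iff_norm] at hv
      exact SE_ball hre h2R hv
    have := Complex.norm_iteratedDeriv_le_of_forall_mem_sphere_norm_le (n := 2) (c := u) (R := ‖u‖ / 4) (C := 2) (f := V) (by positivity)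
      (by
        apply DifferentiableOn.diffContOnCl
        rw [closure_ball _ (by positivity)]
        exact hVd.mono hball)
      (fun z hz => hVb z (hball (Metric.sphere_subset_closedBall hz)))
    rw [iteratedDeriv_succ, iteratedDeriv_one] at this
    refine this.trans (le_of_eq ?_)
    norm_num [Nat.factorial]
    field_simp
    norm_num
  obtain ⟨Z, hZ⟩ := HP_primitive R ω (hωd.mono hsub)
  have hωV : ∀ u ∈ HP R, ω u = 1 / V u ^ 2 := by
    intro u hu
    rw [eq_div_iff (pow_ne_zero 2 (hV0 u)), mul_comm]; exact hV2 u (hsub hu)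
  let G : ℂ → ℂ := fun u => V u * deriv (deriv V) u
  have hGd : DifferentiableOn ℂ G (HP R) := ((hVd.mul hVd2)).mono hsub
  have hGb : ∀ u ∈ HP R, ‖G u‖ ≤ 128 / ‖u‖ ^ 2 := by
    intro u hu
    simp only [G, norm_mul]
    calc _ ≤ 2 * (64 / ‖u‖ ^ 2) := mul_le_mul (hVb u (hsub hu)) (hVb2 u hu) (norm_nonneg _) (by norm_num)
      _ = _ := by ring
  have hmono : ∀ (d : ℂ), d = Complex.I ∨ d = -Complex.I → ∀ u ∈ HP R, ∀ s : ℝ, 0 ≤ s →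
      0 ≤ d.im * (Z (u + s * d) - Z u).im := by
    intro d hd u hu s hs
    have hdre : d.re = 0 := by rcases hd with rfl | rfl <;> simp
    have hder : ∀ s : ℝ, HasDerivAt (fun s : ℝ => d.im * (Z (u + s * d)).im) (d.im * (ω (u + s * d) * d).im) s := by
      intro s
      have hray0 : HasDerivAt (fun τ : ℝ => u + τ * d) d s := by
        have := (Complex.ofRealCLM.hasDerivAt (x := s)).mul_const d
        simpa using this.const_add u
      have h1 : HasDerivAt (fun s : ℝ => Z (u + s * d)) (ω (u + s * d) * d) s :=
        HasDerivAt.comp s (hZ _ (ray_mem hdre s hu)) hray0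
      have h2 : HasDerivAt (fun s : ℝ => (Z (u + s * d)).im) ((ω (u + s * d) * d).im) s :=
        (Complex.imCLM.hasFDerivAt.comp_hasDerivAt s h1)
      exact h2.const_mul _
    have hm : Monotone (fun s : ℝ => d.im * (Z (u + s * d)).im) := by
      apply monotone_of_deriv_nonneg (fun s => (hder s).differentiableAt)
      intro s
      rw [(hder s).deriv]
      have := hωre _ (hsub (ray_mem hdre s hu))
      generalize ω (u + s * d) = W at *
      rcases hd with rfl | rfl <;> simp <;> linarith
    have := hm hs
    simp only [Complex.ofReal_zero, zero_mul, add_zero] at this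
    rw [Complex.sub_im]; linarith
  have hCR : 4 * 128 * Real.pi ≤ R := by rw [hRdef]; linarith
  have hω0 : ∀ u ∈ HP R, ω u ≠ 0 := fun u hu => Complex.slitPlane_ne_zero (hωsl u (hsub hu))
  obtain ⟨hp, Jp, hp1, hp2, hp3⟩ := volterra R 128 hRpos (by norm_num) G Z ω hGd hZ hω0 1 Complex.I (by simp) (by simp) (by simp)
    hGb hCR (by intro u hu s hs; simpa using hmono Complex.I (Or.inl rfl) u hu s hs)
  obtain ⟨hm, Jm, hm1, hm2, hm3⟩ := volterra R 128 hRpos (by norm_num) G (fun u => -Z u) (fun u => -ω u) hGd (fun u hu => (hZ u hu).neg)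
    (fun u hu => neg_ne_zero.2 (hω0 u hu)) (-1) (-Complex.I) (by simp) (by simp) (by simp)
    hGb hCR (by
      intro u hu s hs
      have := hmono (-Complex.I) (Or.inr rfl) u hu s hs
      simp at this ⊢; linarith)
  obtain ⟨wp1, hwp⟩ := wkb_sol R V (deriv V) (deriv (deriv V)) Z hp Jp Q 1 (by norm_num) hV1 hV2' (fun u _ => hV0 u)
    (fun u hu => by rw [← hωV u hu]; exact hZ u hu)
    (fun u hu => by rw [← hωsq u (hsub hu)]; linear_combination (V u ^ 2 * ω u + 1) * hV2 u (hsub hu))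
    (fun u hu => by rw [← hωV u hu]; refine (hp2 u hu).congr_deriv (by ring))
    (fun u hu => hp3 u hu)
  obtain ⟨wm1, hwm⟩ := wkb_sol R V (deriv V) (deriv (deriv V)) (fun u => -Z u) hm Jm Q (-1) (by norm_num) hV1 hV2' (fun u _ => hV0 u)
    (fun u hu => by rw [neg_div, ← hωV u hu]; exact (hZ u hu).neg)
    (fun u hu => by rw [← hωsq u (hsub hu)]; linear_combination (V u ^ 2 * ω u + 1) * hV2 u (hsub hu))
    (fun u hu => by rw [← hωV u hu]; refine (hm2 u hu).congr_deriv (by ring))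
    (fun u hu => hm3 u hu)
  have hK : ∀ u ∈ HP R, 2 * 128 * Real.pi / u.re ≤ 1 / 2 := by
    intro u hu
    have hu' : R < u.re := hu
    rw [div_le_iff₀ (by linarith)]; linarith
  have hhb : ∀ (h : ℂ → ℂ), (∀ u ∈ HP R, ‖h u - 1‖ ≤ 2 * 128 * Real.pi / u.re) → ∀ u ∈ HP R, 1/2 ≤ ‖h u‖ ∧ ‖h u‖ ≤ 3/2 := by
    intro h hh u hu
    have h1 := (hh u hu).trans (hK u hu)
    have h2 := norm_sub_norm_le (h u) 1
    have h3 := norm_sub_norm_le 1 (h u)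
    rw [norm_sub_rev] at h3
    rw [norm_one] at h2 h3
    constructor <;> linarith
  refine ⟨R, by linarith, by linarith, 4 * (2 * 128 * Real.pi), Z, ω, _, _, wp1, wm1, fun u => hp u / hm u,
    fun u hu => ⟨hZ u hu, hωκ u (hsub hu)⟩, fun u hu => ⟨?_, hwp u hu⟩, fun u hu => ⟨?_, hwm u hu⟩, fun u hu => ?_⟩
  · have := (hhb hp hp1 u hu).1
    have h0 : hp u ≠ 0 := by intro h; rw [h] at this; norm_num at this
    exact mul_ne_zero (mul_ne_zero (hV0 u) (Complex.exp_ne_zero _)) h0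
  · have := (hhb hm hm1 u hu).1
    have h0 : hm u ≠ 0 := by intro h; rw [h] at this; norm_num at this
    exact mul_ne_zero (mul_ne_zero (hV0 u) (Complex.exp_ne_zero _)) h0
  · obtain ⟨a1, a2⟩ := hhb hp hp1 u hu
    obtain ⟨b1, b2⟩ := hhb hm hm1 u hu
    have h0 : hm u ≠ 0 := by intro h; rw [h] at b1; norm_num at b1
    have hb : 0 < ‖hm u‖ := by linarith
    refine ⟨?_, ?_, ?_, ?_⟩
    · have e1 : Complex.exp (2 * Complex.I * Z u) = (Complex.exp (Complex.I * Z u)) ^ 2 := by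
        rw [← Complex.exp_nat_mul]; congr 1; push_cast; ring
      have e2 : Complex.exp (Complex.I * -Z u) = (Complex.exp (Complex.I * Z u))⁻¹ := by
        rw [← Complex.exp_neg]; congr 1; ring
      have hE := Complex.exp_ne_zero (Complex.I * Z u)
      have hv := hV0 u
      simp only [e1, e2]
      generalize Complex.exp (Complex.I * Z u) = E at *
      field_simp
    · rw [norm_div, le_div_iff₀ hb]; linarith
    · rw [norm_div, div_le_iff₀ hb]; linarith
    · have : hp u / hm u - 1 = ((hp u - 1) - (hm u - 1)) / hm u := by field_simp; ring
      rw [this, norm_div, div_le_iff₀ hb]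
      have h1 := norm_sub_le (hp u - 1) (hm u - 1)
      have h2 := hp1 u hu
      have h3 := hm1 u hu
      have : 4 * (2 * 128 * Real.pi) / u.re = 4 * (2 * 128 * Real.pi / u.re) := by ring
      rw [this]
      have h4 : 0 ≤ 2 * 128 * Real.pi / u.re := (norm_nonneg _).trans h2
      nlinarith


lemma meromorphicAt_of_pole (f : ℂ → ℂ) (p : ℂ) (h1 : ∀ᶠ z in 𝓝[≠] p, AnalyticAt ℂ f z)
    (h2 : Tendsto (fun z => ‖f z‖) (𝓝[≠] p) atTop) : MeromorphicAt f p := by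
  have h3 : ∀ᶠ z in 𝓝[≠] p, f z ≠ 0 := by
    filter_upwards [h2.eventually_gt_atTop 0] with z hz
    exact norm_pos_iff.1 hz
  let g : ℂ → ℂ := Function.update (fun z => (f z)⁻¹) p 0
  have hg : AnalyticAt ℂ g p := by
    apply Complex.analyticAt_of_differentiable_on_punctured_nhds_of_continuousAt
    · filter_upwards [h1, h3, self_mem_nhdsWithin] with z a b c
      have : g =ᶠ[𝓝 z] fun z => (f z)⁻¹ := by
        filter_upwards [isOpen_ne.mem_nhds c] with y hy
        simp [g, hy]
      exact (this.differentiableAt_iff).2 (a.differentiableAt.inv b)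
    · rw [continuousAt_update_same]
      exact (tendsto_norm_atTop_iff_cobounded.1 h2 |> tendsto_inv₀_cobounded.comp)
  refine (hg.meromorphicAt.inv).congr ?_
  filter_upwards [self_mem_nhdsWithin] with z hz
  have hz' : z ≠ p := hz
  simp [g, hz']

lemma local_const (g : ℂ → ℂ) (u0 : ℂ) (h : ∀ᶠ u in 𝓝 u0, HasDerivAt g 0 u) : ∀ᶠ u in 𝓝 u0, g u = g u0 := by
  obtain ⟨ε, hε, hb⟩ := Metric.eventually_nhds_iff_ball.1 h
  refine Metric.eventually_nhds_iff_ball.2 ⟨ε, hε, fun u hu => ?_⟩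
  exact (Metric.isOpen_ball (x := u0) (ε := ε)).is_const_of_deriv_eq_zero (convex_ball u0 ε).isPreconnected
    (fun z hz => (hb z hz).differentiableAt.differentiableWithinAt) (fun z hz => (hb z hz).deriv) hu (Metric.mem_ball_self hε)

lemma local_rep (F Q : ℂ → ℂ) (u0 : ℂ) (hF : AnalyticAt ℂ F u0) (hF' : deriv F u0 ≠ 0)
    (hS : ∀ᶠ u in 𝓝 u0, schwarzian F u = 2 * Q u) :
    ∃ (v : ℂ → ℂ) (v1 c0 : ℂ), c0 ≠ 0 ∧ (∀ u, v u ≠ 0) ∧ ∀ w w1 : ℂ → ℂ,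
      (∀ᶠ u in 𝓝 u0, HasDerivAt w (w1 u) u ∧ HasDerivAt w1 (-Q u * w u) u) →
      ∃ A B : ℂ, (∀ᶠ u in 𝓝 u0, w u = v u * (A + B * F u)) ∧ B * c0 = v u0 * w1 u0 - v1 * w u0 := by
  set c0 := deriv F u0 with hc0
  have hF1 := hF.deriv
  have hF2 := hF1.deriv
  let v : ℂ → ℂ := fun u => Complex.exp (-Complex.log (deriv F u / c0) / 2)
  have e1 : ∀ᶠ u in 𝓝 u0, deriv F u / c0 ∈ Complex.slitPlane := by
    have : ContinuousAt (fun u => deriv F u / c0) u0 := hF1.continuousAt.div_const _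
    apply this.eventually (Complex.isOpen_slitPlane.mem_nhds _)
    show deriv F u0 / c0 ∈ Complex.slitPlane
    rw [← hc0, div_self hF']
    exact Complex.one_mem_slitPlane
  have hne : ∀ u, v u ≠ 0 := fun u => Complex.exp_ne_zero _
  let v1 : ℂ → ℂ := fun u => -(deriv (deriv F) u / deriv F u) / 2 * v u
  have hv : ∀ᶠ u in 𝓝 u0, HasDerivAt v (v1 u) u ∧ deriv F u ≠ 0 ∧ v u ^ 2 * deriv F u = c0 := by
    filter_upwards [e1, hF1.eventually_analyticAt] with u hu hu2
    have h0 : deriv F u ≠ 0 := by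
      intro h; rw [h, zero_div] at hu; exact Complex.zero_notMem_slitPlane hu
    refine ⟨?_, h0, ?_⟩
    · have := (((hu2.differentiableAt.hasDerivAt.div_const c0).clog hu).neg.div_const 2).cexp
      refine this.congr_deriv ?_
      simp only [v1, v, Pi.neg_apply]
      generalize Complex.exp (-Complex.log (deriv F u / c0) / 2) = E
      field_simp
    · simp only [v]
      rw [← Complex.exp_nat_mul]
      push_cast
      rw [mul_div_cancel₀ _ (by norm_num), Complex.exp_neg, Complex.exp_log (Complex.slitPlane_ne_zero hu)]
      field_simp
  have hv1 : ∀ᶠ u in 𝓝 u0, HasDerivAt v1 (-Q u * v u) u := by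
    filter_upwards [hv, hF1.eventually_analyticAt, hF2.eventually_analyticAt, hS] with u hu a1 a2 hs
    have := ((a2.differentiableAt.hasDerivAt.div a1.differentiableAt.hasDerivAt hu.2.1).neg.div_const 2).mul hu.1
    refine this.congr_deriv ?_
    have hq : Q u = schwarzian F u / 2 := by rw [hs]; ring
    have := hu.2.1
    simp only [v1, hq, schwarzian, Pi.neg_apply, Pi.div_apply]
    field_simp
    ring
  refine ⟨v, v1 u0, c0, hF', hne, ?_⟩
  intro w w1 hw
  let b : ℂ → ℂ := fun u => v u * w1 u - v1 u * w u
  have hb : ∀ᶠ u in 𝓝 u0, b u = b u0 := by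
    apply local_const
    filter_upwards [hv, hv1, hw] with u a1 a2 a3
    have := (a1.1.mul a3.2).sub (a2.mul a3.1)
    refine this.congr_deriv ?_
    ring
  let B := b u0 / c0
  have hA : ∀ᶠ u in 𝓝 u0, w u / v u - B * F u = w u0 / v u0 - B * F u0 := by
    apply local_const (fun u => w u / v u - B * F u)
    filter_upwards [hv, hw, hb, hF.eventually_analyticAt] with u a1 a3 a4 a5
    have := (a3.1.div a1.1 (hne u)).sub ((a5.differentiableAt.hasDerivAt).const_mul B)
    refine this.congr_deriv ?_
    simp only [B]
    rw [← a4, ← a1.2.2]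
    have := hne u
    have := a1.2.1
    simp only [b]
    field_simp
    ring
  refine ⟨w u0 / v u0 - B * F u0, B, ?_, ?_⟩
  · filter_upwards [hA] with u hu
    have := hne u
    rw [← hu]; field_simp; ring
  · simp only [B, b]; field_simp

/-- The Mobius value. -/
def mv (A B A' B' r : ℂ) : Option ℂ :=
  open scoped Classical in if B' * r - B = 0 then none else some ((A - A' * r) / (B' * r - B))

def ell (A B A' B' : ℂ) : Option ℂ → ℂ → ℂ
  | Option.none, r => B' * r - B
  | Option.some a, r => a * (B' * r - B) - (A - A' * r)

def ca : Option ℂ → ℝ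
  | Option.none => 1
  | Option.some a => Real.sqrt (1 + ‖a‖ ^ 2)

lemma ca_pos (a : Option ℂ) : 0 < ca a := by
  cases a with
  | none => simp [ca]
  | some a => simp only [ca]; positivity

def rho (A B A' B' r : ℂ) : ℝ := Real.sqrt (‖B' * r - B‖ ^ 2 + ‖A - A' * r‖ ^ 2)

lemma NM_ne {A B A' B' : ℂ} (hdet : A * B' - A' * B ≠ 0) (r : ℂ) : B' * r - B ≠ 0 ∨ A - A' * r ≠ 0 := by
  by_contra hc
  push Not at hc
  apply hdet
  have h1 : B = B' * r := by linear_combination -hc.1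
  have h2 : A = A' * r := by linear_combination hc.2
  rw [h1, h2]; ring

lemma rho_pos {A B A' B' : ℂ} (hdet : A * B' - A' * B ≠ 0) (r : ℂ) : 0 < rho A B A' B' r := by
  apply Real.sqrt_pos.2
  rcases NM_ne hdet r with h | h
  · have := norm_pos_iff.2 h; positivity
  · have := norm_pos_iff.2 h; positivity

lemma chordal_mv {A B A' B' : ℂ} (hdet : A * B' - A' * B ≠ 0) (a : Option ℂ) (r : ℂ) :
    chordal (mv A B A' B' r) a = ‖ell A B A' B' a r‖ / (rho A B A' B' r * ca a) := by
  have hne := NM_ne hdet r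
  by_cases hN : B' * r - B = 0
  · have hM : A - A' * r ≠ 0 := by simpa [hN] using hne
    have : rho A B A' B' r = ‖A - A' * r‖ := by
      simp [rho, hN, Real.sqrt_sq]
    have hp := norm_pos_iff.2 hM
    rw [this]
    cases a with
    | none => simp [mv, hN, chordal, ell]
    | some a => 
      have h1 : ell A B A' B' (some a) r = -(A - A' * r) := by simp only [ell, hN]; ring
      rw [h1, norm_neg]
      simp only [mv, hN, chordal, ca, if_true]
      field_simp
  · have hp := norm_pos_iff.2 hN
    have hmv : mv A B A' B' r = some ((A - A' * r) / (B' * r - B)) := by simp [mv, hN]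
    have hr : rho A B A' B' r = ‖B' * r - B‖ * Real.sqrt (1 + ‖(A - A' * r) / (B' * r - B)‖ ^ 2) := by
      rw [rho]
      nth_rw 2 [← Real.sqrt_sq (norm_nonneg (B' * r - B))]
      rw [← Real.sqrt_mul (by positivity)]
      congr 1
      rw [norm_div]
      field_simp
    rw [hmv, hr]
    have hp' := hp.ne'
    cases a with
    | none => 
      simp only [chordal, ell, ca, mul_one]
      generalize ‖B' * r - B‖ = n at *
      generalize √(1 + ‖(A - A' * r) / (B' * r - B)‖ ^ 2) = m
      rw [div_mul_eq_div_div, div_self hp']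
    | some a =>
      simp only [chordal, ell, ca]
      rw [Real.sqrt_mul (by positivity)]
      have : a * (B' * r - B) - (A - A' * r) = -((B' * r - B) * ((A - A' * r) / (B' * r - B) - a)) := by
        field_simp; ring
      rw [this, norm_neg, norm_mul]
      have : 0 < Real.sqrt (1 + ‖(A - A' * r) / (B' * r - B)‖ ^ 2) := by positivity
      have : 0 < Real.sqrt (1 + ‖a‖ ^ 2) := by positivity
      rw [mul_assoc, mul_div_mul_left _ _ hp']

lemma ell_affine (A B A' B' : ℂ) (a : Option ℂ) : ∃ α β : ℂ, ∀ r, ell A B A' B' a r = α * r - β := by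
  cases a with
  | none => exact ⟨B', B, fun r => rfl⟩
  | some a => exact ⟨a * B' + A', a * B + A, fun r => by simp only [ell]; ring⟩

lemma ell_ne {A B A' B' : ℂ} (hdet : A * B' - A' * B ≠ 0) (a : Option ℂ) (α β : ℂ)
    (h : ∀ r, ell A B A' B' a r = α * r - β) : α ≠ 0 ∨ β ≠ 0 := by
  by_contra hc
  push Not at hc
  apply hdet
  obtain ⟨rfl, rfl⟩ := hc
  cases a with
  | none =>
    have h0 := h 0
    have h1 := h 1
    simp [ell] at h0 h1
    rw [h0, sub_zero] at h1
    rw [h0, h1]; ring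
  | some a =>
    have h0 := h 0
    have h1 := h 1
    simp [ell] at h0 h1
    have e1 : A = -a * B := by linear_combination -h0
    have e2 : A' = -a * B' := by linear_combination h1 - h0
    rw [e1, e2]; ring

/-- along a filter with bounded `r`, chordal convergence forces convergence of `r` -/
lemma mv_lim {A B A' B' : ℂ} (hdet : A * B' - A' * B ≠ 0) (a : Option ℂ) {ι : Type*} (l : Filter ι) [l.NeBot] (r : ι → ℂ)
    (M : ℝ) (hM : ∀ᶠ i in l, ‖r i‖ ≤ M) (h : Tendsto (fun i => chordal (mv A B A' B' (r i)) a) l (𝓝 0)) :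
    ∃ ρ, Tendsto r l (𝓝 ρ) ∧ ell A B A' B' a ρ = 0 := by
  have h1 : Tendsto (fun i => ell A B A' B' a (r i)) l (𝓝 0) := by
    rw [tendsto_zero_iff_norm_tendsto_zero]
    let K := Real.sqrt ((‖B'‖ * M + ‖B‖) ^ 2 + (‖A‖ + ‖A'‖ * M) ^ 2) * ca a
    have hle : ∀ᶠ i in l, ‖ell A B A' B' a (r i)‖ ≤ chordal (mv A B A' B' (r i)) a * K := by
      filter_upwards [hM] with i hi
      have hr := rho_pos hdet (r i)
      have hc := ca_pos a
      rw [chordal_mv hdet, div_mul_eq_mul_div, le_div_iff₀ (by positivity)]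
      apply mul_le_mul_of_nonneg_left _ (norm_nonneg _)
      apply mul_le_mul_of_nonneg_right _ hc.le
      apply Real.sqrt_le_sqrt
      have e1 : ‖B' * r i - B‖ ≤ ‖B'‖ * M + ‖B‖ := (norm_sub_le _ _).trans (by rw [norm_mul]; gcongr)
      have e2 : ‖A - A' * r i‖ ≤ ‖A‖ + ‖A'‖ * M := (norm_sub_le _ _).trans (by rw [norm_mul]; gcongr)
      gcongr
    have := h.mul_const K
    rw [zero_mul] at this
    exact squeeze_zero' (Eventually.of_forall fun _ => norm_nonneg _) hle this
  obtain ⟨α, β, hab⟩ := ell_affine A B A' B' a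
  have hα : α ≠ 0 := by
    intro h0
    have hβ : β ≠ 0 := by
      rcases ell_ne hdet a α β hab with h | h
      · exact absurd h0 h
      · exact h
    simp only [hab, h0, zero_mul, zero_sub] at h1
    have := tendsto_nhds_unique h1 tendsto_const_nhds
    apply hβ; linear_combination this
  refine ⟨β / α, ?_, by rw [hab]; field_simp; ring⟩
  have := (h1.add_const β).div_const α
  simp only [hab] at this
  rw [zero_add] at this
  refine this.congr fun i => ?_
  field_simp; ring

lemma ell_zero_iff {A B A' B' : ℂ} (hdet : A * B' - A' * B ≠ 0) (a : Option ℂ) (r : ℂ)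
    (h : ell A B A' B' a r = 0) : a = mv A B A' B' r := by
  have hne := NM_ne hdet r
  cases a with
  | none => simp only [ell] at h; simp [mv, h]
  | some a =>
    simp only [ell] at h
    have hN : B' * r - B ≠ 0 := by
      intro h0
      rw [h0] at h hne
      simp at h hne
      exact hne (by linear_combination -h)
    simp only [mv, hN, if_false]
    congr 1
    rw [eq_div_iff hN]
    linear_combination h

lemma mv_close {A B A' B' : ℂ} (hdet : A * B' - A' * B ≠ 0) (t : ℝ) (ht : 0 < t) :
    ∃ δ > 0, ∀ r : ℂ, ‖r‖ < δ → chordal (mv A B A' B' r) (mv A B A' B' 0) < t := by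
  obtain ⟨α, β, hab⟩ := ell_affine A B A' B' (mv A B A' B' 0)
  have h0 : ell A B A' B' (mv A B A' B' 0) 0 = 0 := by
    by_cases hB : -B = 0
    · simp [mv, hB, ell]
    · have hB' : B ≠ 0 := by simpa using hB
      simp [mv, hB', ell]
      rw [div_neg, neg_mul, div_mul_cancel₀ _ hB']; ring
  have hcont : ContinuousAt (fun r => chordal (mv A B A' B' r) (mv A B A' B' 0)) 0 := by
    simp only [chordal_mv hdet, hab]
    apply ContinuousAt.div
    · fun_prop
    · unfold rho; fun_prop
    · exact (mul_pos (rho_pos hdet 0) (ca_pos _)).ne'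
  have := hcont.tendsto.eventually_lt_const (u := t) (by rw [chordal_mv hdet, h0]; simpa using ht)
  obtain ⟨δ, hδ, hh⟩ := Metric.eventually_nhds_iff_ball.1 this
  exact ⟨δ, hδ, fun r hr => hh r (by simpa using hr)⟩

lemma mv_inv (A B A' B' r : ℂ) (hr : r ≠ 0) : mv A B A' B' r = mv A' B' A B r⁻¹ := by
  have e : B * r⁻¹ - B' = -r⁻¹ * (B' * r - B) := by field_simp; ring
  have e2 : A' - A * r⁻¹ = -r⁻¹ * (A - A' * r) := by field_simp; ring
  unfold mv
  rw [e, e2]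
  by_cases h : B' * r - B = 0
  · simp [h]
  · have : -r⁻¹ * (B' * r - B) ≠ 0 := mul_ne_zero (neg_ne_zero.2 (inv_ne_zero hr)) h
    simp only [h, this, if_false]
    congr 1
    field_simp


lemma global_rep (R : ℝ) (F Q wp wm wp1 wm1 : ℂ → ℂ) (PF : Set ℂ)
    (hU : ∀ u ∈ HP R, u ∉ PF → AnalyticAt ℂ F u)
    (hP : ∀ u ∈ HP R, u ∈ PF → (∀ᶠ z in 𝓝[≠] u, z ∉ PF) ∧ Tendsto (fun z => ‖F z‖) (𝓝[≠] u) atTop)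
    (u0 : ℂ) (hu0 : u0 ∈ HP R) (hu0P : u0 ∉ PF) (hu0' : deriv F u0 ≠ 0)
    (hS : ∀ᶠ u in 𝓝 u0, schwarzian F u = 2 * Q u)
    (hwp : ∀ u ∈ HP R, wp u ≠ 0 ∧ HasDerivAt wp (wp1 u) u ∧ HasDerivAt wp1 (-Q u * wp u) u)
    (hwm : ∀ u ∈ HP R, wm u ≠ 0 ∧ HasDerivAt wm (wm1 u) u ∧ HasDerivAt wm1 (-Q u * wm u) u)
    (hr : ¬ ∃ k, ∀ u ∈ HP R, wp u / wm u = k) :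
    ∃ A B A' B' : ℂ, A * B' - A' * B ≠ 0 ∧ ∀ u ∈ HP R, valueAt F PF u = mv A B A' B' (wp u / wm u) := by
  have hopen := HP_open R
  obtain ⟨v, v1, c0, hc0, hv0, hrep⟩ := local_rep F Q u0 (hU u0 hu0 hu0P) hu0' hS
  obtain ⟨A, B, h1, h2⟩ := hrep wp wp1 (by
    filter_upwards [hopen.mem_nhds hu0] with u hu using (hwp u hu).2)
  obtain ⟨A', B', h1', h2'⟩ := hrep wm wm1 (by
    filter_upwards [hopen.mem_nhds hu0] with u hu using (hwm u hu).2)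
  have hdet : A * B' - A' * B ≠ 0 := by
    intro h0
    apply hr
    have e1 := h1.self_of_nhds
    have e1' := h1'.self_of_nhds
    have hW0 : wp u0 * wm1 u0 - wp1 u0 * wm u0 = 0 := by
      have : v u0 * (wp u0 * wm1 u0 - wp1 u0 * wm u0) = v u0 * c0 * (A * B' - A' * B) := by
        have : v u0 * (wp u0 * wm1 u0 - wp1 u0 * wm u0) = wp u0 * (B' * c0) - wm u0 * (B * c0) := by
          rw [h2, h2']; ring
        rw [this, e1, e1']; ring
      rw [h0, mul_zero] at this
      exact (mul_eq_zero.1 this).resolve_left (hv0 u0)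
    have hW : ∀ u ∈ HP R, wp u * wm1 u - wp1 u * wm u = 0 := by
      intro u hu
      rw [← hW0]
      have hd : ∀ z ∈ HP R, HasDerivAt (fun u => wp u * wm1 u - wp1 u * wm u) 0 z := by
        intro z hz
        have := ((hwp z hz).2.1.mul (hwm z hz).2.2).sub ((hwp z hz).2.2.mul (hwm z hz).2.1)
        exact this.congr_deriv (by ring)
      exact hopen.is_const_of_deriv_eq_zero (HP_preconn R) (f := fun u => wp u * wm1 u - wp1 u * wm u)
        (fun z hz => (hd z hz).differentiableAt.differentiableWithinAt) (fun z hz => (hd z hz).deriv) hu hu0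
    refine ⟨wp u0 / wm u0, fun u hu => ?_⟩
    have hd : ∀ z ∈ HP R, HasDerivAt (fun u => wp u / wm u) 0 z := by
      intro z hz
      have := (hwp z hz).2.1.div (hwm z hz).2.1 (hwm z hz).1
      refine this.congr_deriv ?_
      rw [div_eq_zero_iff]; left
      linear_combination -hW z hz
    exact hopen.is_const_of_deriv_eq_zero (HP_preconn R) (f := fun u => wp u / wm u)
        (fun z hz => (hd z hz).differentiableAt.differentiableWithinAt) (fun z hz => (hd z hz).deriv) hu hu0
  refine ⟨A, B, A', B', hdet, ?_⟩
  -- the meromorphic identity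
  let D : ℂ → ℂ := fun u => wp u * (A' + B' * F u) - wm u * (A + B * F u)
  have hF : MeromorphicOn F (HP R) := by
    intro u hu
    by_cases hp : u ∈ PF
    · apply meromorphicAt_of_pole F u _ (hP u hu hp).2
      filter_upwards [(hP u hu hp).1, mem_nhdsWithin_of_mem_nhds (hopen.mem_nhds hu)] with z a b using hU z b a
    · exact (hU u hu hp).meromorphicAt
  have hwpd : DifferentiableOn ℂ wp (HP R) := fun u hu => (hwp u hu).2.1.differentiableAt.differentiableWithinAt
  have hwmd : DifferentiableOn ℂ wm (HP R) := fun u hu => (hwm u hu).2.1.differentiableAt.differentiableWithinAt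
  have hwpa : ∀ u ∈ HP R, AnalyticAt ℂ wp u := fun u hu => hwpd.analyticAt (hopen.mem_nhds hu)
  have hwma : ∀ u ∈ HP R, AnalyticAt ℂ wm u := fun u hu => hwmd.analyticAt (hopen.mem_nhds hu)
  have hD : MeromorphicOn D (HP R) := by
    intro u hu
    exact ((hwpa u hu).meromorphicAt.mul ((MeromorphicAt.const A' u).add ((MeromorphicAt.const B' u).mul (hF u hu)))).sub
      ((hwma u hu).meromorphicAt.mul ((MeromorphicAt.const A u).add ((MeromorphicAt.const B u).mul (hF u hu))))
  have hD0 : meromorphicOrderAt D u0 = ⊤ := by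
    rw [meromorphicOrderAt_eq_top_iff]
    apply Filter.Eventually.filter_mono nhdsWithin_le_nhds
    filter_upwards [h1, h1'] with u a b
    simp only [D]
    rw [a, b]; ring
  have hDall : ∀ u ∈ HP R, ∀ᶠ z in 𝓝[≠] u, D z = 0 := by
    intro u hu
    rw [← meromorphicOrderAt_eq_top_iff]
    by_contra hc
    exact hD.meromorphicOrderAt_ne_top_of_isPreconnected (HP_preconn R) hu hu0 hc hD0
  intro u hu
  have hm0 := (hwm u hu).1
  by_cases hp : u ∈ PF
  · have hval : valueAt F PF u = none := by simp [valueAt, hp]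
    rw [hval]
    have ht := (hP u hu hp).2
    have hinv : Tendsto (fun z => (F z)⁻¹) (𝓝[≠] u) (𝓝 0) :=
      (tendsto_norm_atTop_iff_cobounded.1 ht |> tendsto_inv₀_cobounded.comp)
    have hl : Tendsto (fun z => wp z * (A' * (F z)⁻¹ + B') - wm z * (A * (F z)⁻¹ + B)) (𝓝[≠] u)
        (𝓝 (wp u * (A' * 0 + B') - wm u * (A * 0 + B))) := by
      have c1 : Tendsto wp (𝓝[≠] u) (𝓝 (wp u)) := (hwpa u hu).continuousAt.tendsto.mono_left nhdsWithin_le_nhds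
      have c2 : Tendsto wm (𝓝[≠] u) (𝓝 (wm u)) := (hwma u hu).continuousAt.tendsto.mono_left nhdsWithin_le_nhds
      exact (c1.mul ((hinv.const_mul A').add_const B')).sub (c2.mul ((hinv.const_mul A).add_const B))
    have hz : Tendsto (fun z => wp z * (A' * (F z)⁻¹ + B') - wm z * (A * (F z)⁻¹ + B)) (𝓝[≠] u) (𝓝 0) := by
      refine tendsto_const_nhds.congr' ?_
      filter_upwards [hDall u hu, ht.eventually_gt_atTop 0] with z a b
      have hf0 : F z ≠ 0 := norm_pos_iff.1 b
      have : wp z * (A' * (F z)⁻¹ + B') - wm z * (A * (F z)⁻¹ + B) = D z * (F z)⁻¹ := by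
        simp only [D]; field_simp
      rw [this, a, zero_mul]
    have := tendsto_nhds_unique hl hz
    have h0 : B' * (wp u / wm u) - B = 0 := by
      field_simp
      linear_combination this
    simp [mv, h0]
  · have hval : valueAt F PF u = some (F u) := by simp [valueAt, hp]
    rw [hval]
    have hc : ContinuousAt D u := by
      have := (hwpa u hu).continuousAt
      have := (hwma u hu).continuousAt
      have := (hU u hu hp).continuousAt
      simp only [D]; fun_prop
    have hDu : D u = 0 := by
      have h1 : Tendsto D (𝓝[≠] u) (𝓝 (D u)) := hc.tendsto.mono_left nhdsWithin_le_nhds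
      have h2 : Tendsto D (𝓝[≠] u) (𝓝 0) := tendsto_const_nhds.congr' (by
        filter_upwards [hDall u hu] with z hz using hz.symm)
      exact tendsto_nhds_unique h1 h2
    apply ell_zero_iff hdet
    simp only [ell]
    simp only [D] at hDu
    field_simp
    linear_combination hDu


lemma mp_discrete {f : ℂ → ℂ} {P : Set ℂ} (h : MeroPlane f P) (z : ℂ) : ∀ᶠ w in 𝓝[≠] z, w ∉ P := by
  have hfin := h.1 (Metric.closedBall z 1) (isCompact_closedBall z 1)
  have h2 : ((P ∩ Metric.closedBall z 1) \ {z}).Finite := hfin.subset sdiff_subset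
  have h3 : ((P ∩ Metric.closedBall z 1) \ {z})ᶜ ∈ 𝓝 z := h2.isClosed.isOpen_compl.mem_nhds (by simp)
  filter_upwards [mem_nhdsWithin_of_mem_nhds h3, self_mem_nhdsWithin,
    mem_nhdsWithin_of_mem_nhds (Metric.closedBall_mem_nhds z one_pos)] with w a b c d
  exact a ⟨⟨d, c⟩, b⟩

lemma mp_closed {f : ℂ → ℂ} {P : Set ℂ} (h : MeroPlane f P) : IsOpen Pᶜ := by
  rw [isOpen_iff_mem_nhds]
  intro z hz
  have := mp_discrete h z
  rw [eventually_nhdsWithin_iff] at this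
  filter_upwards [this] with w hw
  by_cases h : w = z
  · rw [h]; exact hz
  · exact hw h

lemma mp_countable {f : ℂ → ℂ} {P : Set ℂ} (h : MeroPlane f P) : P.Countable := by
  have : P = ⋃ n : ℕ, P ∩ Metric.closedBall 0 n := by
    rw [← inter_iUnion, Metric.iUnion_closedBall_nat, inter_univ]
  rw [this]
  exact countable_iUnion fun n => (h.1 _ (isCompact_closedBall _ _)).countable

lemma mp_pole {f : ℂ → ℂ} {P : Set ℂ} (h : MeroPlane f P) {z : ℂ} (hz : z ∈ P) :
    Tendsto (fun z => ‖f z‖) (𝓝[≠] z) atTop := by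
  refine (h.2.2 z hz).mono_left ?_
  rw [nhdsWithin, nhdsWithin, le_inf_iff]
  refine ⟨inf_le_left, ?_⟩
  rw [le_principal_iff]
  exact mp_discrete h z

lemma mp_mero {f : ℂ → ℂ} {P : Set ℂ} (h : MeroPlane f P) (z : ℂ) : MeromorphicAt f z := by
  by_cases hz : z ∈ P
  · apply meromorphicAt_of_pole f z _ (mp_pole h hz)
    filter_upwards [mp_discrete h z] with w hw using h.2.1 w hw
  · exact (h.2.1 z hz).meromorphicAt

lemma mp_conn {f : ℂ → ℂ} {P : Set ℂ} (h : MeroPlane f P) : IsPreconnected Pᶜ :=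
  ((mp_countable h).isPathConnected_compl_of_one_lt_rank (by simp)).isConnected.isPreconnected

lemma tm_deriv {f : ℂ → ℂ} {P : Set ℂ} (h : TranscMeroPlane f P) (z0 : ℂ) :
    ∀ᶠ z in 𝓝[≠] z0, z ∉ P ∧ deriv f z ≠ 0 := by
  have hm : ∀ z, MeromorphicAt (deriv f) z := fun z => (mp_mero h.1 z).deriv
  rcases (hm z0).eventually_eq_zero_or_eventually_ne_zero with h0 | h0
  · exfalso
    apply h.2
    have hall : ∀ z, ∀ᶠ w in 𝓝[≠] z, deriv f w = 0 := by
      intro z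
      rw [← meromorphicOrderAt_eq_top_iff] at h0 ⊢
      by_contra hc
      have hon : MeromorphicOn (deriv f) univ := fun z _ => hm z
      exact hon.meromorphicOrderAt_ne_top_of_isPreconnected isPreconnected_univ (mem_univ z) (mem_univ z0) hc h0
    have hd : ∀ z ∈ Pᶜ, deriv f z = 0 := by
      intro z hz
      have hc := (h.1.2.1 z hz).deriv.continuousAt
      have h1 : Tendsto (deriv f) (𝓝[≠] z) (𝓝 (deriv f z)) := hc.tendsto.mono_left nhdsWithin_le_nhds
      have h2 : Tendsto (deriv f) (𝓝[≠] z) (𝓝 0) := tendsto_const_nhds.congr' (by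
        filter_upwards [hall z] with z hz using hz.symm)
      exact tendsto_nhds_unique h1 h2
    obtain ⟨z1, hz1⟩ : (Pᶜ : Set ℂ).Nonempty :=
      ((mp_countable h.1).isPathConnected_compl_of_one_lt_rank (by simp)).nonempty
    refine ⟨Polynomial.C (f z1), 1, one_ne_zero, fun z hz _ => ?_⟩
    simp
    exact (mp_closed h.1).is_const_of_deriv_eq_zero (mp_conn h.1)
      (fun z hz => (h.1.2.1 z hz).differentiableAt.differentiableWithinAt) hd hz hz1
  · filter_upwards [h0, mp_discrete h.1 z0] with z a b using ⟨b, a⟩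

lemma schw_comp (f φ φ1 φ2 : ℂ → ℂ) (φ3 u0 : ℂ) (h1 : ∀ᶠ u in 𝓝 u0, HasDerivAt φ (φ1 u) u)
    (h2 : ∀ᶠ u in 𝓝 u0, HasDerivAt φ1 (φ2 u) u) (h3 : HasDerivAt φ2 φ3 u0) (hf : AnalyticAt ℂ f (φ u0))
    (hf' : deriv f (φ u0) ≠ 0) (hφ : φ1 u0 ≠ 0) :
    schwarzian (fun u => f (φ u)) u0 = schwarzian f (φ u0) * φ1 u0 ^ 2 + (φ3 / φ1 u0 - 3 / 2 * (φ2 u0 / φ1 u0) ^ 2) := by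
  have hc : ContinuousAt φ u0 := h1.self_of_nhds.continuousAt
  have hfa : ∀ᶠ u in 𝓝 u0, AnalyticAt ℂ f (φ u) := hc.eventually hf.eventually_analyticAt
  have e1 : ∀ᶠ u in 𝓝 u0, deriv (fun u => f (φ u)) u = deriv f (φ u) * φ1 u := by
    filter_upwards [h1, hfa] with u a b
    exact (b.differentiableAt.hasDerivAt.comp u a).deriv
  have e2 : ∀ᶠ u in 𝓝 u0, deriv (deriv (fun u => f (φ u))) u = deriv (deriv f) (φ u) * φ1 u * φ1 u + deriv f (φ u) * φ2 u := by
    filter_upwards [e1.eventually_nhds, h1, h2, hfa] with u a b c d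
    rw [EventuallyEq.deriv_eq a]
    have := (HasDerivAt.comp u d.deriv.differentiableAt.hasDerivAt b).mul c
    exact this.deriv
  have e3 : deriv (deriv (deriv (fun u => f (φ u)))) u0 = (deriv (deriv (deriv f)) (φ u0) * φ1 u0 * φ1 u0 + deriv (deriv f) (φ u0) * φ2 u0) * φ1 u0
      + deriv (deriv f) (φ u0) * φ1 u0 * φ2 u0 + (deriv (deriv f) (φ u0) * φ1 u0 * φ2 u0 + deriv f (φ u0) * φ3) := by
    rw [EventuallyEq.deriv_eq e2]
    have b := h1.self_of_nhds
    have c := h2.self_of_nhds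
    have d0 := HasDerivAt.comp u0 hf.deriv.differentiableAt.hasDerivAt b
    have d1 := HasDerivAt.comp u0 hf.deriv.deriv.differentiableAt.hasDerivAt b
    exact (((d1.mul c).mul c).add (d0.mul h3)).deriv
  unfold schwarzian
  rw [e3, e2.self_of_nhds, e1.self_of_nhds]
  field_simp
  ring

def phi (N : ℕ) (β u : ℂ) : ℂ := Complex.exp (2 / N * Complex.log u + β)

lemma phi_ne (N : ℕ) (β u : ℂ) : phi N β u ≠ 0 := Complex.exp_ne_zero _

lemma phi_deriv (N : ℕ) (β : ℂ) {u : ℂ} (hu : u ∈ Complex.slitPlane) :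
    HasDerivAt (phi N β) (2 / N * phi N β u / u) u := by
  have := (((Complex.hasDerivAt_log hu).const_mul (2 / (N:ℂ))).add_const β).cexp
  refine this.congr_deriv ?_
  simp only [phi]; ring

lemma phi_deriv1 (N : ℕ) (β : ℂ) {u : ℂ} (hu : u ∈ Complex.slitPlane) :
    HasDerivAt (fun u => 2 / N * phi N β u / u) (2 / N * (2 / N - 1) * phi N β u / u ^ 2) u := by
  have h0 := Complex.slitPlane_ne_zero hu
  have := ((phi_deriv N β hu).const_mul (2 / (N:ℂ))).div (hasDerivAt_id u) h0
  refine this.congr_deriv ?_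
  simp only [id]
  generalize phi N β u = E
  generalize (2 / (N:ℂ)) = m
  field_simp

lemma phi_deriv2 (N : ℕ) (β : ℂ) {u : ℂ} (hu : u ∈ Complex.slitPlane) :
    HasDerivAt (fun u => 2 / N * (2 / N - 1) * phi N β u / u ^ 2) (2 / N * (2 / N - 1) * (2 / N - 2) * phi N β u / u ^ 3) u := by
  have h0 := Complex.slitPlane_ne_zero hu
  have := ((phi_deriv N β hu).const_mul (2 / (N:ℂ) * (2 / N - 1))).div ((hasDerivAt_id u).pow 2) (pow_ne_zero 2 h0)
  refine this.congr_deriv ?_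
  simp only [id, Pi.pow_apply]
  generalize phi N β u = E
  generalize (2 / (N:ℂ)) = m
  field_simp
  ring

lemma phi_norm (N : ℕ) (β u : ℂ) : ‖phi N β u‖ = Real.exp (2 / N * Real.log ‖u‖ + β.re) := by
  rw [phi, Complex.norm_exp]
  congr 1
  rw [Complex.add_re, show (2 / (N:ℂ)) = ((2 / N : ℝ) : ℂ) by push_cast; rfl, Complex.re_ofReal_mul, Complex.log_re]

lemma phi_pow (N : ℕ) (hN : 1 ≤ N) (β u : ℂ) (hu : u ≠ 0) : phi N β u ^ N = u ^ 2 * Complex.exp (N * β) := by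
  have hN0 : (N:ℂ) ≠ 0 := by exact_mod_cast (by omega : N ≠ 0)
  rw [phi, ← Complex.exp_nat_mul]
  have : (N:ℂ) * (2 / N * Complex.log u + β) = (2:ℕ) * Complex.log u + N * β := by push_cast; field_simp
  rw [this, Complex.exp_add, Complex.exp_nat_mul, Complex.exp_log hu]

lemma schw_phi (f : ℂ → ℂ) (N : ℕ) (hN : 1 ≤ N) (β : ℂ) {u : ℂ} (hu : u ∈ Complex.slitPlane) (hf : AnalyticAt ℂ f (phi N β u))
    (hf' : deriv f (phi N β u) ≠ 0) :
    schwarzian (fun u => f (phi N β u)) u = schwarzian f (phi N β u) * (2 / N * phi N β u / u) ^ 2 + (1 - (2 / N) ^ 2) / (2 * u ^ 2) := by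
  have h0 := Complex.slitPlane_ne_zero hu
  have hN0 : (N:ℂ) ≠ 0 := by exact_mod_cast (by omega : N ≠ 0)
  have hsl := Complex.isOpen_slitPlane.mem_nhds hu
  have hne : 2 / N * phi N β u / u ≠ 0 := (div_ne_zero (mul_ne_zero (div_ne_zero two_ne_zero hN0) (phi_ne _ _ _)) h0)
  have h := schw_comp f (phi N β) (fun u => 2 / N * phi N β u / u) (fun u => 2 / N * (2 / N - 1) * phi N β u / u ^ 2)
    (2 / N * (2 / N - 1) * (2 / N - 2) * phi N β u / u ^ 3) u
    (by filter_upwards [hsl] with z hz using phi_deriv N β hz)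
    (by filter_upwards [hsl] with z hz using phi_deriv1 N β hz) (phi_deriv2 N β hu) hf hf' hne
  refine h.trans ?_
  have := phi_ne N β u
  have hm : (2 / (N:ℂ)) ≠ 0 := div_ne_zero two_ne_zero hN0
  generalize schwarzian f (phi N β u) = S
  clear h hne hf hf' hsl
  generalize phi N β u = E at *
  generalize (2 / (N:ℂ)) = m at *
  congr 1
  field_simp
  ring

lemma poly_ratio (p : Polynomial ℂ) (z : ℂ) (hz : z ≠ 0) : p.eval z = p.reverse.eval z⁻¹ * z ^ p.natDegree := by
  letI := invertibleOfNonzero hz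
  have := Polynomial.eval₂_reverse_mul_pow (RingHom.id ℂ) z p
  rw [invOf_eq_inv] at this
  exact this.symm

lemma poly_lim (p q : Polynomial ℂ) (hp : p ≠ 0) (hq : q ≠ 0) (N : ℕ) (hN : q.natDegree + N = p.natDegree + 2) :
    ∃ c : ℂ, c ≠ 0 ∧ ∀ ε > 0, ∃ R > 0, ∀ z : ℂ, R < ‖z‖ → q.eval z ≠ 0 ∧ ‖p.eval z * z ^ 2 / (q.eval z * z ^ N) - c‖ < ε := by
  refine ⟨p.reverse.eval 0 / q.reverse.eval 0, ?_, ?_⟩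
  · rw [← Polynomial.coeff_zero_eq_eval_zero, ← Polynomial.coeff_zero_eq_eval_zero, Polynomial.coeff_zero_reverse, Polynomial.coeff_zero_reverse]
    simp [hp, hq]
  · have hq0 : q.reverse.eval 0 ≠ 0 := by
      rw [← Polynomial.coeff_zero_eq_eval_zero, Polynomial.coeff_zero_reverse]; simp [hq]
    have hc : ContinuousAt (fun y => p.reverse.eval y / q.reverse.eval y) 0 :=
      p.reverse.continuous.continuousAt.div q.reverse.continuous.continuousAt hq0
    intro ε hε
    have h1 := Metric.continuousAt_iff'.1 hc ε hε
    have h2 := q.reverse.continuous.continuousAt.eventually_ne hq0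
    obtain ⟨δ, hδ, hh⟩ := Metric.eventually_nhds_iff_ball.1 (h1.and h2)
    refine ⟨1 / δ, by positivity, fun z hz => ?_⟩
    have hzn : 0 < ‖z‖ := lt_trans (by positivity) hz
    have hz0 : z ≠ 0 := norm_pos_iff.1 hzn
    obtain ⟨a, b⟩ := hh z⁻¹ (by
      simp only [Metric.mem_ball, dist_zero_right, norm_inv]
      rw [inv_lt_comm₀ hzn hδ, ← one_div]; exact hz)
    rw [dist_eq_norm] at a
    refine ⟨?_, ?_⟩
    · rw [poly_ratio q z hz0]; exact mul_ne_zero b (pow_ne_zero _ hz0)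
    · have : p.eval z * z ^ 2 / (q.eval z * z ^ N) = p.reverse.eval z⁻¹ / q.reverse.eval z⁻¹ := by
        rw [poly_ratio q z hz0, poly_ratio p z hz0, mul_assoc, mul_assoc, ← pow_add, ← pow_add, hN]
        rw [mul_div_mul_right _ _ (pow_ne_zero _ hz0)]
      rw [this]; exact a


lemma phi_large (N : ℕ) (hN : 1 ≤ N) (β : ℂ) (R : ℝ) : ∃ R' > 0, ∀ u : ℂ, R' < ‖u‖ → R < ‖phi N β u‖ := by
  have hN0 : (0:ℝ) < N := by exact_mod_cast hN
  have h1 : Tendsto (fun x : ℝ => Real.exp (2 / N * Real.log x + β.re)) atTop atTop := by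
    apply Real.tendsto_exp_atTop.comp
    apply tendsto_atTop_add_const_right
    exact Real.tendsto_log_atTop.const_mul_atTop (by positivity)
  obtain ⟨a, ha⟩ := (h1.eventually_gt_atTop R).exists_forall_of_atTop
  refine ⟨max a 1, by positivity, fun u hu => ?_⟩
  rw [phi_norm]
  exact ha _ ((le_max_left _ _).trans hu.le)

lemma Q_asymp (p q : Polynomial ℂ) (N : ℕ) (hN1 : 1 ≤ N) (c : ℂ) (hc : c ≠ 0)
    (hlim : ∀ ε > 0, ∃ R > 0, ∀ z : ℂ, R < ‖z‖ → q.eval z ≠ 0 ∧ ‖p.eval z * z ^ 2 / (q.eval z * z ^ N) - c‖ < ε)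
    (β κ : ℂ) (hκ : ‖κ‖ = 1) (hβ : 2 * c * Complex.exp (N * β) / N ^ 2 = κ ^ 2) (Rb : ℝ) :
    ∃ R0 > 0, Rb ≤ R0 ∧ (∀ u ∈ SE R0, q.eval (phi N β u) ≠ 0) ∧
      DifferentiableOn ℂ (fun u => 1 / 2 * (p.eval (phi N β u) / q.eval (phi N β u) * (2 / N * phi N β u / u) ^ 2 + (1 - (2 / N) ^ 2) / (2 * u ^ 2))) (SE R0) ∧
      ∀ u ∈ SE R0, ‖(1 / 2 * (p.eval (phi N β u) / q.eval (phi N β u) * (2 / N * phi N β u / u) ^ 2 + (1 - (2 / N) ^ 2) / (2 * u ^ 2))) / κ ^ 2 - 1‖ ≤ 1 / 10 := by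
  have hN0 : (N:ℂ) ≠ 0 := by exact_mod_cast (by omega : N ≠ 0)
  have hκ0 : κ ≠ 0 := by rintro rfl; simp at hκ
  obtain ⟨R1, hR1, h1⟩ := hlim (‖c‖ / 20) (by have := norm_pos_iff.2 hc; positivity)
  obtain ⟨R2, hR2, h2⟩ := phi_large N hN1 β R1
  set M := ‖(1 - (2 / (N:ℂ)) ^ 2) / 4‖ with hM
  have hM0 : 0 ≤ M := norm_nonneg _
  refine ⟨max (max R2 Rb) (20 * M + 1), by positivity, (le_max_right _ _).trans (le_max_left _ _), ?_, ?_, ?_⟩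
  · intro u hu
    exact (h1 _ (h2 u (lt_of_le_of_lt ((le_max_left _ _).trans (le_max_left _ _)) hu.2))).1
  · intro u hu
    have hq := (h1 _ (h2 u (lt_of_le_of_lt ((le_max_left _ _).trans (le_max_left _ _)) hu.2))).1
    have h0 := Complex.slitPlane_ne_zero hu.1
    have hd := (phi_deriv N β hu.1).differentiableAt
    have hpd : DifferentiableAt ℂ (fun u => p.eval (phi N β u)) u := (p.differentiable _).comp u hd
    have hqd : DifferentiableAt ℂ (fun u => q.eval (phi N β u)) u := (q.differentiable _).comp u hd
    apply DifferentiableAt.differentiableWithinAt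
    apply DifferentiableAt.const_mul
    apply DifferentiableAt.add
    · exact (hpd.div hqd hq).mul (((hd.const_mul _).div differentiableAt_id h0).pow 2)
    · exact (differentiableAt_const _).div (by fun_prop) (by simpa using h0)
  · intro u hu
    have hz := h1 _ (h2 u (lt_of_le_of_lt ((le_max_left _ _).trans (le_max_left _ _)) hu.2))
    have h0 := Complex.slitPlane_ne_zero hu.1
    have hz0 := phi_ne N β u
    have hpow := phi_pow N hN1 β u h0
    have hE := Complex.exp_ne_zero (N * β)
    have hcc := norm_pos_iff.2 hc
    have hbig : 20 * M + 1 < ‖u‖ := lt_of_le_of_lt (le_max_right _ _) hu.2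
    have hb2 : ‖(1 - (2 / (N:ℂ)) ^ 2) / 4 / u ^ 2 / κ ^ 2‖ ≤ 1 / 20 := by
      rw [norm_div, norm_div, norm_pow, norm_pow, hκ, ← hM, one_pow, div_one, div_le_iff₀ (by positivity)]
      nlinarith
    have hmain : ‖(p.eval (phi N β u) * phi N β u ^ 2 / (q.eval (phi N β u) * phi N β u ^ N) - c) / c‖ ≤ 1 / 20 := by
      rw [norm_div, div_le_iff₀ hcc]; linarith [hz.2]
    have hq := hz.1
    have e : (1 / 2 * (p.eval (phi N β u) / q.eval (phi N β u) * (2 / N * phi N β u / u) ^ 2 + (1 - (2 / N) ^ 2) / (2 * u ^ 2))) / κ ^ 2 - 1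
       = (p.eval (phi N β u) * phi N β u ^ 2 / (q.eval (phi N β u) * phi N β u ^ N) - c) / c + (1 - (2 / (N:ℂ)) ^ 2) / 4 / u ^ 2 / κ ^ 2 := by
      rw [hpow]
      have hk : κ ^ 2 ≠ 0 := pow_ne_zero 2 hκ0
      have e1 : (1 / 2 * (p.eval (phi N β u) / q.eval (phi N β u) * (2 / N * phi N β u / u) ^ 2)) / κ ^ 2
         = p.eval (phi N β u) * phi N β u ^ 2 / (q.eval (phi N β u) * (u ^ 2 * Complex.exp (N * β))) / c := by
        rw [← hβ]
        generalize Complex.exp (N * β) = E at *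
        generalize phi N β u = Φ at *
        generalize Polynomial.eval Φ p = a at *
        generalize Polynomial.eval Φ q = b at *
        field_simp
      have e0 : ∀ X : ℂ, (X - c) / c = X / c - 1 := fun X => by field_simp
      rw [e0, ← e1]
      generalize p.eval (phi N β u) / q.eval (phi N β u) * (2 / N * phi N β u / u) ^ 2 = Y
      field_simp
      ring
    rw [e]
    exact (norm_add_le _ _).trans (by linarith)

lemma sector (f : ℂ → ℂ) (Pf : Set ℂ) (hf : TranscMeroPlane f Pf) (p q : Polynomial ℂ)
    (hrat : ∀ z, z ∉ Pf → deriv f z ≠ 0 → q.eval z ≠ 0 → schwarzian f z = p.eval z / q.eval z)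
    (N : ℕ) (hN1 : 1 ≤ N) (c : ℂ) (hc : c ≠ 0)
    (hlim : ∀ ε > 0, ∃ R > 0, ∀ z : ℂ, R < ‖z‖ → q.eval z ≠ 0 ∧ ‖p.eval z * z ^ 2 / (q.eval z * z ^ N) - c‖ < ε)
    (β κ : ℂ) (hκ : ‖κ‖ = 1) (hκr : 7/10 ≤ κ.re) (hβ : 2 * c * Complex.exp (N * β) / N ^ 2 = κ ^ 2) :
    ∃ R : ℝ, 1 ≤ R ∧ ∃ (C : ℝ) (Z ω ξ : ℂ → ℂ) (A B A' B' : ℂ), A * B' - A' * B ≠ 0 ∧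
      (∀ u ∈ HP R, HasDerivAt Z (ω u) u ∧ ‖ω u - κ‖ ≤ 1 / 10) ∧
      (∀ u ∈ HP R, valueAt f Pf (phi N β u) = mv A B A' B' (Complex.exp (2 * Complex.I * Z u) * ξ u)) ∧
      (∀ u ∈ HP R, 1/3 ≤ ‖ξ u‖ ∧ ‖ξ u‖ ≤ 3 ∧ ‖ξ u - 1‖ ≤ C / u.re) := by
  obtain ⟨R0, hR0, -, hq0, hQd, hQb⟩ := Q_asymp p q N hN1 c hc hlim β κ hκ hβ 1
  obtain ⟨R, hR0R, hR1, C, Z, ω, wp, wm, wp1, wm1, ξ, hZ, hwp, hwm, hξ⟩ := core_sol R0 hR0 _ κ hκ hκr hQd hQb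
  have hsl : ∀ u ∈ HP R, u ∈ Complex.slitPlane := fun u hu => Or.inl (by have : R < u.re := hu; linarith)
  have hN0 : (N:ℂ) ≠ 0 := by exact_mod_cast (by omega : N ≠ 0)
  have hopen := HP_open R
  have hφ' : ∀ u ∈ HP R, 2 / N * phi N β u / u ≠ 0 := fun u hu =>
    div_ne_zero (mul_ne_zero (div_ne_zero two_ne_zero hN0) (phi_ne _ _ _)) (Complex.slitPlane_ne_zero (hsl u hu))
  have hφa : ∀ u ∈ HP R, AnalyticAt ℂ (phi N β) u := by
    intro u hu
    have : DifferentiableOn ℂ (phi N β) (HP R) := fun z hz => (phi_deriv N β (hsl z hz)).differentiableAt.differentiableWithinAt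
    exact this.analyticAt (hopen.mem_nhds hu)
  have hne : ∀ u ∈ HP R, Tendsto (phi N β) (𝓝[≠] u) (𝓝[≠] (phi N β u)) := fun u hu =>
    (phi_deriv N β (hsl u hu)).tendsto_nhdsNE (hφ' u hu)
  -- base point
  let u1 : ℂ := ((R + 1 : ℝ) : ℂ)
  have hu1 : u1 ∈ HP R := by simp [HP, u1]
  have hev := (hne u1 hu1).eventually (tm_deriv hf (phi N β u1))
  obtain ⟨u0, hu0a, hu0⟩ := (hev.and (mem_nhdsWithin_of_mem_nhds (hopen.mem_nhds hu1))).exists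
  have hanal : ∀ u ∈ HP R, phi N β u ∉ Pf → AnalyticAt ℂ (fun u => f (phi N β u)) u := fun u hu hP =>
    (hf.1.2.1 _ hP).comp (hφa u hu)
  have hrne : ¬ ∃ k, ∀ u ∈ HP R, wp u / wm u = k := by
    rintro ⟨k, hk⟩
    -- compare values along the vertical line
    have hn : ∀ u ∈ HP R, ‖k‖ = Real.exp (-2 * (Z u).im) * ‖ξ u‖ := by
      intro u hu
      rw [← hk u hu, (hξ u hu).1, norm_mul, Complex.norm_exp]
      congr 2; simp
    have hline : ∀ s : ℝ, u1 + s * Complex.I ∈ HP R := fun s => ray_mem (by simp) s hu1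
    let g : ℝ → ℝ := fun s => (Z (u1 + s * Complex.I)).im
    have hder : ∀ s : ℝ, HasDerivAt g ((ω (u1 + s * Complex.I) * Complex.I).im) s := by
      intro s
      have hray0 : HasDerivAt (fun τ : ℝ => u1 + τ * Complex.I) Complex.I s := by
        have := (Complex.ofRealCLM.hasDerivAt (x := s)).mul_const Complex.I
        simpa using this.const_add u1
      have h1 : HasDerivAt (fun s : ℝ => Z (u1 + s * Complex.I)) (ω (u1 + s * Complex.I) * Complex.I) s :=
        HasDerivAt.comp s (hZ _ (hline s)).1 hray0
      exact (Complex.imCLM.hasFDerivAt.comp_hasDerivAt s h1)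
    have hge : ∀ s : ℝ, 6/10 ≤ deriv g s := by
      intro s
      rw [(hder s).deriv]
      have := abs_le.1 ((Complex.abs_re_le_norm _).trans (hZ _ (hline s)).2)
      simp at this ⊢
      linarith
    have hdiff : g 10 - g 0 ≥ 6 := by
      have := mul_sub_le_image_sub_of_le_deriv (f := g) (fun s => (hder s).differentiableAt) hge (show (0:ℝ) ≤ 10 by norm_num)
      linarith
    have a0 := hn _ (hline 0)
    have a1 := hn _ (hline 10)
    have b0 := hξ _ (hline 0)
    have b1 := hξ _ (hline 10)
    have hlt : Real.exp (-2 * g 10) * 3 < Real.exp (-2 * g 0) * (1/3) := by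
      have : Real.exp (-2 * g 0) = Real.exp (-2 * g 10) * Real.exp (2 * (g 10 - g 0)) := by
        rw [← Real.exp_add]; congr 1; ring
      rw [this]
      have h12 : (12:ℝ) + 1 ≤ Real.exp (2 * (g 10 - g 0)) := le_trans (by linarith) (Real.add_one_le_exp _)
      nlinarith [Real.exp_pos (-2 * g 10)]
    have c1 : Real.exp (-2 * g 0) * (1/3) ≤ ‖k‖ := by
      rw [a0]; exact mul_le_mul_of_nonneg_left b0.2.1 (Real.exp_pos _).le
    have c2 : ‖k‖ ≤ Real.exp (-2 * g 10) * 3 := by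
      rw [a1]; exact mul_le_mul_of_nonneg_left b1.2.2.1 (Real.exp_pos _).le
    linarith
  have hderF : ∀ u ∈ HP R, phi N β u ∉ Pf → deriv (fun u => f (phi N β u)) u = deriv f (phi N β u) * (2 / N * phi N β u / u) := fun u hu hP =>
    ((hf.1.2.1 _ hP).differentiableAt.hasDerivAt.comp u (phi_deriv N β (hsl u hu))).deriv
  obtain ⟨A, B, A', B', hdet, hval⟩ := global_rep R (fun u => f (phi N β u)) _ wp wm wp1 wm1 (phi N β ⁻¹' Pf) hanal
    (by
      intro u hu hP
      exact ⟨(hne u hu).eventually (mp_discrete hf.1 _), (mp_pole hf.1 hP).comp (hne u hu)⟩)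
    u0 hu0 hu0a.1 (by rw [hderF u0 hu0 hu0a.1]; exact mul_ne_zero hu0a.2 (hφ' u0 hu0))
    (by
      have hc := (hφa u0 hu0).continuousAt
      have e1 : ∀ᶠ u in 𝓝 u0, phi N β u ∉ Pf := hc.eventually ((mp_closed hf.1).mem_nhds hu0a.1)
      have e2 : ∀ᶠ u in 𝓝 u0, deriv f (phi N β u) ≠ 0 := hc.eventually ((hf.1.2.1 _ hu0a.1).deriv.continuousAt.eventually_ne hu0a.2)
      filter_upwards [e1, e2, hopen.mem_nhds hu0] with u a b d
      have hSE : u ∈ SE R0 := ⟨hsl u d, lt_of_le_of_lt hR0R (HP_norm d)⟩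
      rw [schw_phi f N hN1 β (hsl u d) (hf.1.2.1 _ a) b, hrat _ a b (hq0 u hSE)]
      ring) hwp hwm hrne
  refine ⟨R, hR1, C, Z, ω, ξ, A, B, A', B', hdet, hZ, ?_, fun u hu => (hξ u hu).2⟩
  intro u hu
  rw [← (hξ u hu).1, ← hval u hu]
  by_cases h : phi N β u ∈ Pf <;> simp [valueAt, h]




lemma phi_norm_inv (N : ℕ) (hN : 1 ≤ N) (β : ℂ) (u : ℂ) (hu : u ≠ 0) :
    ‖u‖ = Real.exp ((N:ℝ) / 2 * (Real.log ‖phi N β u‖ - β.re)) := by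
  have hN0 : (0:ℝ) < N := by exact_mod_cast hN
  rw [phi_norm, Real.log_exp]
  have : (N:ℝ) / 2 * (2 / N * Real.log ‖u‖ + β.re - β.re) = Real.log ‖u‖ := by field_simp; ring
  rw [this, Real.exp_log (norm_pos_iff.2 hu)]

lemma phi_big (N : ℕ) (hN : 1 ≤ N) (β : ℂ) (M : ℝ) : ∃ R > 0, ∀ u : ℂ, u ≠ 0 → R < ‖phi N β u‖ → M < ‖u‖ := by
  have hN0 : (0:ℝ) < N := by exact_mod_cast hN
  refine ⟨Real.exp (2 / N * Real.log (max M 1) + β.re), Real.exp_pos _, fun u hu h => ?_⟩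
  rw [phi_norm, Real.exp_lt_exp] at h
  have h1 : Real.log (max M 1) < Real.log ‖u‖ := by
    have : 2 / (N:ℝ) * Real.log (max M 1) < 2 / N * Real.log ‖u‖ := by linarith
    exact lt_of_mul_lt_mul_left this (by positivity)
  have := (Real.log_lt_log_iff (by positivity) (norm_pos_iff.2 hu)).1 h1
  exact lt_of_le_of_lt (le_max_left _ _) this

def Uinv (N : ℕ) (β z : ℂ) : ℂ := Complex.exp (N / 2 * Complex.log (z * Complex.exp (-β)))

lemma arg_lt_of_re {u : ℂ} (h : 0 < u.re) : |Complex.arg u| < Real.pi / 2 :=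
  Complex.abs_arg_lt_pi_div_two_iff.2 (Or.inl h)

lemma phi_mul (N : ℕ) (β u : ℂ) : phi N β u * Complex.exp (-β) = Complex.exp (2 / N * Complex.log u) := by
  rw [phi, ← Complex.exp_add]; congr 1; ring

lemma twoN_im (N : ℕ) (hN : 1 ≤ N) {u : ℂ} (h : 0 < u.re) : |(2 / (N:ℂ) * Complex.log u).im| < Real.pi := by
  have hN0 : (1:ℝ) ≤ N := by exact_mod_cast hN
  have : (2 / (N:ℂ) * Complex.log u).im = 2 / (N:ℝ) * Complex.arg u := by
    have e : (2 / (N:ℂ)) = ((2 / (N:ℝ) : ℝ) : ℂ) := by push_cast; rfl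
    rw [e, Complex.im_ofReal_mul, Complex.log_im]
  rw [this, abs_mul, abs_of_pos (by positivity)]
  have h1 := arg_lt_of_re h
  have h2 : 2 / (N:ℝ) ≤ 2 := by rw [div_le_iff₀ (by linarith)]; linarith
  nlinarith [abs_nonneg (Complex.arg u)]

lemma Uinv_phi (N : ℕ) (hN : 1 ≤ N) (β : ℂ) {u : ℂ} (h : 0 < u.re) : Uinv N β (phi N β u) = u := by
  have hN0 : (N:ℂ) ≠ 0 := by exact_mod_cast (by omega : N ≠ 0)
  have h1 := abs_lt.1 (twoN_im N hN h)
  rw [Uinv, phi_mul, Complex.log_exp h1.1 h1.2.le]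
  have : (N:ℂ) / 2 * (2 / N * Complex.log u) = Complex.log u := by field_simp
  rw [this, Complex.exp_log]
  rintro rfl; simp at h

lemma Uinv_cont (N : ℕ) (hN : 1 ≤ N) (β : ℂ) {u : ℂ} (h : 0 < u.re) : ContinuousAt (Uinv N β) (phi N β u) := by
  have h1 := abs_lt.1 (twoN_im N hN h)
  have hs : phi N β u * Complex.exp (-β) ∈ Complex.slitPlane := by
    rw [phi_mul, Complex.mem_slitPlane_iff_arg]
    refine ⟨?_, Complex.exp_ne_zero _⟩
    have := Complex.log_exp h1.1 h1.2.le
    rw [← Complex.log_im, this]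
    exact h1.2.ne
  unfold Uinv
  have : ContinuousAt (fun z => Complex.log (z * Complex.exp (-β))) (phi N β u) :=
    ContinuousAt.comp (g := Complex.log) (continuousAt_clog hs) (by fun_prop)
  fun_prop

lemma phi_open (N : ℕ) (hN : 1 ≤ N) (β : ℂ) (R : ℝ) (hR : 0 ≤ R) : IsOpen (phi N β '' HP R) := by
  rw [isOpen_iff_mem_nhds]
  rintro _ ⟨u, hu, rfl⟩
  have hu' : R < u.re := hu
  have hsl : u ∈ Complex.slitPlane := Or.inl (by linarith)
  have hN0 : (N:ℂ) ≠ 0 := by exact_mod_cast (by omega : N ≠ 0)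
  have hd := phi_deriv N β hsl
  have hne : 2 / N * phi N β u / u ≠ 0 := div_ne_zero (mul_ne_zero (div_ne_zero two_ne_zero hN0) (phi_ne _ _ _)) (Complex.slitPlane_ne_zero hsl)
  have han : AnalyticAt ℂ (phi N β) u := by
    have : DifferentiableOn ℂ (phi N β) (HP 0) := fun z hz => (phi_deriv N β (Or.inl hz)).differentiableAt.differentiableWithinAt
    exact this.analyticAt ((HP_open 0).mem_nhds (show 0 < u.re by linarith))
  have hs : HasStrictDerivAt (phi N β) (2 / N * phi N β u / u) u := by
    have := han.hasStrictDerivAt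
    rwa [hd.deriv] at this
  rw [← hs.map_nhds_eq hne]
  exact image_mem_map ((HP_open R).mem_nhds hu)

lemma phi_closed (N : ℕ) (hN : 1 ≤ N) (β : ℂ) (R : ℝ) (hR : 0 < R) : IsClosed (phi N β '' {u | R ≤ u.re}) := by
  apply IsSeqClosed.isClosed
  intro z z0 hz hlim
  choose u hu hφ using hz
  have hne : ∀ n, u n ≠ 0 := by
    intro n h
    have := hu n
    simp [h] at this; linarith
  obtain ⟨M, hM⟩ := (Metric.isBounded_range_of_tendsto _ hlim).exists_norm_le
  have hb : ∀ n, u n ∈ Metric.closedBall (0:ℂ) (Real.exp ((N:ℝ) / 2 * (Real.log (max M 1) - β.re))) := by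
    intro n
    rw [mem_closedBall_zero_iff, phi_norm_inv N hN β (u n) (hne n), Real.exp_le_exp]
    have : Real.log ‖phi N β (u n)‖ ≤ Real.log (max M 1) := by
      apply Real.log_le_log (norm_pos_iff.2 (phi_ne _ _ _))
      rw [hφ]; exact (hM _ (mem_range_self n)).trans (le_max_left _ _)
    gcongr
  obtain ⟨v, -, k, hk, hv⟩ := tendsto_subseq_of_bounded Metric.isBounded_closedBall hb
  have hvR : R ≤ v.re := by
    have : Tendsto (fun n => ((u ∘ k) n).re) atTop (𝓝 v.re) := (Complex.continuous_re.tendsto v).comp hv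
    exact ge_of_tendsto' this (fun n => hu (k n))
  refine ⟨v, hvR, ?_⟩
  have hc : ContinuousAt (phi N β) v := (phi_deriv N β (Or.inl (by linarith))).continuousAt
  have h1 := hc.tendsto.comp hv
  have h2 := hlim.comp hk.tendsto_atTop
  refine tendsto_nhds_unique h1 (h2.congr fun n => ?_)
  simp [hφ]

lemma phi_cover (N : ℕ) (hN : 1 ≤ N) (β0 z : ℂ) (hz : z ≠ 0) : ∃ j : Fin (2 * N), ∃ u : ℂ, u ≠ 0 ∧ |u.im| ≤ u.re ∧
    phi N (β0 + Complex.I * Real.pi * (j:ℕ) / N) u = z := by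
  have hN0 : (N:ℂ) ≠ 0 := by exact_mod_cast (by omega : N ≠ 0)
  have hNr : (0:ℝ) < N := by exact_mod_cast hN
  have hpi := Real.pi_pos
  set θ : ℝ := (Complex.log z - β0).im with hθ
  set k : ℤ := round (θ * N / Real.pi) with hk
  have hk2 : |θ * N - Real.pi * k| ≤ Real.pi / 2 := by
    have h := abs_sub_round (θ * N / Real.pi)
    rw [← hk] at h
    have e : θ * N - Real.pi * k = Real.pi * (θ * N / Real.pi - k) := by field_simp
    rw [e, abs_mul, abs_of_pos hpi]
    nlinarith
  have hmod : 0 ≤ k % (2 * N : ℤ) := Int.emod_nonneg _ (by omega)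
  have hmod2 : k % (2 * N : ℤ) < 2 * N := Int.emod_lt_of_pos _ (by omega)
  set w : ℂ := N / 2 * (Complex.log z - β0 - Complex.I * Real.pi * k / N) with hw
  have hwim : w.im = (θ * N - Real.pi * k) / 2 := by
    have e1 : w = ((N / 2 : ℝ):ℂ) * (Complex.log z - β0) - ((Real.pi * k / 2 : ℝ):ℂ) * Complex.I := by
      rw [hw]; push_cast; field_simp
    rw [e1, Complex.sub_im, Complex.im_ofReal_mul, Complex.im_ofReal_mul, ← hθ]; simp; ring
  have hwb := abs_le.1 hk2
  have hlog : Complex.log (Complex.exp w) = w := Complex.log_exp (by rw [hwim]; linarith) (by rw [hwim]; linarith)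
  refine ⟨⟨(k % (2 * N : ℤ)).toNat, by omega⟩, Complex.exp w, Complex.exp_ne_zero _, ?_, ?_⟩
  · rw [Complex.exp_im, Complex.exp_re, abs_mul, abs_of_pos (Real.exp_pos _)]
    apply mul_le_mul_of_nonneg_left _ (Real.exp_pos _).le
    have hc : √2 / 2 ≤ Real.cos w.im := by
      rw [← Real.cos_abs, ← Real.cos_pi_div_four]
      apply Real.cos_le_cos_of_nonneg_of_le_pi (abs_nonneg _) (by linarith)
      rw [hwim, abs_div, abs_of_pos (by norm_num : (0:ℝ) < 2)]
      linarith
    have hs2 : (√2) ^ 2 = 2 := Real.sq_sqrt (by norm_num)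
    have := Real.sin_sq_add_cos_sq w.im
    have h0 := Real.sqrt_pos.2 (show (0:ℝ) < 2 by norm_num)
    apply abs_le_of_sq_le_sq _ (by linarith)
    nlinarith
  · rw [phi, hlog]
    have hj : (((k % (2 * N : ℤ)).toNat : ℕ) : ℂ) = (k:ℂ) - 2 * N * ((k / (2 * N : ℤ) : ℤ) : ℂ) := by
      have h1 : (((k % (2 * N : ℤ)).toNat : ℕ) : ℤ) = k - 2 * N * (k / (2 * N : ℤ)) := by
        rw [Int.toNat_of_nonneg hmod]; rw [Int.emod_def]
      exact_mod_cast congrArg (Int.cast : ℤ → ℂ) h1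
    rw [hj]
    have : 2 / N * w + (β0 + Complex.I * Real.pi * ((k:ℂ) - 2 * N * ((k / (2 * N : ℤ) : ℤ) : ℂ)) / N)
       = Complex.log z - ((k / (2 * N : ℤ) : ℤ) : ℂ) * (2 * Real.pi * Complex.I) := by
      rw [hw]; field_simp; ring
    rw [this, Complex.exp_sub, Complex.exp_int_mul_two_pi_mul_I, div_one, Complex.exp_log hz]




lemma Z_diff (R : ℝ) (Z ω : ℂ → ℂ) (κ : ℂ)
    (hZ : ∀ u ∈ HP R, HasDerivAt Z (ω u) u ∧ ‖ω u - κ‖ ≤ 1 / 10) {u v : ℂ} (hu : u ∈ HP R) (hv : v ∈ HP R) :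
    ‖Z u - Z v - κ * (u - v)‖ ≤ 1 / 10 * ‖u - v‖ := by
  have h := (HP_convex R).norm_image_sub_le_of_norm_hasDerivWithin_le (f := fun z => Z z - κ * z) (f' := fun z => ω z - κ) (C := 1/10)
    (fun z hz => by
      have := (hZ z hz).1.sub ((hasDerivAt_id z).const_mul κ)
      simp only [mul_one] at this
      exact this.hasDerivWithinAt) (fun z hz => (hZ z hz).2) hv hu
  refine le_trans (le_of_eq ?_) h
  congr 1; ring

lemma tract_conn (R : ℝ) (Z ω : ℂ → ℂ) (κ : ℂ) (hκ : ‖κ‖ = 1) (hκr : 7/10 ≤ κ.re)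
    (hZ : ∀ u ∈ HP R, HasDerivAt Z (ω u) u ∧ ‖ω u - κ‖ ≤ 1 / 10) (σ : ℝ) (hσ : σ = 1 ∨ σ = -1) (L : ℝ) :
    IsPreconnected {u | u ∈ HP R ∧ L < σ * (Z u).im} := by
  have hσ2 : σ * σ = 1 := by rcases hσ with h | h <;> rw [h] <;> norm_num
  have hσa : |σ| = 1 := by rcases hσ with h | h <;> rw [h] <;> norm_num
  -- key estimate
  have key : ∀ u d : ℂ, ∀ S : ℝ, u ∈ HP R → u + d ∈ HP R → 2 * ‖d‖ ≤ S → u + d + (σ * S : ℝ) * Complex.I ∈ HP R →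
      σ * (Z u).im ≤ σ * (Z (u + d + (σ * S : ℝ) * Complex.I)).im := by
    intro u d S hu hud hS hv
    have h := Z_diff R Z ω κ hZ hv hu
    have e : u + d + (σ * S : ℝ) * Complex.I - u = d + (σ * S : ℝ) * Complex.I := by ring
    rw [e] at h
    have h1 := (Complex.abs_im_le_norm _).trans h
    have h2 : ‖d + (σ * S : ℝ) * Complex.I‖ ≤ ‖d‖ + S := by
      refine (norm_add_le _ _).trans ?_
      rw [norm_mul, Complex.norm_I, Complex.norm_real, Real.norm_eq_abs, abs_mul, hσa, abs_of_nonneg (by linarith [norm_nonneg d])]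
      linarith
    have h3 : |(κ * d).im| ≤ ‖d‖ := by
      refine (Complex.abs_im_le_norm _).trans ?_
      rw [norm_mul, hκ, one_mul]
    set W := Z (u + d + (σ * S : ℝ) * Complex.I)
    have e2 : (W - Z u - κ * (d + (σ * S : ℝ) * Complex.I)).im = W.im - (Z u).im - (κ * d).im - σ * (S * κ.re) := by
      simp [mul_add]; ring
    rw [e2] at h1
    have h4 : |σ * (W.im - (Z u).im - (κ * d).im - σ * (S * κ.re))| ≤ 1/10 * (‖d‖ + S) := by
      rw [abs_mul, hσa, one_mul]; linarith
    have h5 : |σ * (κ * d).im| ≤ ‖d‖ := by rw [abs_mul, hσa, one_mul]; exact h3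
    have e3 : σ * (W.im - (Z u).im - (κ * d).im - σ * (S * κ.re)) = σ * W.im - σ * (Z u).im - σ * (κ * d).im - S * κ.re := by
      linear_combination (-(S * κ.re)) * hσ2
    rw [e3] at h4
    have a := (abs_le.1 h4).1
    have b := (abs_le.1 h5).1
    have hd0 := norm_nonneg d
    nlinarith
  have vert : ∀ u : ℂ, ∀ s : ℝ, u ∈ HP R → u + (s : ℝ) * Complex.I ∈ HP R := fun u s hu => ray_mem (by simp) s hu
  apply isPreconnected_of_forall_pair
  rintro u ⟨hu, hLu⟩ v ⟨hv, hLv⟩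
  set S : ℝ := 2 * ‖v - u‖ with hS
  have hS0 : 0 ≤ S := by positivity
  let ray : ℂ → Set ℂ := fun w => (fun s : ℝ => w + (σ * s : ℝ) * Complex.I) '' Icc 0 S
  let mid : Set ℂ := (fun s : ℝ => u + s * (v - u) + (σ * S : ℝ) * Complex.I) '' Icc 0 1
  have cray : ∀ w, IsPreconnected (ray w) := fun w => isPreconnected_Icc.image _ (by fun_prop)
  have cmid : IsPreconnected mid := isPreconnected_Icc.image _ (by fun_prop)
  have sray : ∀ w, w ∈ HP R → L < σ * (Z w).im → ray w ⊆ {u | u ∈ HP R ∧ L < σ * (Z u).im} := by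
    rintro w hw hLw _ ⟨s, hs, rfl⟩
    refine ⟨vert w _ hw, lt_of_lt_of_le hLw ?_⟩
    have := key w 0 s hw (by simpa using hw) (by simpa using hs.1) (by simpa using vert w (σ * s) hw)
    simpa using this
  have smid : mid ⊆ {u | u ∈ HP R ∧ L < σ * (Z u).im} := by
    rintro _ ⟨s, hs, rfl⟩
    have hm : u + s * (v - u) ∈ HP R := by
      have h1 : R < u.re := hu
      have h2 : R < v.re := hv
      change R < (u + s * (v - u)).re
      have : (u + s * (v - u)).re = (1 - s) * u.re + s * v.re := by simp; ring
      rw [this]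
      rcases eq_or_lt_of_le hs.1 with h | h
      · rw [← h]; linarith
      · nlinarith [hs.2]
    refine ⟨vert _ _ hm, lt_of_lt_of_le hLu ?_⟩
    refine key u _ S hu hm ?_ (vert _ _ hm)
    rw [norm_mul, Complex.norm_real, Real.norm_eq_abs, abs_of_nonneg hs.1, hS]
    nlinarith [norm_nonneg (v - u), hs.2]
  have m1 : u + (σ * S : ℝ) * Complex.I ∈ ray u := ⟨S, ⟨hS0, le_rfl⟩, rfl⟩
  have m1' : u + (σ * S : ℝ) * Complex.I ∈ mid := ⟨0, ⟨le_rfl, zero_le_one⟩, by simp⟩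
  have m2 : v + (σ * S : ℝ) * Complex.I ∈ ray v := ⟨S, ⟨hS0, le_rfl⟩, rfl⟩
  have m2' : v + (σ * S : ℝ) * Complex.I ∈ mid := ⟨1, ⟨zero_le_one, le_rfl⟩, by simp⟩
  have m3 : ∀ w, w ∈ ray w := fun w => ⟨0, ⟨le_rfl, hS0⟩, by simp⟩
  refine ⟨ray u ∪ mid ∪ ray v, ?_, Or.inl (Or.inl (m3 u)), Or.inr (m3 v), ?_⟩
  · exact union_subset (union_subset (sray u hu hLu) smid) (sray v hv hLv)
  · exact ((cray u).union _ m1 m1' cmid).union _ (Or.inr m2') m2 (cray v)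

lemma tract_value (val : ℂ → Option ℂ) (A B A' B' : ℂ) (hdet : A * B' - A' * B ≠ 0) (φ r : ℂ → ℂ) (H : ℝ → Set ℂ)
    (hval : ∀ L, ∀ u ∈ H L, val (φ u) = mv A B A' B' (r u)) (hr : ∀ L, ∀ u ∈ H L, ‖r u‖ ≤ 3 * Real.exp (-2 * L))
    (a : Option ℂ) (γ : ℝ → ℂ) (ha : Tendsto (fun t => chordal (val (γ t)) a) atTop (𝓝 0))
    (hm : ∀ L T : ℝ, ∃ t > T, ∃ u ∈ H L, γ t = φ u) : a = mv A B A' B' 0 := by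
  choose t ht u hu hγ using fun n : ℕ => hm n n
  have htt : Tendsto t atTop atTop := tendsto_atTop_mono (fun n => (ht n).le) tendsto_natCast_atTop_atTop
  have h1 := ha.comp htt
  have hr0 : Tendsto (fun n => r (u n)) atTop (𝓝 0) := by
    apply squeeze_zero_norm (fun n => hr _ _ (hu n))
    have : Tendsto (fun n : ℕ => Real.exp (-2 * (n:ℝ))) atTop (𝓝 0) := by
      apply Real.tendsto_exp_atBot.comp
      exact tendsto_natCast_atTop_atTop.const_mul_atTop_of_neg (by norm_num)
    simpa using this.const_mul 3
  obtain ⟨ρ, hρ, he⟩ := mv_lim hdet a atTop (fun n => r (u n)) 3 (Eventually.of_forall fun n => by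
      refine (hr _ _ (hu n)).trans ?_
      have : Real.exp (-2 * (n:ℝ)) ≤ 1 := Real.exp_le_one_iff.2 (by have : (0:ℝ) ≤ n := Nat.cast_nonneg n; linarith)
      linarith) (h1.congr fun n => by simp only [Function.comp]; rw [hγ n, hval _ _ (hu n)])
  have := tendsto_nhds_unique hρ hr0
  rw [this] at he
  exact ell_zero_iff hdet a 0 he

lemma tract_same (f : ℂ → ℂ) (Pf : Set ℂ) (A B A' B' : ℂ) (hdet : A * B' - A' * B ≠ 0) (φ r : ℂ → ℂ) (H : ℝ → Set ℂ)
    (hconn : ∀ L, IsPreconnected (φ '' H L))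
    (hval : ∀ L, ∀ u ∈ H L, valueAt f Pf (φ u) = mv A B A' B' (r u)) (hr : ∀ L, ∀ u ∈ H L, ‖r u‖ ≤ 3 * Real.exp (-2 * L))
    (a₁ a₂ : Option ℂ) (γ₁ γ₂ : ℝ → ℂ) (h₁ : AsymptoticPath f Pf a₁ γ₁) (h₂ : AsymptoticPath f Pf a₂ γ₂)
    (hm₁ : ∀ L T : ℝ, ∃ t > T, ∃ u ∈ H L, γ₁ t = φ u) (hm₂ : ∀ L T : ℝ, ∃ t > T, ∃ u ∈ H L, γ₂ t = φ u) :
    ¬ DistinctSingularities f Pf a₁ a₂ γ₁ γ₂ := by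
  have e1 := tract_value _ A B A' B' hdet φ r H hval hr a₁ γ₁ h₁.2.2 hm₁
  have e2 := tract_value _ A B A' B' hdet φ r H hval hr a₂ γ₂ h₂.2.2 hm₂
  rintro (h | ⟨t, ht, C₁, C₂, ⟨x₁, hx₁, hC₁⟩, ⟨x₂, hx₂, hC₂⟩, hdis, hb₁, hb₂⟩)
  · exact h (e1.trans e2.symm)
  rw [e1] at hx₁ hC₁
  rw [e2] at hx₂ hC₂
  obtain ⟨δ, hδ, hclose⟩ := mv_close hdet t ht
  obtain ⟨L, hL⟩ : ∃ L : ℝ, 3 * Real.exp (-2 * L) < δ := by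
    have : Tendsto (fun L : ℝ => 3 * Real.exp (-2 * L)) atTop (𝓝 0) := by
      have : Tendsto (fun n : ℝ => Real.exp (-2 * n)) atTop (𝓝 0) := by
        apply Real.tendsto_exp_atBot.comp
        exact tendsto_id.const_mul_atTop_of_neg (by norm_num)
      simpa using this.const_mul 3
    exact (this.eventually_lt_const hδ).exists
  set S := {z | chordal (valueAt f Pf z) (mv A B A' B' 0) < t} with hS
  have hsub : φ '' H L ⊆ S := by
    rintro _ ⟨u, hu, rfl⟩
    change chordal _ _ < t
    rw [hval L u hu]
    exact hclose _ (lt_of_le_of_lt (hr L u hu) hL)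
  have main : ∀ (γ : ℝ → ℂ) (C : Set ℂ) (x : ℂ), x ∈ S → C = connectedComponentIn S x → IsBounded (γ '' Ici 0 \ C) →
      Tendsto (fun t => ‖γ t‖) atTop atTop → (∀ L T : ℝ, ∃ t > T, ∃ u ∈ H L, γ t = φ u) → φ '' H L ⊆ C := by
    intro γ C x hx hC hb hinf hm
    obtain ⟨M, hM⟩ := hb.exists_norm_le
    obtain ⟨T, hT⟩ := (hinf.eventually_gt_atTop M).exists_forall_of_atTop
    obtain ⟨s, hs, u, hu, hγ⟩ := hm L (max T 0)
    have hsC : γ s ∈ C := by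
      by_contra hn
      have := hM _ ⟨⟨s, (lt_of_le_of_lt (le_max_right _ _) hs).le, rfl⟩, hn⟩
      have := hT s (lt_of_le_of_lt (le_max_left _ _) hs).le
      linarith
    have hmem : γ s ∈ φ '' H L := ⟨u, hu, hγ.symm⟩
    have h1 := (hconn L).subset_connectedComponentIn hmem hsub
    rw [hC] at hsC
    rw [← connectedComponentIn_eq hsC] at h1
    rwa [hC]
  have s1 := main γ₁ C₁ x₁ hx₁ hC₁ hb₁ h₁.2.1 hm₁
  have s2 := main γ₂ C₂ x₂ hx₂ hC₂ hb₂ h₂.2.1 hm₂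
  obtain ⟨s, -, u, hu, -⟩ := hm₁ L 0
  exact Set.disjoint_left.1 hdis (s1 ⟨u, hu, rfl⟩) (s2 ⟨u, hu, rfl⟩)

lemma strip_est (κ : ℂ) (hκ : ‖κ‖ = 1) (hκr : 7/10 ≤ κ.re) (ζ u : ℂ) (hu : 0 < u.re) (D L : ℝ) (hD : 0 ≤ D) (hL : 0 ≤ L)
    (h : ‖ζ - κ * u‖ ≤ 1/10 * ‖u‖ + D) (hi : |ζ.im| ≤ L) :
    |u.im| ≤ 14/10 * u.re + 2 * (D + L) ∧ 2/10 * u.re - 20 * (D + L) ≤ ζ.re := by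
  have hn : ‖u‖ ≤ u.re + |u.im| := by
    have := Complex.norm_le_abs_re_add_abs_im u
    rwa [abs_of_pos hu] at this
  have hk2 : κ.re ^ 2 + κ.im ^ 2 = 1 := by
    have := Complex.sq_norm κ
    rw [hκ, Complex.normSq_apply] at this
    nlinarith
  have hki : |κ.im| ≤ 715/1000 := by
    apply abs_le_of_sq_le_sq _ (by norm_num)
    nlinarith
  have hkr1 : κ.re ≤ 1 := by nlinarith
  have h1 := abs_le.1 ((Complex.abs_im_le_norm _).trans h)
  have h2 := abs_le.1 ((Complex.abs_re_le_norm _).trans h)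
  have e1 : (ζ - κ * u).im = ζ.im - (κ.re * u.im + κ.im * u.re) := by simp
  have e2 : (ζ - κ * u).re = ζ.re - (κ.re * u.re - κ.im * u.im) := by simp
  rw [e1] at h1; rw [e2] at h2
  have hi' := abs_le.1 hi
  have hki' := abs_le.1 hki
  set x := u.re
  set y := u.im
  set b := κ.re * y + κ.im * x with hb
  set a := κ.re * x - κ.im * y with ha
  have hb1 : |b| ≤ 1/10 * ‖u‖ + D + L := abs_le.2 ⟨by linarith, by linarith⟩
  have hy : |y| ≤ 14/10 * x + 2 * (D + L) := by
    have : κ.re * |y| ≤ 715/1000 * x + (1/10 * ‖u‖ + D + L) := by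
      have e3 : κ.re * y = b - κ.im * x := by rw [hb]; ring
      have : κ.re * |y| = |b - κ.im * x| := by rw [← e3, abs_mul, abs_of_pos (show (0:ℝ) < κ.re by linarith)]
      rw [this]
      refine (abs_sub _ _).trans ?_
      rw [abs_mul, abs_of_pos hu]
      nlinarith
    nlinarith [abs_nonneg y]
  refine ⟨hy, ?_⟩
  have e4 : κ.re * a = x - κ.im * b := by
    rw [ha, hb]; linear_combination x * hk2
  have h5 : κ.im * b ≤ 715/1000 * (1/10 * ‖u‖ + D + L) := by
    have := abs_mul κ.im b
    have h6 : |κ.im * b| ≤ 715/1000 * (1/10 * ‖u‖ + D + L) := by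
      rw [abs_mul]; exact mul_le_mul hki hb1 (abs_nonneg _) (by norm_num)
    exact (le_abs_self _).trans h6
  have h7 : 7/10 * x - 2 * (D + L) ≤ κ.re * a := by
    rw [e4]; nlinarith
  have h8 : 7/10 * x - 2 * (D + L) ≤ a ∨ 7/10 * x ≤ 2 * (D + L) := by
    by_contra hcon
    push Not at hcon
    nlinarith
  have hnn : 1/10 * ‖u‖ ≤ 1/10 * (24/10 * x + 2 * (D + L)) := by linarith
  rcases h8 with h8 | h8
  · linarith
  · have : -‖u‖ ≤ a := by
      have := (abs_le.1 (Complex.abs_re_le_norm (κ * u))).1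
      rw [norm_mul, hκ, one_mul] at this
      simpa [ha] using this
    linarith




lemma Z_lin (R : ℝ) (Z ω : ℂ → ℂ) (κ : ℂ)
    (hZ : ∀ u ∈ HP R, HasDerivAt Z (ω u) u ∧ ‖ω u - κ‖ ≤ 1 / 10) :
    ∃ D : ℝ, 0 ≤ D ∧ ∀ u ∈ HP R, ‖Z u - κ * u‖ ≤ 1/10 * ‖u‖ + D := by
  let v : ℂ := ((R + 1 : ℝ) : ℂ)
  have hv : v ∈ HP R := by simp [HP, v]
  refine ⟨‖Z v - κ * v‖ + 1/10 * ‖v‖, by positivity, fun u hu => ?_⟩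
  have h := Z_diff R Z ω κ hZ hu hv
  have e : Z u - κ * u = (Z u - Z v - κ * (u - v)) + (Z v - κ * v) := by ring
  rw [e]
  refine (norm_add_le _ _).trans ?_
  have := norm_sub_le u v
  linarith

lemma no_stay (R C : ℝ) (Z ω ξ : ℂ → ℂ) (A B A' B' : ℂ) (hR : 1 ≤ R) (hdet : A * B' - A' * B ≠ 0)
    (κ : ℂ) (hκ : ‖κ‖ = 1) (hκr : 7/10 ≤ κ.re)
    (hZ : ∀ u ∈ HP R, HasDerivAt Z (ω u) u ∧ ‖ω u - κ‖ ≤ 1 / 10)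
    (hξ : ∀ u ∈ HP R, 1/3 ≤ ‖ξ u‖ ∧ ‖ξ u‖ ≤ 3 ∧ ‖ξ u - 1‖ ≤ C / u.re)
    (u : ℝ → ℂ) (t0 L : ℝ) (hc : ContinuousOn u (Ici t0)) (hu : ∀ t ≥ t0, u t ∈ HP R ∧ |(Z (u t)).im| ≤ L)
    (hinf : Tendsto (fun t => ‖u t‖) atTop atTop) (a : Option ℂ)
    (ha : Tendsto (fun t => chordal (mv A B A' B' (Complex.exp (2 * Complex.I * Z (u t)) * ξ (u t))) a) atTop (𝓝 0)) : False := by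
  obtain ⟨D, hD, hDb⟩ := Z_lin R Z ω κ hZ
  have hL : 0 ≤ L := (abs_nonneg _).trans (hu t0 le_rfl).2
  have hpos : ∀ t ≥ t0, 0 < (u t).re := fun t ht => by
    have : R < (u t).re := (hu t ht).1
    linarith
  have hst := fun t (ht : t ≥ t0) => strip_est κ hκ hκr (Z (u t)) (u t) (hpos t ht) D L hD hL (hDb _ (hu t ht).1) (hu t ht).2
  have hre : Tendsto (fun t => (u t).re) atTop atTop := by
    have h1 : Tendsto (fun t => (1/3) * (‖u t‖ + (-(2 * (D + L))))) atTop atTop :=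
      (tendsto_atTop_add_const_right _ _ hinf).const_mul_atTop (by norm_num)
    refine tendsto_atTop_mono' _ ?_ h1
    filter_upwards [eventually_ge_atTop t0] with t ht
    have := Complex.norm_le_abs_re_add_abs_im (u t)
    rw [abs_of_pos (hpos t ht)] at this
    have h2 := (hst t ht).1
    have h3 := hpos t ht
    linarith
  have hg : Tendsto (fun t => (Z (u t)).re) atTop atTop := by
    have h1 : Tendsto (fun t => (2/10) * (u t).re + (-(20 * (D + L)))) atTop atTop :=
      tendsto_atTop_add_const_right _ _ (hre.const_mul_atTop (by norm_num))
    refine tendsto_atTop_mono' _ ?_ h1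
    filter_upwards [eventually_ge_atTop t0] with t ht
    linarith [(hst t ht).2]
  have hgc : ContinuousOn (fun t => (Z (u t)).re) (Ici t0) := by
    have hZc : ContinuousOn Z (HP R) := fun z hz => (hZ z hz).1.continuousAt.continuousWithinAt
    exact Complex.continuous_re.comp_continuousOn (hZc.comp hc (fun t ht => (hu t ht).1))
  have hen : ∀ t ≥ t0, Real.exp (-2 * L) ≤ ‖Complex.exp (2 * Complex.I * Z (u t))‖ ∧ ‖Complex.exp (2 * Complex.I * Z (u t))‖ ≤ Real.exp (2 * L) := by
    intro t ht
    rw [Complex.norm_exp]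
    have e : (2 * Complex.I * Z (u t)).re = -2 * (Z (u t)).im := by simp
    rw [e, Real.exp_le_exp, Real.exp_le_exp]
    have := abs_le.1 (hu t ht).2
    constructor <;> linarith
  have hξ1 : Tendsto (fun t => ξ (u t)) atTop (𝓝 1) := by
    rw [tendsto_iff_norm_sub_tendsto_zero]
    refine squeeze_zero' (Eventually.of_forall fun _ => norm_nonneg _) ?_ (hre.const_div_atTop C)
    filter_upwards [eventually_ge_atTop t0] with t ht
    exact (hξ _ (hu t ht).1).2.2
  obtain ⟨ρ, hρ, -⟩ := mv_lim hdet a atTop _ (Real.exp (2 * L) * 3) (by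
    filter_upwards [eventually_ge_atTop t0] with t ht
    rw [norm_mul]
    exact mul_le_mul (hen t ht).2 (hξ _ (hu t ht).1).2.1 (norm_nonneg _) (Real.exp_pos _).le) ha
  have he : Tendsto (fun t => Complex.exp (2 * Complex.I * Z (u t))) atTop (𝓝 ρ) := by
    have h1 := hρ.div hξ1 one_ne_zero
    rw [div_one] at h1
    refine h1.congr' ?_
    filter_upwards [eventually_ge_atTop t0] with t ht
    have : ξ (u t) ≠ 0 := by
      rw [← norm_pos_iff]; linarith [(hξ _ (hu t ht).1).1]
    exact mul_div_cancel_right₀ _ this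
  have her : Tendsto (fun t => (Complex.exp (2 * Complex.I * Z (u t))).re) atTop (𝓝 ρ.re) :=
    (Complex.continuous_re.tendsto ρ).comp he
  obtain ⟨T, hT⟩ := ((Metric.tendsto_nhds.1 her _ (Real.exp_pos (-2 * L))).and (eventually_ge_atTop t0)).exists_forall_of_atTop
  have hT0 : t0 ≤ T := (hT T le_rfl).2
  have ivt : ∀ y, (Z (u T)).re ≤ y → ∃ t ≥ T, (Z (u t)).re = y := by
    intro y hy
    obtain ⟨T2, hT2, hT2'⟩ := ((hg.eventually_ge_atTop y).and (eventually_ge_atTop T)).exists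
    have := intermediate_value_Icc hT2' (hgc.mono fun t ht => hT0.trans ht.1)
    obtain ⟨t, ht, hty⟩ := this ⟨hy, hT2⟩
    exact ⟨t, ht.1, hty⟩
  have hexpre : ∀ t, (Complex.exp (2 * Complex.I * Z (u t))).re = ‖Complex.exp (2 * Complex.I * Z (u t))‖ * Real.cos (2 * (Z (u t)).re) := by
    intro t
    rw [Complex.exp_re, Complex.norm_exp]
    congr 2; simp
  obtain ⟨k, hk⟩ := exists_nat_gt ((Z (u T)).re / Real.pi)
  rw [div_lt_iff₀ Real.pi_pos] at hk
  obtain ⟨t1, ht1, h1⟩ := ivt (k * Real.pi) hk.le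
  obtain ⟨t2, ht2, h2⟩ := ivt (k * Real.pi + Real.pi / 2) (by linarith [Real.pi_pos])
  have a1 := (hT t1 ht1).1
  have a2 := (hT t2 ht2).1
  rw [Real.dist_eq, hexpre, h1] at a1
  rw [Real.dist_eq, hexpre, h2] at a2
  have c1 : Real.cos (2 * (k * Real.pi)) = 1 := by
    rw [← Real.cos_nat_mul_two_pi k]; congr 1; ring
  have c2 : Real.cos (2 * (k * Real.pi + Real.pi / 2)) = -1 := by
    rw [← Real.cos_nat_mul_two_pi_add_pi k]; congr 1; ring
  rw [c1] at a1; rw [c2] at a2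
  have b1 := (hen t1 (hT0.trans ht1)).1
  have b2 := (hen t2 (hT0.trans ht2)).1
  have := (abs_lt.1 a1).2
  have := (abs_lt.1 a2).1
  linarith

/-- a path eventually confined to the strip in every sector chart is impossible -/
lemma no_strip (f : ℂ → ℂ) (Pf : Set ℂ) (N : ℕ) (hN : 1 ≤ N) (β0 : ℂ) (β κ : Fin (2*N) → ℂ)
    (hβ : ∀ j, β j = β0 + Complex.I * Real.pi * (j:ℕ) / N)
    (hκ : ∀ j, ‖κ j‖ = 1) (hκr : ∀ j, 7/10 ≤ (κ j).re)
    (R C : Fin (2*N) → ℝ) (hR : ∀ j, 1 ≤ R j) (Z ω ξ : Fin (2*N) → ℂ → ℂ) (A B A' B' : Fin (2*N) → ℂ)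
    (hdet : ∀ j, A j * B' j - A' j * B j ≠ 0)
    (hZ : ∀ j, ∀ u ∈ HP (R j), HasDerivAt (Z j) (ω j u) u ∧ ‖ω j u - κ j‖ ≤ 1 / 10)
    (hval : ∀ j, ∀ u ∈ HP (R j), valueAt f Pf (phi N (β j) u) = mv (A j) (B j) (A' j) (B' j) (Complex.exp (2 * Complex.I * Z j u) * ξ j u))
    (hξ : ∀ j, ∀ u ∈ HP (R j), 1/3 ≤ ‖ξ j u‖ ∧ ‖ξ j u‖ ≤ 3 ∧ ‖ξ j u - 1‖ ≤ C j / u.re)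
    (a : Option ℂ) (γ : ℝ → ℂ) (hγ : AsymptoticPath f Pf a γ) (L T : ℝ)
    (hs : ∀ j, ∀ t > T, ∀ u ∈ HP (R j), γ t = phi N (β j) u → |(Z j u).im| ≤ L) : False := by
  choose D hD hDb using fun j => Z_lin (R j) (Z j) (ω j) (κ j) (hZ j)
  -- thresholds
  choose M hM0 hM using fun j => phi_big N hN (β j) (3 * (R j + 1) + 2 * (D j + |L|))
  obtain ⟨M', hM'⟩ := (Set.finite_range M).bddAbove
  have hM'j : ∀ j, M j ≤ M' := fun j => hM' (mem_range_self j)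
  obtain ⟨t0, ht0⟩ := ((hγ.2.1.eventually_gt_atTop M').and (eventually_gt_atTop (max T 0))).exists_forall_of_atTop
  have hbig : ∀ j, ∀ t ≥ t0, ∀ u, u ≠ 0 → γ t = phi N (β j) u → 3 * (R j + 1) + 2 * (D j + |L|) < ‖u‖ := by
    intro j t ht u hu e
    exact hM j u hu (by rw [← e]; exact lt_of_le_of_lt (hM'j j) (ht0 t ht).1)
  have hz0 : γ t0 ≠ 0 := by
    intro h
    have h1 := (ht0 t0 le_rfl).1
    rw [h, norm_zero] at h1
    have j0 : Fin (2 * N) := ⟨0, by omega⟩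
    linarith [hM0 j0, hM'j j0]
  obtain ⟨j, u0, hu0, hu0a, hu0φ⟩ := phi_cover N hN β0 (γ t0) hz0
  rw [← hβ j] at hu0φ
  have hR1 := hR j
  have hLa := abs_nonneg L
  have hDj := hD j
  have hu0R : u0 ∈ HP (R j) := by
    have h1 := hbig j t0 le_rfl u0 hu0 hu0φ.symm
    have h2 := Complex.norm_le_abs_re_add_abs_im u0
    have h3 : |u0.re| = u0.re := abs_of_nonneg ((abs_nonneg _).trans hu0a)
    change R j < u0.re
    linarith
  -- the curve stays in the chart
  have hstay : γ '' Ici t0 ⊆ phi N (β j) '' HP (R j) := by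
    have hconn : IsPreconnected (γ '' Ici t0) := by
      apply isPreconnected_Ici.image
      exact hγ.1.mono fun t ht => le_trans (le_of_lt (lt_of_le_of_lt (le_max_right T 0) (ht0 t0 le_rfl).2)) ht
    have hGF : phi N (β j) '' {u | R j + 1 ≤ u.re} ⊆ phi N (β j) '' HP (R j) :=
      image_mono fun u hu => by
        have : R j + 1 ≤ u.re := hu
        change R j < u.re
        linarith
    have hFG : ∀ z ∈ γ '' Ici t0, z ∈ phi N (β j) '' HP (R j) → z ∈ phi N (β j) '' {u | R j + 1 ≤ u.re} := by
      rintro _ ⟨t, ht, rfl⟩ ⟨u, hu, e⟩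
      refine ⟨u, ?_, e⟩
      have hup : 0 < u.re := by have : R j < u.re := hu; linarith
      have h1 := hs j t (lt_of_le_of_lt (le_max_left T 0) (ht0 t ht).2) u hu e.symm
      have h2 := (strip_est (κ j) (hκ j) (hκr j) (Z j u) u hup (D j) |L| hDj hLa (hDb j u hu) (h1.trans (le_abs_self L))).1
      have h3 := hbig j t ht u (by rintro rfl; simp at hup) e.symm
      have h4 := Complex.norm_le_abs_re_add_abs_im u
      rw [abs_of_pos hup] at h4
      change R j + 1 ≤ u.re
      linarith
    intro z hz
    by_contra hzF
    obtain ⟨x, hx, hxF, hxG⟩ := hconn _ _ (phi_open N hN (β j) (R j) (by linarith))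
      (phi_closed N hN (β j) (R j + 1) (by linarith)).isOpen_compl
      (fun w _ => by
        by_cases h : w ∈ phi N (β j) '' {u | R j + 1 ≤ u.re}
        · exact Or.inl (hGF h)
        · exact Or.inr h)
      ⟨γ t0, ⟨t0, le_refl t0, rfl⟩, ⟨u0, hu0R, hu0φ⟩⟩ ⟨z, hz, fun h => hzF (hGF h)⟩
    exact hxG (hFG x hx hxF)
  let u : ℝ → ℂ := fun t => Uinv N (β j) (γ t)
  have hu : ∀ t ≥ t0, u t ∈ HP (R j) ∧ γ t = phi N (β j) (u t) := by
    intro t ht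
    obtain ⟨v, hv, e⟩ := hstay ⟨t, ht, rfl⟩
    have : u t = v := by
      change Uinv N (β j) (γ t) = v
      rw [← e]
      exact Uinv_phi N hN _ (by have : R j < v.re := hv; linarith)
    rw [this]; exact ⟨hv, e.symm⟩
  have hT : ∀ t ≥ t0, t > T := fun t ht => lt_of_le_of_lt (le_max_left T 0) (ht0 t ht).2
  refine no_stay (R j) (C j) (Z j) (ω j) (ξ j) (A j) (B j) (A' j) (B' j) hR1 (hdet j) (κ j) (hκ j) (hκr j) (hZ j) (hξ j) u t0 L ?_
    (fun t ht => ⟨(hu t ht).1, hs j t (hT t ht) _ (hu t ht).1 (hu t ht).2⟩) ?_ a ?_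
  · intro t ht
    have h1 : ContinuousWithinAt γ (Ici t0) t := (hγ.1.mono fun t ht => le_trans (le_of_lt (lt_of_le_of_lt (le_max_right T 0) (ht0 t0 le_rfl).2)) ht) t ht
    have h2 : ContinuousAt (Uinv N (β j)) (γ t) := by
      rw [(hu t ht).2]
      exact Uinv_cont N hN _ (by have : R j < (u t).re := (hu t ht).1; linarith)
    exact h2.comp_continuousWithinAt h1
  · rw [tendsto_atTop]
    intro b
    obtain ⟨M2, -, hM2⟩ := phi_big N hN (β j) b
    filter_upwards [hγ.2.1.eventually_gt_atTop M2, eventually_ge_atTop t0] with t h1 h2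
    have h3 : R j < (u t).re := (hu t h2).1
    refine (hM2 (u t) (by intro h; rw [h] at h3; simp at h3; linarith) ?_).le
    rw [← (hu t h2).2]; exact h1
  · refine hγ.2.2.congr' ?_
    filter_upwards [eventually_ge_atTop t0] with t ht
    rw [← hval j _ (hu t ht).1, ← (hu t ht).2]

lemma count_sing (f : ℂ → ℂ) (Pf : Set ℂ) (hf : TranscMeroPlane f Pf) (p q : Polynomial ℂ) (hp : p ≠ 0) (hq : q ≠ 0)
    (hrat : ∀ z, z ∉ Pf → deriv f z ≠ 0 → q.eval z ≠ 0 → schwarzian f z = p.eval z / q.eval z)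
    (N : ℕ) (hN : 1 ≤ N) (hNd : q.natDegree + N = p.natDegree + 2) : FinitelyManyTranscSing f Pf := by
  obtain ⟨c, hc, hlim⟩ := poly_lim p q hp hq N hNd
  have hN0 : (N:ℂ) ≠ 0 := by exact_mod_cast (by omega : N ≠ 0)
  set β0 : ℂ := Complex.log (Complex.I * N ^ 2 / (2 * c)) / N with hβ0
  have hb0 : Complex.exp (N * β0) = Complex.I * N ^ 2 / (2 * c) := by
    rw [hβ0, mul_div_cancel₀ _ hN0, Complex.exp_log]
    exact div_ne_zero (mul_ne_zero Complex.I_ne_zero (pow_ne_zero 2 hN0)) (mul_ne_zero two_ne_zero hc)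
  let β : Fin (2 * N) → ℂ := fun j => β0 + Complex.I * Real.pi * (j:ℕ) / N
  have hbj : ∀ j, 2 * c * Complex.exp (N * β j) / N ^ 2 = Complex.I * (-1) ^ (j:ℕ) := by
    intro j
    have e : (N:ℂ) * β j = N * β0 + (j:ℕ) * (Real.pi * Complex.I) := by
      simp only [β]; field_simp
    rw [e, Complex.exp_add, hb0, Complex.exp_nat_mul, Complex.exp_pi_mul_I]
    field_simp
  have hs2 : (√2) ^ 2 = 2 := Real.sq_sqrt (by norm_num)
  have hs0 := Real.sqrt_nonneg 2
  have hs14 : 14/10 ≤ √2 := by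
    apply Real.le_sqrt_of_sq_le; norm_num
  have hκex : ∀ j : Fin (2 * N), ∃ κ : ℂ, ‖κ‖ = 1 ∧ 7/10 ≤ κ.re ∧ 2 * c * Complex.exp (N * β j) / N ^ 2 = κ ^ 2 := by
    intro j
    have gen : ∀ σ : ℝ, σ ^ 2 = 1 → ∃ κ : ℂ, ‖κ‖ = 1 ∧ 7/10 ≤ κ.re ∧ Complex.I * (σ:ℂ) = κ ^ 2 := by
      intro σ hσ
      refine ⟨⟨√2 / 2, σ * (√2 / 2)⟩, ?_, ?_, ?_⟩
      · have h := Complex.sq_norm (⟨√2 / 2, σ * (√2 / 2)⟩ : ℂ)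
        rw [Complex.normSq_mk] at h
        have h2 : √2 / 2 * (√2 / 2) + σ * (√2 / 2) * (σ * (√2 / 2)) = 1 := by nlinarith
        rw [h2] at h
        nlinarith [norm_nonneg (⟨√2 / 2, σ * (√2 / 2)⟩ : ℂ)]
      · change 7/10 ≤ √2 / 2
        linarith
      · apply Complex.ext
        · simp [pow_two]; nlinarith
        · simp [pow_two]; linear_combination (-σ / 2) * hs2
    rw [hbj]
    rcases neg_one_pow_eq_or ℂ (j:ℕ) with h | h <;> rw [h]
    · simpa using gen 1 (by norm_num)
    · simpa using gen (-1) (by norm_num)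
  choose κ hκ hκr hκβ using hκex
  choose R hR C Z ω ξ A B A' B' hdet hZ hval hξ using fun j =>
    sector f Pf hf p q hrat N hN c hc hlim (β j) (κ j) (hκ j) (hκr j) (hκβ j)
  let sg : Bool → ℝ := fun b => if b then 1 else -1
  have hsg : ∀ b, sg b = 1 ∨ sg b = -1 := by intro b; cases b <;> simp [sg]
  let H : Fin (2 * N) → Bool → ℝ → Set ℂ := fun j b L => {u | u ∈ HP (R j) ∧ L < sg b * (Z j u).im}
  have hφc : ∀ j, ContinuousOn (phi N (β j)) (HP (R j)) := by
    intro j u hu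
    have : R j < u.re := hu
    exact (phi_deriv N (β j) (Or.inl (by linarith [hR j]))).continuousAt.continuousWithinAt
  have hHconn : ∀ j b L, IsPreconnected (phi N (β j) '' H j b L) := fun j b L =>
    (tract_conn (R j) (Z j) (ω j) (κ j) (hκ j) (hκr j) (hZ j) (sg b) (hsg b) L).image _ ((hφc j).mono fun u hu => hu.1)
  have hnorm : ∀ j u, ‖Complex.exp (2 * Complex.I * Z j u)‖ = Real.exp (-2 * (Z j u).im) := by
    intro j u
    rw [Complex.norm_exp]; congr 1; simp
  have same : ∀ j b a₁ a₂ γ₁ γ₂, AsymptoticPath f Pf a₁ γ₁ → AsymptoticPath f Pf a₂ γ₂ →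
      (∀ L T : ℝ, ∃ t > T, ∃ u ∈ H j b L, γ₁ t = phi N (β j) u) → (∀ L T : ℝ, ∃ t > T, ∃ u ∈ H j b L, γ₂ t = phi N (β j) u) →
      ¬ DistinctSingularities f Pf a₁ a₂ γ₁ γ₂ := by
    intro j b a₁ a₂ γ₁ γ₂ h₁ h₂ m₁ m₂
    cases b with
    | true =>
      refine tract_same f Pf (A j) (B j) (A' j) (B' j) (hdet j) (phi N (β j)) (fun u => Complex.exp (2 * Complex.I * Z j u) * ξ j u)
        (H j true) (hHconn j true) (fun L u hu => hval j u hu.1) ?_ a₁ a₂ γ₁ γ₂ h₁ h₂ m₁ m₂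
      intro L u hu
      have h1 : L < sg true * (Z j u).im := hu.2
      simp only [sg, if_true, one_mul] at h1
      rw [norm_mul, hnorm, mul_comm]
      exact mul_le_mul (hξ j u hu.1).2.1 (Real.exp_le_exp.2 (by linarith)) (Real.exp_pos _).le (by norm_num)
    | false =>
      have hξ0 : ∀ u ∈ HP (R j), ξ j u ≠ 0 := fun u hu => by
        rw [← norm_pos_iff]; linarith [(hξ j u hu).1]
      refine tract_same f Pf (A' j) (B' j) (A j) (B j) (by intro h; apply hdet j; linear_combination -h) (phi N (β j))
        (fun u => (Complex.exp (2 * Complex.I * Z j u) * ξ j u)⁻¹)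
        (H j false) (hHconn j false) (fun L u hu => ?_) ?_ a₁ a₂ γ₁ γ₂ h₁ h₂ m₁ m₂
      · rw [hval j u hu.1, mv_inv _ _ _ _ _ (mul_ne_zero (Complex.exp_ne_zero _) (hξ0 u hu.1))]
      intro L u hu
      have h1 : L < sg false * (Z j u).im := hu.2
      simp [sg] at h1
      rw [norm_inv, norm_mul, hnorm, mul_inv, ← Real.exp_neg, mul_comm]
      have h3 : ‖ξ j u‖⁻¹ ≤ 3 := by
        rw [inv_le_comm₀ (norm_pos_iff.2 (hξ0 u hu.1)) (by norm_num)]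
        linarith [(hξ j u hu.1).1]
      exact mul_le_mul h3 (Real.exp_le_exp.2 (by linarith)) (Real.exp_pos _).le (by norm_num)
  have meets : ∀ a γ, AsymptoticPath f Pf a γ → ∃ jb : Fin (2 * N) × Bool, ∀ L T : ℝ, ∃ t > T, ∃ u ∈ H jb.1 jb.2 L, γ t = phi N (β jb.1) u := by
    intro a γ hγ
    by_contra hcon
    push Not at hcon
    choose L T hLT using hcon
    obtain ⟨L', hL'⟩ := (Set.finite_range L).bddAbove
    obtain ⟨T', hT'⟩ := (Set.finite_range T).bddAbove
    refine no_strip f Pf N hN β0 β κ (fun j => rfl) hκ hκr R C hR Z ω ξ A B A' B' hdet hZ hval hξ a γ hγ L' T' ?_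
    intro j t ht u hu e
    have key : ∀ b, sg b * (Z j u).im ≤ L' := by
      intro b
      by_contra hb
      push Not at hb
      exact hLT (j, b) t (lt_of_le_of_lt (hT' (mem_range_self (j, b))) ht) u ⟨hu, lt_of_le_of_lt (hL' (mem_range_self (j, b))) hb⟩ e
    have k1 := key true
    have k2 := key false
    simp [sg] at k1 k2
    exact abs_le.2 ⟨by linarith, k1⟩
  refine ⟨Fintype.card (Fin (2 * N) × Bool), fun m a γ hA hD => ?_⟩
  choose jb hjb using fun i => meets (a i) (γ i) (hA i)
  have hinj : Function.Injective jb := by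
    intro i i' h
    by_contra hne
    refine same (jb i).1 (jb i).2 (a i) (a i') (γ i) (γ i') (hA i) (hA i') (hjb i) ?_ (hD i i' hne)
    rw [h]; exact hjb i'
  simpa using Fintype.card_le_of_injective jb hinj




lemma punct_nested {z0 : ℂ} {P : ℂ → Prop} (h : ∀ᶠ z in 𝓝[≠] z0, P z) : ∀ᶠ z in 𝓝[≠] z0, ∀ᶠ y in 𝓝 z, P y := by
  have h1 := (eventually_nhdsWithin_iff.1 h).eventually_nhds
  rw [eventually_nhdsWithin_iff]
  filter_upwards [h1] with z hz hne
  filter_upwards [hz, isOpen_ne.mem_nhds hne] with y hy hy'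
  exact hy hy'

lemma deriv_zpow_form {F G : ℂ → ℂ} {z0 : ℂ} (k : ℤ) (hG : AnalyticAt ℂ G z0)
    (h : ∀ᶠ z in 𝓝[≠] z0, F z = (z - z0) ^ k * G z) :
    ∀ᶠ z in 𝓝[≠] z0, deriv F z = (z - z0) ^ (k - 1) * (k * G z + (z - z0) * deriv G z) := by
  filter_upwards [punct_nested h, mem_nhdsWithin_of_mem_nhds hG.eventually_analyticAt, self_mem_nhdsWithin] with z hz hGz hne
  have hne' : z - z0 ≠ 0 := sub_ne_zero.2 hne
  rw [Filter.EventuallyEq.deriv_eq hz]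
  have h1 : HasDerivAt (fun y : ℂ => (y - z0) ^ k) (k * (z - z0) ^ (k - 1)) z := by
    have := (hasDerivAt_zpow k (z - z0) (Or.inl hne')).comp_sub_const z z0
    exact this
  refine (h1.mul hGz.differentiableAt.hasDerivAt).deriv.trans ?_
  rw [zpow_sub_one₀ hne']
  field_simp

lemma schw_mult {f g : ℂ → ℂ} {z0 : ℂ} (k : ℤ) (hg : AnalyticAt ℂ g z0) (hg0 : g z0 ≠ 0)
    (h : ∀ᶠ z in 𝓝[≠] z0, deriv f z = (z - z0) ^ k * g z) :
    Tendsto (fun z => (z - z0) ^ 2 * schwarzian f z) (𝓝[≠] z0) (𝓝 (-(k * (k + 2)) / 2)) := by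
  set g1 : ℂ → ℂ := fun z => k * g z + (z - z0) * deriv g z with hg1
  have ag1 : AnalyticAt ℂ g1 z0 := by
    have := hg.deriv
    fun_prop
  have h1 := deriv_zpow_form k hg h
  set g2 : ℂ → ℂ := fun z => ((k - 1 : ℤ) : ℂ) * g1 z + (z - z0) * deriv g1 z with hg2
  have ag2 : AnalyticAt ℂ g2 z0 := by
    have := ag1.deriv
    fun_prop
  have h2 := deriv_zpow_form (k - 1) ag1 h1
  have hlim : Tendsto (fun z => g2 z / g z - 3 / 2 * (g1 z / g z) ^ 2) (𝓝[≠] z0) (𝓝 (g2 z0 / g z0 - 3 / 2 * (g1 z0 / g z0) ^ 2)) := by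
    have c0 := hg.continuousAt
    have c1 := ag1.continuousAt
    have c2 := ag2.continuousAt
    have : ContinuousAt (fun z => g2 z / g z - 3 / 2 * (g1 z / g z) ^ 2) z0 :=
      (c2.div c0 hg0).sub (((c1.div c0 hg0).pow 2).const_mul _)
    exact this.tendsto.mono_left nhdsWithin_le_nhds
  have e : g2 z0 / g z0 - 3 / 2 * (g1 z0 / g z0) ^ 2 = -(k * (k + 2)) / 2 := by
    simp only [hg2, hg1, sub_self, zero_mul, add_zero]
    push_cast
    field_simp
    ring
  rw [e] at hlim
  refine hlim.congr' ?_
  filter_upwards [h, h1, h2, self_mem_nhdsWithin, mem_nhdsWithin_of_mem_nhds (hg.continuousAt.eventually_ne hg0)] with z e0 e1 e2 hne hgz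
  have hne' : z - z0 ≠ 0 := sub_ne_zero.2 hne
  rw [schwarzian, e0, e1, e2]
  have hw := zpow_ne_zero k hne'
  rw [zpow_sub_one₀ hne', zpow_sub_one₀ hne']
  change g2 z / g z - 3 / 2 * (g1 z / g z) ^ 2 = (z - z0) ^ 2 * ((z - z0) ^ k * (z - z0)⁻¹ * (z - z0)⁻¹ * g2 z / ((z - z0) ^ k * g z) - 3 / 2 * ((z - z0) ^ k * (z - z0)⁻¹ * g1 z / ((z - z0) ^ k * g z)) ^ 2)
  generalize (z - z0) ^ k = X at *
  generalize g2 z = b at *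
  generalize g1 z = c at *
  generalize g z = d at *
  field_simp

lemma mult_root (f : ℂ → ℂ) (Pf : Set ℂ) (hf : TranscMeroPlane f Pf) (p q : Polynomial ℂ)
    (hrat : ∀ z, z ∉ Pf → deriv f z ≠ 0 → q.eval z ≠ 0 → schwarzian f z = p.eval z / q.eval z)
    (z0 : ℂ) (hm : MultiplePoint f z0) : q.eval z0 = 0 := by
  by_contra hq
  have hform : ∃ (k : ℤ) (g : ℂ → ℂ), AnalyticAt ℂ g z0 ∧ g z0 ≠ 0 ∧ k ≠ 0 ∧ k ≠ -2 ∧ ∀ᶠ z in 𝓝[≠] z0, deriv f z = (z - z0) ^ k * g z := by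
    obtain ⟨μ, hμ, ⟨hμ0, g, hg, hg0, h⟩ | ⟨-, hμ0, g, hg, hg0, h⟩⟩ := hm
    · have h' : ∀ᶠ z in 𝓝[≠] z0, f z = (z - z0) ^ (-(μ:ℤ)) * g z := by
        filter_upwards [h] with z hz
        rw [hz, zpow_neg, zpow_natCast, div_eq_inv_mul]
      refine ⟨-(μ:ℤ) - 1, _, ?_, ?_, by omega, by omega, deriv_zpow_form _ hg h'⟩
      · have := hg.deriv
        fun_prop
      · simp [hg0]; omega
    · refine ⟨((μ - 1 : ℕ) : ℤ), g, hg, hg0, by omega, by omega, ?_⟩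
      filter_upwards [mem_nhdsWithin_of_mem_nhds h] with z hz
      rw [hz, zpow_natCast]
  obtain ⟨k, g, hg, hg0, hk0, hk2, h⟩ := hform
  have h1 := schw_mult k hg hg0 h
  have hqc : ContinuousAt (fun z => q.eval z) z0 := q.continuous.continuousAt
  have h2 : Tendsto (fun z => (z - z0) ^ 2 * (p.eval z / q.eval z)) (𝓝[≠] z0) (𝓝 0) := by
    have : ContinuousAt (fun z => (z - z0) ^ 2 * (p.eval z / q.eval z)) z0 :=
      (by fun_prop : ContinuousAt (fun z => (z - z0) ^ 2) z0).mul (p.continuous.continuousAt.div hqc hq)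
    have := this.tendsto.mono_left (nhdsWithin_le_nhds (s := {z0}ᶜ))
    simpa using this
  have h3 : Tendsto (fun z => (z - z0) ^ 2 * schwarzian f z) (𝓝[≠] z0) (𝓝 0) := by
    refine h2.congr' ?_
    filter_upwards [tm_deriv hf z0, mem_nhdsWithin_of_mem_nhds (hqc.eventually_ne hq)] with z hz hqz
    rw [hrat z hz.1 hz.2 hqz]
  have := tendsto_nhds_unique h1 h3
  have h4 : (k:ℂ) * (k + 2) = 0 := by linear_combination (-2) * this
  have h5 : k * (k + 2) = 0 := by exact_mod_cast h4
  rcases mul_eq_zero.1 h5 with h6 | h6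
  · exact hk0 h6
  · exact hk2 (by omega)




lemma entire_poly {h : ℂ → ℂ} (hd : Differentiable ℂ h) (C R : ℝ) (n : ℕ)
    (hb : ∀ z, R ≤ ‖z‖ → ‖h z‖ ≤ C * ‖z‖ ^ n) : ∃ P : Polynomial ℂ, ∀ z, h z = P.eval z := by
  have hz : ∀ m, n < m → iteratedDeriv m h 0 = 0 := by
    intro m hm
    have hlim : Tendsto (fun r : ℝ => (m.factorial * C) * r ^ (-((m - n : ℕ) : ℤ))) atTop (𝓝 ((m.factorial * C) * 0)) := by
      refine Tendsto.const_mul _ ?_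
      simp_rw [zpow_neg, zpow_natCast]
      exact tendsto_inv_atTop_zero.comp (tendsto_pow_atTop (by omega))
    have hle : ‖iteratedDeriv m h 0‖ ≤ (m.factorial * C) * 0 := by
      refine ge_of_tendsto hlim ?_
      filter_upwards [eventually_gt_atTop (max R 0)] with r hr
      have hr0 : 0 < r := lt_of_le_of_lt (le_max_right _ _) hr
      have hrR : R ≤ r := (le_max_left _ _).trans hr.le
      have := Complex.norm_iteratedDeriv_le_of_forall_mem_sphere_norm_le (c := 0) (C := C * r ^ n) m hr0 hd.diffContOnCl (by
        intro z hz
        have : ‖z‖ = r := by simpa using hz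
        have h2 := hb z (by rw [this]; exact hrR)
        rwa [this] at h2)
      refine this.trans (le_of_eq ?_)
      rw [zpow_neg, zpow_natCast]
      have : r ^ m = r ^ (m - n) * r ^ n := by rw [← pow_add]; congr 1; omega
      rw [this]
      field_simp
    rw [mul_zero] at hle
    exact norm_le_zero_iff.1 hle
  refine ⟨∑ i ∈ Finset.range (n + 1), Polynomial.C ((i.factorial : ℂ)⁻¹ * iteratedDeriv i h 0) * Polynomial.X ^ i, fun z => ?_⟩
  have hs := Complex.hasSum_taylorSeries_of_entire hd 0 z
  have hs2 := hasSum_sum_of_ne_finset_zero (L := SummationFilter.unconditional ℕ) (f := fun i : ℕ => (i.factorial : ℂ)⁻¹ • (z - 0) ^ i • iteratedDeriv i h 0) (s := Finset.range (n + 1)) (by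
    intro i hi
    simp only [Finset.mem_range] at hi
    rw [hz i (by omega)]; simp)
  rw [hs.unique hs2, Polynomial.eval_finsetSum]
  refine Finset.sum_congr rfl fun i _ => ?_
  simp
  ring

lemma poly_growth (Q : Polynomial ℂ) : ∃ C : ℝ, ∃ n : ℕ, 0 ≤ C ∧ ∀ z : ℂ, 1 ≤ ‖z‖ → ‖Q.eval z‖ ≤ C * ‖z‖ ^ n := by
  refine ⟨∑ i ∈ Finset.range (Q.natDegree + 1), ‖Q.coeff i‖, Q.natDegree, Finset.sum_nonneg fun _ _ => norm_nonneg _, fun z hz => ?_⟩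
  rw [Polynomial.eval_eq_sum_range, Finset.sum_mul]
  refine (norm_sum_le _ _).trans (Finset.sum_le_sum fun i hi => ?_)
  rw [norm_mul, norm_pow]
  have hi' : i ≤ Q.natDegree := by simp at hi; omega
  gcongr

lemma rational_of_growth {f : ℂ → ℂ} {P : Set ℂ} (h : MeroPlane f P) (C R : ℝ) (n : ℕ)
    (hP : ∀ z ∈ P, ‖z‖ ≤ R) (hb : ∀ z, R < ‖z‖ → ‖f z‖ ≤ C * ‖z‖ ^ n) : RationalFn f P := by
  classical
  have hfin : P.Finite := (h.1 (Metric.closedBall 0 R) (isCompact_closedBall _ _)).subset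
    (fun z hz => ⟨hz, by simpa using hP z hz⟩)
  have hm : ∀ z, ∃ k : ℕ, AnalyticAt ℂ (fun w => (w - z) ^ k • f w) z := fun z => mp_mero h z
  choose k hk using hm
  set Q : Polynomial ℂ := ∏ a ∈ hfin.toFinset, (Polynomial.X - Polynomial.C a) ^ k a with hQ
  have hQ0 : Q ≠ 0 := Finset.prod_ne_zero_iff.2 fun a _ => pow_ne_zero _ (Polynomial.X_sub_C_ne_zero a)
  -- values at poles: use Q f modified
  have hloc : ∀ z, ∃ G : ℂ → ℂ, AnalyticAt ℂ G z ∧ ∀ᶠ w in 𝓝[≠] z, Q.eval w * f w = G w := by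
    intro z
    by_cases hz : z ∈ P
    · have e : Q = (Polynomial.X - Polynomial.C z) ^ k z * ∏ a ∈ hfin.toFinset.erase z, (Polynomial.X - Polynomial.C a) ^ k a := by
        rw [hQ, Finset.mul_prod_erase _ (fun a => (Polynomial.X - Polynomial.C a) ^ k a)]
        simpa using hz
      set Q1 := ∏ a ∈ hfin.toFinset.erase z, (Polynomial.X - Polynomial.C a) ^ k a
      refine ⟨fun w => Q1.eval w * ((w - z) ^ k z • f w), ?_, Eventually.of_forall fun w => ?_⟩
      · exact (AnalyticOnNhd.eval_polynomial (A := ℂ) Q1 z (mem_univ z)).mul (hk z)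
      · rw [e]; simp; ring
    · exact ⟨fun w => Q.eval w * f w, (AnalyticOnNhd.eval_polynomial (A := ℂ) Q z (mem_univ z)).mul (h.2.1 z hz), Eventually.of_forall fun w => rfl⟩
  choose G hG hGe using hloc
  set H : ℂ → ℂ := fun z => if z ∈ P then G z z else Q.eval z * f z with hH
  have hHa : ∀ z, H =ᶠ[𝓝 z] G z := by
    intro z
    have h1 := hGe z
    have h2 : H z = G z z := by
      simp only [hH]
      split_ifs with hz
      · rfl
      · have c1 : Tendsto (fun w => Q.eval w * f w) (𝓝[≠] z) (𝓝 (Q.eval z * f z)) :=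
          ((Q.continuous.continuousAt).mul (h.2.1 z hz).continuousAt).tendsto.mono_left nhdsWithin_le_nhds
        have c2 : Tendsto (G z) (𝓝[≠] z) (𝓝 (G z z)) := (hG z).continuousAt.tendsto.mono_left nhdsWithin_le_nhds
        exact tendsto_nhds_unique c1 (c2.congr' (by filter_upwards [h1] with w hw using hw.symm))
    have h3 : ∀ᶠ w in 𝓝[≠] z, H w = G z w := by
      filter_upwards [h1, mp_discrete h z] with w a b
      simp only [hH, if_neg b]; exact a
    rw [eventually_nhdsWithin_iff] at h3
    filter_upwards [h3] with w hw
    by_cases hwz : w = z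
    · rw [hwz]; exact h2
    · exact hw hwz
  have hd : Differentiable ℂ H := fun z => ((hG z).congr (hHa z).symm).differentiableAt
  obtain ⟨C1, n1, hC1, hQg⟩ := poly_growth Q
  obtain ⟨p, hp⟩ := entire_poly hd (C1 * C) (max (R + 1) 1) (n1 + n) (by
    intro z hz
    have hz1 : R < ‖z‖ := by have := (le_max_left _ _).trans hz; linarith
    have hzP : z ∉ P := fun hzP => absurd (hP z hzP) (not_le.2 hz1)
    simp only [hH, if_neg hzP]
    rw [norm_mul, pow_add]
    have a := hQg z ((le_max_right _ _).trans hz)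
    have b := hb z hz1
    calc _ ≤ (C1 * ‖z‖ ^ n1) * (C * ‖z‖ ^ n) := by gcongr
      _ = _ := by ring)
  refine ⟨p, Q, hQ0, fun z hz hq => ?_⟩
  rw [← hp z]
  simp only [hH, if_neg hz]
  field_simp

lemma lower_growth (g : ℂ → ℂ) (R C : ℝ) (K : ℕ) (hR : 0 < R) (hg : ∀ z, R < ‖z‖ → AnalyticAt ℂ g z)
    (hb : ∀ z, R < ‖z‖ → ‖g z‖ ≤ C * ‖z‖ ^ K) (hne : ∀ r, ∃ z, r < ‖z‖ ∧ g z ≠ 0) :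
    ∃ (n : ℕ) (c R2 : ℝ), 0 < c ∧ ∀ z, R2 < ‖z‖ → c ≤ ‖g z‖ * ‖z‖ ^ n := by
  set G : ℂ → ℂ := fun w => g w⁻¹ * w ^ (K + 1) with hG
  have hnear : ∀ᶠ w in 𝓝[≠] (0:ℂ), R < ‖w⁻¹‖ := by
    have := (tendsto_norm_inv_nhdsNE_zero_atTop (α := ℂ)).eventually_gt_atTop R
    simpa using this
  have hlim : Tendsto G (𝓝[≠] 0) (𝓝 0) := by
    have h0 : Tendsto (fun w : ℂ => C * ‖w‖) (𝓝[≠] 0) (𝓝 0) := by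
      have : ContinuousAt (fun w : ℂ => C * ‖w‖) 0 := by fun_prop
      have := this.tendsto.mono_left (nhdsWithin_le_nhds (s := {0}ᶜ))
      simpa using this
    refine squeeze_zero_norm' ?_ h0
    filter_upwards [hnear, self_mem_nhdsWithin] with w hw hw0
    have hw0' : 0 < ‖w‖ := norm_pos_iff.2 hw0
    have := hb _ hw
    rw [hG, norm_mul, norm_pow]
    calc _ ≤ (C * ‖w⁻¹‖ ^ K) * ‖w‖ ^ (K + 1) := by gcongr
      _ = C * ‖w‖ := by rw [norm_inv, pow_succ, inv_pow]; field_simp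
  have hG0 : G 0 = 0 := by simp [hG]
  have han : AnalyticAt ℂ G 0 := by
    apply Complex.analyticAt_of_differentiable_on_punctured_nhds_of_continuousAt
    · filter_upwards [hnear, self_mem_nhdsWithin] with w hw hw0
      have h1 : DifferentiableAt ℂ (fun w : ℂ => g w⁻¹) w :=
        DifferentiableAt.comp w (hg _ hw).differentiableAt (differentiableAt_inv hw0)
      exact h1.mul (by fun_prop)
    · rw [continuousAt_iff_punctured_nhds, hG0]; exact hlim
  have hne' : ¬ ∀ᶠ w in 𝓝 (0:ℂ), G w = 0 := by
    intro h0
    obtain ⟨ε, hε, hball⟩ := Metric.eventually_nhds_iff.1 h0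
    obtain ⟨z, hz, hgz⟩ := hne ε⁻¹
    have hz0 : 0 < ‖z‖ := (inv_pos.2 hε).trans hz
    have := @hball z⁻¹ (by rw [dist_zero_right, norm_inv]; exact inv_lt_of_inv_lt₀ hε hz)
    simp only [hG, inv_inv] at this
    exact (mul_ne_zero hgz (pow_ne_zero _ (inv_ne_zero (norm_pos_iff.1 hz0)))) this
  obtain ⟨m, u, hu, hu0, he⟩ := (han.exists_eventuallyEq_pow_smul_nonzero_iff).2 hne'
  have hu1 : ∀ᶠ w in 𝓝 (0:ℂ), ‖u 0‖ / 2 < ‖u w‖ := by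
    have := norm_pos_iff.2 hu0
    exact hu.continuousAt.norm.eventually_const_lt (by linarith)
  obtain ⟨ε, hε, hball⟩ := Metric.eventually_nhds_iff.1 (he.and hu1)
  refine ⟨m, ‖u 0‖ / 2, max ε⁻¹ 1, half_pos (norm_pos_iff.2 hu0), fun z hz => ?_⟩
  have hz1 : ε⁻¹ < ‖z‖ := (le_max_left _ _).trans_lt hz
  have hz0 : 0 < ‖z‖ := (inv_pos.2 hε).trans hz1
  obtain ⟨a, b⟩ := @hball z⁻¹ (by rw [dist_zero_right, norm_inv]; exact inv_lt_of_inv_lt₀ hε hz1)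
  simp only [hG, inv_inv, sub_zero, smul_eq_mul] at a
  have a' := congrArg norm a
  rw [norm_mul, norm_mul, norm_pow, norm_pow, norm_inv] at a'
  have h1 : ‖u z⁻¹‖ = ‖g z‖ * ‖z‖ ^ m * ‖z‖⁻¹ ^ (K + 1) := by
    have : ‖u z⁻¹‖ = ‖z‖ ^ m * (‖z‖⁻¹ ^ m * ‖u z⁻¹‖) := by
      rw [inv_pow]
      generalize ‖u z⁻¹‖ = X
      field_simp
    rw [this, ← a']; ring
  have h2 : ‖z‖⁻¹ ^ (K + 1) ≤ 1 := pow_le_one₀ (by positivity) (inv_le_one_of_one_le₀ ((le_max_right _ _).trans hz.le))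
  calc _ ≤ ‖u z⁻¹‖ := b.le
    _ ≤ ‖g z‖ * ‖z‖ ^ m * 1 := by rw [h1]; gcongr
    _ = _ := mul_one _




lemma ghat_exists (f : ℂ → ℂ) (Pf : Set ℂ) (hf : TranscMeroPlane f Pf) (p q : Polynomial ℂ)
    (hrat : ∀ z, z ∉ Pf → deriv f z ≠ 0 → q.eval z ≠ 0 → schwarzian f z = p.eval z / q.eval z) :
    ∃ g : ℂ → ℂ, (∀ z, q.eval z ≠ 0 → AnalyticAt ℂ g z) ∧ ∀ z, ∀ᶠ w in 𝓝[≠] z, g w = (deriv f w)⁻¹ := by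
  have hm : ∀ z, MeromorphicAt (deriv f) z := fun z => (mp_mero hf.1 z).deriv
  have hon : MeromorphicOn (deriv f)⁻¹ univ := fun z _ => (hm z).inv
  refine ⟨toMeromorphicNFOn (deriv f)⁻¹ univ, fun z0 hq => ?_, fun z => hon.toMeromorphicNFOn_eq_self_on_nhdsNE (mem_univ z)⟩
  refine ((meromorphicNFOn_toMeromorphicNFOn (deriv f)⁻¹ univ) (mem_univ z0)).meromorphicOrderAt_nonneg_iff_analyticAt.1 ?_
  rw [meromorphicOrderAt_toMeromorphicNFOn hon (mem_univ z0), meromorphicOrderAt_inv]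
  have hnt : meromorphicOrderAt (deriv f) z0 ≠ ⊤ := by
    rw [meromorphicOrderAt_ne_top_iff_eventually_ne_zero (hm z0)]
    filter_upwards [tm_deriv hf z0] with z hz using hz.2
  obtain ⟨k, hk⟩ := WithTop.ne_top_iff_exists.1 hnt
  obtain ⟨g, hg, hg0, h⟩ := (meromorphicOrderAt_eq_int_iff (hm z0)).1 hk.symm
  have h1 := schw_mult k hg hg0 h
  have hqc : ContinuousAt (fun z => q.eval z) z0 := q.continuous.continuousAt
  have h2 : Tendsto (fun z => (z - z0) ^ 2 * (p.eval z / q.eval z)) (𝓝[≠] z0) (𝓝 0) := by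
    have : ContinuousAt (fun z => (z - z0) ^ 2 * (p.eval z / q.eval z)) z0 :=
      (by fun_prop : ContinuousAt (fun z => (z - z0) ^ 2) z0).mul (p.continuous.continuousAt.div hqc hq)
    have := this.tendsto.mono_left (nhdsWithin_le_nhds (s := {z0}ᶜ))
    simpa using this
  have h3 : Tendsto (fun z => (z - z0) ^ 2 * schwarzian f z) (𝓝[≠] z0) (𝓝 0) := by
    refine h2.congr' ?_
    filter_upwards [tm_deriv hf z0, mem_nhdsWithin_of_mem_nhds (hqc.eventually_ne hq)] with z hz hqz
    rw [hrat z hz.1 hz.2 hqz]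
  have := tendsto_nhds_unique h1 h3
  have h4 : (k:ℂ) * (k + 2) = 0 := by linear_combination (-2) * this
  have h5 : k * (k + 2) = 0 := by exact_mod_cast h4
  rw [← hk]
  rcases mul_eq_zero.1 h5 with h6 | h6
  · rw [h6]; simp
  · rw [show k = -2 by omega]; decide

lemma ode_point {F : ℂ → ℂ} {w : ℂ} (hF : AnalyticAt ℂ F w) (h0 : F w ≠ 0) :
    deriv (deriv (deriv (fun z => (F z)⁻¹))) w
     + 2 * (deriv (deriv F) w / F w - 3 / 2 * (deriv F w / F w) ^ 2) * deriv (fun z => (F z)⁻¹) w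
     + deriv (fun z => deriv (deriv F) z / F z - 3 / 2 * (deriv F z / F z) ^ 2) w * (F w)⁻¹ = 0 := by
  have hev : ∀ᶠ z in 𝓝 w, AnalyticAt ℂ F z ∧ F z ≠ 0 :=
    hF.eventually_analyticAt.and (hF.continuousAt.eventually_ne h0)
  have e1 : ∀ᶠ z in 𝓝 w, deriv (fun z => (F z)⁻¹) z = - deriv F z / F z ^ 2 := by
    filter_upwards [hev] with z hz
    exact (hz.1.differentiableAt.hasDerivAt.inv hz.2).deriv
  have e2 : ∀ᶠ z in 𝓝 w, deriv (deriv (fun z => (F z)⁻¹)) z = - deriv (deriv F) z / F z ^ 2 + 2 * deriv F z ^ 2 / F z ^ 3 := by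
    filter_upwards [hev, e1.eventually_nhds] with z hz hz1
    rw [EventuallyEq.deriv_eq hz1]
    have d0 := hz.1.differentiableAt.hasDerivAt
    have d1 := hz.1.deriv.differentiableAt.hasDerivAt
    refine (d1.neg.div (d0.pow 2) (pow_ne_zero 2 hz.2)).deriv.trans ?_
    have := hz.2
    simp only [Pi.neg_apply, Pi.pow_apply]
    generalize deriv (deriv F) z = c
    generalize deriv F z = b
    generalize F z = a at *
    field_simp
    push_cast
    ring
  have e3 : deriv (deriv (deriv (fun z => (F z)⁻¹))) w = - deriv (deriv (deriv F)) w / F w ^ 2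
      + 6 * deriv F w * deriv (deriv F) w / F w ^ 3 - 6 * deriv F w ^ 3 / F w ^ 4 := by
    rw [EventuallyEq.deriv_eq e2]
    have d0 := hF.differentiableAt.hasDerivAt
    have d1 := hF.deriv.differentiableAt.hasDerivAt
    have d2 := hF.deriv.deriv.differentiableAt.hasDerivAt
    refine ((d2.neg.div (d0.pow 2) (pow_ne_zero 2 h0)).add (((d1.pow 2).const_mul 2).div (d0.pow 3) (pow_ne_zero 3 h0))).deriv.trans ?_
    simp only [Pi.neg_apply, Pi.pow_apply]
    generalize deriv (deriv (deriv F)) w = d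
    generalize deriv (deriv F) w = c
    generalize deriv F w = b
    generalize F w = a at *
    field_simp
    push_cast
    ring
  have e4 : deriv (fun z => deriv (deriv F) z / F z - 3 / 2 * (deriv F z / F z) ^ 2) w
      = deriv (deriv (deriv F)) w / F w - deriv (deriv F) w * deriv F w / F w ^ 2
        - 3 * (deriv F w / F w) * (deriv (deriv F) w / F w - deriv F w ^ 2 / F w ^ 2) := by
    have d0 := hF.differentiableAt.hasDerivAt
    have d1 := hF.deriv.differentiableAt.hasDerivAt
    have d2 := hF.deriv.deriv.differentiableAt.hasDerivAt
    refine ((d2.div d0 h0).sub (((d1.div d0 h0).pow 2).const_mul (3/2))).deriv.trans ?_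
    simp only [Pi.div_apply, Nat.add_one_sub_one, pow_one]
    generalize deriv (deriv (deriv F)) w = d
    generalize deriv (deriv F) w = c
    generalize deriv F w = b
    generalize F w = a at *
    field_simp
    push_cast
    ring
  rw [e3, e4, e1.self_of_nhds]
  generalize deriv (deriv (deriv F)) w = d
  generalize deriv (deriv F) w = c
  generalize deriv F w = b
  generalize F w = a at *
  field_simp
  ring

lemma ghat_ode (f : ℂ → ℂ) (Pf : Set ℂ) (hf : TranscMeroPlane f Pf) (p q : Polynomial ℂ)
    (hrat : ∀ z, z ∉ Pf → deriv f z ≠ 0 → q.eval z ≠ 0 → schwarzian f z = p.eval z / q.eval z)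
    (g : ℂ → ℂ) (hg : ∀ z, q.eval z ≠ 0 → AnalyticAt ℂ g z) (hge : ∀ z, ∀ᶠ w in 𝓝[≠] z, g w = (deriv f w)⁻¹)
    (z : ℂ) (hz : q.eval z ≠ 0) :
    deriv (deriv (deriv g)) z + 2 * (p.eval z / q.eval z) * deriv g z
      + deriv (fun z => p.eval z / q.eval z) z * g z = 0 := by
  have hS : ∀ w, q.eval w ≠ 0 → AnalyticAt ℂ (fun z => p.eval z / q.eval z) w := fun w hw =>
    (AnalyticOnNhd.eval_polynomial (A := ℂ) p w (mem_univ w)).div (AnalyticOnNhd.eval_polynomial (A := ℂ) q w (mem_univ w)) hw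
  have hqc : ContinuousAt (fun z => q.eval z) z := q.continuous.continuousAt
  have hp : ∀ᶠ w in 𝓝[≠] z, deriv (deriv (deriv g)) w + 2 * (p.eval w / q.eval w) * deriv g w
      + deriv (fun z => p.eval z / q.eval z) w * g w = 0 := by
    filter_upwards [punct_nested (hge z), punct_nested (tm_deriv hf z),
      punct_nested (mem_nhdsWithin_of_mem_nhds (hqc.eventually_ne hz))] with w h1 h2 h3
    have hfa : AnalyticAt ℂ f w := hf.1.2.1 w h2.self_of_nhds.1
    have key := ode_point hfa.deriv h2.self_of_nhds.2
    have hSe : (fun z => deriv (deriv (deriv f)) z / deriv f z - 3 / 2 * (deriv (deriv f) z / deriv f z) ^ 2)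
        =ᶠ[𝓝 w] (fun z => p.eval z / q.eval z) := by
      filter_upwards [h2, h3] with y a b
      exact hrat y a.1 a.2 b
    have hg0 : g =ᶠ[𝓝 w] (fun z => (deriv f z)⁻¹) := h1
    have hSw := hSe.self_of_nhds
    have hgw := hg0.self_of_nhds
    dsimp only at hSw hgw
    rw [hSe.deriv_eq, hSw, ← hg0.deriv_eq, ← hg0.deriv.deriv.deriv_eq, ← hgw] at key
    exact key
  have hc : ContinuousAt (fun w => deriv (deriv (deriv g)) w + 2 * (p.eval w / q.eval w) * deriv g w
      + deriv (fun z => p.eval z / q.eval z) w * g w) z := by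
    have a := hg z hz
    have b := hS z hz
    exact ((a.deriv.deriv.deriv.continuousAt).add ((continuousAt_const.mul b.continuousAt).mul a.deriv.continuousAt)).add
      (b.deriv.continuousAt.mul a.continuousAt)
  refine tendsto_nhds_unique (hc.tendsto.mono_left (nhdsWithin_le_nhds (s := {z}ᶜ))) (tendsto_const_nhds.congr' ?_)
  filter_upwards [hp] with w hw using hw.symm

lemma ode_growth (g A B : ℂ → ℂ) (R C : ℝ) (hR : 1 ≤ R) (hC : 0 ≤ C) (hg : ∀ z, R ≤ ‖z‖ → AnalyticAt ℂ g z)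
    (hode : ∀ z, R ≤ ‖z‖ → deriv (deriv (deriv g)) z + 2 * A z * deriv g z + B z * g z = 0)
    (hA : ∀ z, R ≤ ‖z‖ → ‖z ^ 2 * A z‖ ≤ C) (hB : ∀ z, R ≤ ‖z‖ → ‖z ^ 3 * B z‖ ≤ C) :
    ∃ (M : ℝ) (n : ℕ), ∀ z, R ≤ ‖z‖ → ‖g z‖ ≤ M * ‖z‖ ^ n := by
  set W : ℂ → ℂ × ℂ × ℂ := fun z => (g z, z * deriv g z, z ^ 2 * deriv (deriv g) z) with hW
  have hWc : ContinuousOn W (Metric.sphere 0 R) := by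
    intro z hz
    have hz' : R ≤ ‖z‖ := by simp at hz; exact hz.ge
    have a := hg z hz'
    apply ContinuousAt.continuousWithinAt
    exact a.continuousAt.prodMk ((continuousAt_id.mul a.deriv.continuousAt).prodMk
      ((continuousAt_id.pow 2).mul a.deriv.deriv.continuousAt))
  obtain ⟨δ, hδ⟩ := (isCompact_sphere (0:ℂ) R).exists_bound_of_continuousOn hWc
  have hδ0 : 0 ≤ δ := (norm_nonneg _).trans (hδ (R:ℂ) (by simp; linarith))
  refine ⟨δ, ⌈2 + 3 * C⌉₊, fun z hz => ?_⟩
  have hz0 : 0 < ‖z‖ := by linarith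
  set u : ℂ := ((R / ‖z‖ : ℝ) : ℂ) * z with hu
  have hun : ‖u‖ = R := by
    rw [hu, norm_mul, Complex.norm_real, Real.norm_of_nonneg (by positivity)]; field_simp
  set T : ℝ := Real.log (‖z‖ / R) with hT
  have hT0 : 0 ≤ T := Real.log_nonneg (by rw [le_div_iff₀ (by linarith)]; linarith)
  have heT : Real.exp T = ‖z‖ / R := Real.exp_log (by positivity)
  set c : ℝ → ℂ := fun τ => (Real.exp τ : ℂ) * u with hc
  have hcT : c T = z := by
    simp only [hc]
    rw [heT, hu, ← mul_assoc, ← Complex.ofReal_mul]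
    have : ‖z‖ / R * (R / ‖z‖) = 1 := by field_simp
    rw [this]; simp
  have hcn : ∀ τ, 0 ≤ τ → R ≤ ‖c τ‖ := by
    intro τ hτ
    simp only [hc]
    rw [norm_mul, hun, Complex.norm_real, Real.norm_of_nonneg (Real.exp_pos _).le]
    have := Real.one_le_exp hτ
    nlinarith
  have hcd : ∀ τ, HasDerivAt c (c τ) τ := by
    intro τ
    exact ((Real.hasDerivAt_exp τ).ofReal_comp).mul_const u
  have hWd : ∀ τ, 0 ≤ τ → HasDerivAt (fun τ => W (c τ)) (c τ * deriv g (c τ), c τ * deriv g (c τ) + (c τ) ^ 2 * deriv (deriv g) (c τ),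
      2 * ((c τ) ^ 2 * deriv (deriv g) (c τ)) - 2 * ((c τ)^2 * A (c τ)) * (c τ * deriv g (c τ)) - ((c τ) ^ 3 * B (c τ)) * g (c τ)) τ := by
    intro τ hτ
    have a := hg _ (hcn τ hτ)
    have d := hcd τ
    have d0 := a.differentiableAt.hasDerivAt.scomp τ d
    have d1 := a.deriv.differentiableAt.hasDerivAt.scomp τ d
    have d2 := a.deriv.deriv.differentiableAt.hasDerivAt.scomp τ d
    have ho := hode _ (hcn τ hτ)
    refine HasDerivAt.prodMk (d0.congr_deriv ?_) (HasDerivAt.prodMk ((d.mul d1).congr_deriv ?_) (((d.pow 2).mul d2).congr_deriv ?_))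
    · simp
    · simp only [smul_eq_mul, Function.comp]; ring
    · simp only [smul_eq_mul, Function.comp, Pi.pow_apply]
      push_cast
      linear_combination (c τ) ^ 3 * ho
  have hgr := norm_le_gronwallBound_of_norm_deriv_right_le (f := fun τ => W (c τ)) (a := 0) (b := T) (δ := δ) (K := 2 + 3 * C) (ε := 0)
    (fun τ hτ => (hWd τ hτ.1).continuousAt.continuousWithinAt) (fun τ hτ => (hWd τ hτ.1).hasDerivWithinAt)
    (hδ _ (by simp [hc, hun])) (by
      intro τ hτ
      have hn := hcn τ hτ.1
      have b1 := hA _ hn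
      have b2 := hB _ hn
      have n1 : ‖g (c τ)‖ ≤ ‖W (c τ)‖ := norm_fst_le (W (c τ))
      have n23 : ‖(W (c τ)).2‖ ≤ ‖W (c τ)‖ := norm_snd_le (W (c τ))
      have n2 : ‖c τ * deriv g (c τ)‖ ≤ ‖W (c τ)‖ := (norm_fst_le (W (c τ)).2).trans n23
      have n3 : ‖c τ ^ 2 * deriv (deriv g) (c τ)‖ ≤ ‖W (c τ)‖ := (norm_snd_le (W (c τ)).2).trans n23
      rw [add_zero]
      generalize ‖W (c τ)‖ = X at *
      have hX : 0 ≤ X := (norm_nonneg _).trans n1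
      have hCX : 0 ≤ C * X := mul_nonneg hC hX
      refine norm_prod_le_iff.2 ⟨?_, norm_prod_le_iff.2 ⟨?_, ?_⟩⟩
      · dsimp only; linarith
      · dsimp only
        refine (norm_add_le _ _).trans ?_
        linarith
      · dsimp only
        refine (norm_sub_le _ _).trans ?_
        have := norm_sub_le (2 * (c τ ^ 2 * deriv (deriv g) (c τ))) (2 * (c τ ^ 2 * A (c τ)) * (c τ * deriv g (c τ)))
        rw [norm_mul (2 * (c τ ^ 2 * A (c τ))) _, norm_mul 2 (c τ ^ 2 * A (c τ)), norm_mul 2 (c τ ^ 2 * deriv (deriv g) (c τ)), Complex.norm_two] at this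
        rw [norm_mul (c τ ^ 3 * B (c τ)) _]
        have m1 : ‖c τ ^ 3 * B (c τ)‖ * ‖g (c τ)‖ ≤ C * X := by gcongr
        have m2 : ‖c τ ^ 2 * A (c τ)‖ * ‖c τ * deriv g (c τ)‖ ≤ C * X := by gcongr
        nlinarith)
  have hfin := hgr T ⟨hT0, le_refl T⟩
  rw [gronwallBound_ε0, sub_zero, hcT] at hfin
  have h1 : ‖g z‖ ≤ ‖W z‖ := norm_fst_le (W z)
  refine (h1.trans hfin).trans ?_
  gcongr
  have h2 : (2 + 3 * C) * T ≤ ⌈2 + 3 * C⌉₊ * T := by gcongr; exact Nat.le_ceil _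
  refine (Real.exp_le_exp.2 h2).trans ?_
  rw [Real.exp_nat_mul, heT]
  gcongr
  exact div_le_self hz0.le hR




lemma S_bound (p q : Polynomial ℂ) (hq : q ≠ 0) (h : p = 0 ∨ p.natDegree + 2 ≤ q.natDegree) :
    ∃ C R : ℝ, 0 ≤ C ∧ 1 ≤ R ∧ ∀ z : ℂ, R ≤ ‖z‖ → q.eval z ≠ 0 ∧ ‖z ^ 2 * (p.eval z / q.eval z)‖ ≤ C := by
  have hq0 : q.reverse.eval 0 ≠ 0 := by
    rw [← Polynomial.coeff_zero_eq_eval_zero, Polynomial.coeff_zero_reverse]; simp [hq]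
  have hc : ContinuousAt (fun y => p.reverse.eval y / q.reverse.eval y) 0 :=
    p.reverse.continuous.continuousAt.div q.reverse.continuous.continuousAt hq0
  have h1 := hc.norm.eventually_lt_const (lt_add_one _)
  have h2 := q.reverse.continuous.continuousAt.eventually_ne hq0
  obtain ⟨δ, hδ, hh⟩ := Metric.eventually_nhds_iff_ball.1 (h1.and h2)
  refine ⟨_, max 1 (δ⁻¹ + 1), add_nonneg (norm_nonneg (p.reverse.eval 0 / q.reverse.eval 0)) zero_le_one, le_max_left _ _, fun z hz => ?_⟩
  have hz1 : 1 ≤ ‖z‖ := (le_max_left _ _).trans hz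
  have hzδ : δ⁻¹ < ‖z‖ := by have := (le_max_right _ _).trans hz; linarith
  have hz0 : z ≠ 0 := norm_pos_iff.1 (by linarith)
  obtain ⟨a, b⟩ := hh z⁻¹ (by rw [mem_ball_zero_iff, norm_inv]; exact inv_lt_of_inv_lt₀ hδ hzδ)
  have hqz : q.eval z ≠ 0 := by
    rw [poly_ratio q z hz0]; exact mul_ne_zero b (pow_ne_zero _ hz0)
  refine ⟨hqz, ?_⟩
  rcases h with rfl | h
  · simp
  obtain ⟨k, hk⟩ := Nat.exists_eq_add_of_le h
  have e : z ^ 2 * (p.eval z / q.eval z) = (p.reverse.eval z⁻¹ / q.reverse.eval z⁻¹) * (z ^ k)⁻¹ := by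
    rw [poly_ratio q z hz0, poly_ratio p z hz0, hk, pow_add, pow_add]
    generalize Polynomial.eval z⁻¹ p.reverse = X
    generalize Polynomial.eval z⁻¹ q.reverse = Y at *
    field_simp
  rw [e, norm_mul, norm_inv, norm_pow]
  have : (‖z‖ ^ k)⁻¹ ≤ 1 := inv_le_one_of_one_le₀ (one_le_pow₀ hz1)
  calc _ ≤ ‖(p.reverse.eval z⁻¹ / q.reverse.eval z⁻¹)‖ * 1 := by gcongr
    _ ≤ _ := by rw [mul_one]; exact a.le

lemma S_deriv_bound (S : ℂ → ℂ) (C R : ℝ) (hR : 1 ≤ R) (hS : ∀ z, R ≤ ‖z‖ → AnalyticAt ℂ S z)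
    (hb : ∀ z : ℂ, R ≤ ‖z‖ → ‖z ^ 2 * S z‖ ≤ C) (z : ℂ) (hz : 2 * R ≤ ‖z‖) : ‖z ^ 3 * deriv S z‖ ≤ 8 * C := by
  have hz0 : 0 < ‖z‖ := by linarith
  have hball : ∀ y ∈ Metric.closedBall z (‖z‖ / 2), ‖z‖ / 2 ≤ ‖y‖ := by
    intro y hy
    rw [Metric.mem_closedBall, dist_eq_norm] at hy
    have := norm_sub_norm_le z y
    rw [norm_sub_rev] at this
    linarith
  have h1 := Complex.norm_deriv_le_of_forall_mem_sphere_norm_le (f := S) (c := z) (R := ‖z‖ / 2) (C := 4 * C / ‖z‖ ^ 2) (by positivity)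
    (by
      apply DifferentiableOn.diffContOnCl
      intro y hy
      rw [closure_ball _ (by positivity)] at hy
      exact (hS y (by linarith [hball y hy])).differentiableAt.differentiableWithinAt)
    (by
      intro y hy
      have hy1 := hball y (Metric.sphere_subset_closedBall hy)
      have hy2 := hb y (by linarith)
      rw [norm_mul, norm_pow] at hy2
      rw [le_div_iff₀ (by positivity)]
      have : ‖z‖ ^ 2 ≤ 4 * ‖y‖ ^ 2 := by nlinarith
      nlinarith [norm_nonneg (S y)])
  rw [norm_mul, norm_pow]
  calc _ ≤ ‖z‖ ^ 3 * (4 * C / ‖z‖ ^ 2 / (‖z‖ / 2)) := by gcongr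
    _ = 8 * C := by field_simp; ring

lemma case_two (f : ℂ → ℂ) (Pf : Set ℂ) (hf : TranscMeroPlane f Pf) (p q : Polynomial ℂ) (hq : q ≠ 0)
    (hrat : ∀ z, z ∉ Pf → deriv f z ≠ 0 → q.eval z ≠ 0 → schwarzian f z = p.eval z / q.eval z)
    (h : p = 0 ∨ p.natDegree + 2 ≤ q.natDegree) : False := by
  obtain ⟨g, hg, hge⟩ := ghat_exists f Pf hf p q hrat
  have hode := ghat_ode f Pf hf p q hrat g hg hge
  obtain ⟨C, R, hC, hR, hb⟩ := S_bound p q hq h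
  have hS : ∀ w, R ≤ ‖w‖ → AnalyticAt ℂ (fun z => p.eval z / q.eval z) w := fun w hw =>
    (AnalyticOnNhd.eval_polynomial (A := ℂ) p w (mem_univ w)).div (AnalyticOnNhd.eval_polynomial (A := ℂ) q w (mem_univ w)) (hb w hw).1
  have hR2 : ∀ z : ℂ, 2 * R ≤ ‖z‖ → R ≤ ‖z‖ := fun z hz => by linarith
  obtain ⟨M, n, hgr⟩ := ode_growth g (fun z => p.eval z / q.eval z) (deriv (fun z => p.eval z / q.eval z)) (2 * R) (8 * C)
    (by linarith) (by linarith) (fun z hz => hg z (hb z (hR2 z hz)).1) (fun z hz => hode z (hb z (hR2 z hz)).1)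
    (fun z hz => (hb z (hR2 z hz)).2.trans (by linarith)) (S_deriv_bound _ C R hR hS (fun z hz => (hb z hz).2))
  have hga : ∀ z : ℂ, 2 * R < ‖z‖ → AnalyticAt ℂ g z := fun z hz => hg z (hb z (hR2 z hz.le)).1
  obtain ⟨m, c, R2, hc, hlow⟩ := lower_growth g (2 * R) M n (by linarith) hga (fun z hz => hgr z hz.le) (by
    intro r
    have h1 : ∀ᶠ w in 𝓝[≠] (((|r| + 1 : ℝ)) : ℂ), r < ‖w‖ := by
      apply mem_nhdsWithin_of_mem_nhds
      refine (continuous_norm.tendsto (((|r| + 1 : ℝ)) : ℂ)).eventually_const_lt ?_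
      rw [Complex.norm_real, Real.norm_of_nonneg (by positivity)]
      linarith [le_abs_self r]
    obtain ⟨w, a, b, d⟩ := (h1.and ((hge _).and (tm_deriv hf _))).exists
    exact ⟨w, a, by rw [b]; exact inv_ne_zero d.2⟩)
  set R3 : ℝ := max (2 * R) R2 + 1 with hR3
  have hR3a : 2 * R < R3 := by have := le_max_left (2 * R) R2; linarith
  have hR3b : R2 < R3 := by have := le_max_right (2 * R) R2; linarith
  have hR30 : 0 < R3 := by linarith
  have hgne : ∀ z : ℂ, R3 ≤ ‖z‖ → g z ≠ 0 := by
    intro z hz h0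
    have := hlow z (by linarith)
    rw [h0] at this; simp at this; linarith
  have hnp : ∀ z : ℂ, R3 ≤ ‖z‖ → z ∉ Pf := by
    intro z0 hz hP
    have hpole := (tendsto_cobounded_iff_meromorphicOrderAt_neg (mp_mero hf.1 z0)).1
      (tendsto_norm_atTop_iff_cobounded.1 (mp_pole hf.1 hP))
    obtain ⟨k, hk⟩ := WithTop.ne_top_iff_exists.1 (ne_top_of_lt hpole)
    obtain ⟨G, hG, hG0, he⟩ := (meromorphicOrderAt_eq_int_iff (mp_mero hf.1 z0)).1 hk.symm
    have hk0 : k < 0 := by rw [← hk] at hpole; exact_mod_cast hpole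
    have hd := deriv_zpow_form k hG he
    have ho : meromorphicOrderAt (deriv f) z0 = ((k - 1 : ℤ) : WithTop ℤ) := by
      rw [meromorphicOrderAt_eq_int_iff (mp_mero hf.1 z0).deriv]
      refine ⟨_, ?_, ?_, hd⟩
      · have := hG.deriv
        fun_prop
      · simp [hG0]; omega
    have hlim : Tendsto (deriv f) (𝓝[≠] z0) (𝓝 (g z0)⁻¹) := by
      have h1 : Tendsto (fun z => (g z)⁻¹) (𝓝[≠] z0) (𝓝 (g z0)⁻¹) :=
        ((hga z0 (by linarith)).continuousAt.inv₀ (hgne z0 hz)).tendsto.mono_left nhdsWithin_le_nhds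
      refine h1.congr' ?_
      filter_upwards [hge z0] with w hw
      rw [hw, inv_inv]
    have := (tendsto_nhds_iff_meromorphicOrderAt_nonneg (mp_mero hf.1 z0).deriv).1 ⟨_, hlim⟩
    rw [ho] at this
    have : (0:ℤ) ≤ k - 1 := by exact_mod_cast this
    omega
  have hder : ∀ z : ℂ, R3 ≤ ‖z‖ → deriv f z = (g z)⁻¹ := by
    intro z hz
    have h1 : Tendsto (fun z => (g z)⁻¹) (𝓝[≠] z) (𝓝 (g z)⁻¹) :=
      ((hga z (by linarith)).continuousAt.inv₀ (hgne z hz)).tendsto.mono_left nhdsWithin_le_nhds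
    have h2 : Tendsto (deriv f) (𝓝[≠] z) (𝓝 (deriv f z)) :=
      (hf.1.2.1 z (hnp z hz)).deriv.continuousAt.tendsto.mono_left nhdsWithin_le_nhds
    refine tendsto_nhds_unique h2 (h1.congr' ?_)
    filter_upwards [hge z] with w hw
    rw [hw, inv_inv]
  have hdb : ∀ z : ℂ, R3 ≤ ‖z‖ → ‖deriv f z‖ ≤ ‖z‖ ^ m / c := by
    intro z hz
    have h1 := hlow z (by linarith)
    have h2 := norm_pos_iff.2 (hgne z hz)
    rw [hder z hz, norm_inv, le_div_iff₀ hc, inv_mul_le_iff₀ h2]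
    exact h1
  obtain ⟨B, hB⟩ := (isCompact_sphere (0:ℂ) R3).exists_bound_of_continuousOn (f := f) (fun z hz => by
    have hz' : R3 ≤ ‖z‖ := by simp at hz; exact hz.ge
    exact (hf.1.2.1 z (hnp z hz')).continuousAt.continuousWithinAt)
  have hB0 : 0 ≤ B := (norm_nonneg _).trans (hB (R3:ℂ) (by simp; linarith))
  refine hf.2 (rational_of_growth hf.1 (B + 1 / c) R3 (m + 1) (fun z hz => ?_) (fun z hz => ?_))
  · by_contra hcon
    exact hnp z (by linarith) hz
  · have hz0 : 0 < ‖z‖ := by linarith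
    set z1 : ℂ := ((R3 / ‖z‖ : ℝ) : ℂ) * z with hz1
    have hz1n : ‖z1‖ = R3 := by
      rw [hz1, norm_mul, Complex.norm_real, Real.norm_of_nonneg (by positivity)]; field_simp
    have hseg : ∀ y ∈ segment ℝ z1 z, R3 ≤ ‖y‖ ∧ ‖y‖ ≤ ‖z‖ := by
      rintro y ⟨a, b, ha, hb', hab, rfl⟩
      have e : a • z1 + b • z = ((a * (R3 / ‖z‖) + b : ℝ) : ℂ) * z := by
        rw [hz1]; simp only [Complex.real_smul]; push_cast; ring
      have e2 : ‖a • z1 + b • z‖ = a * R3 + b * ‖z‖ := by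
        rw [e, norm_mul, Complex.norm_real, Real.norm_of_nonneg (by positivity)]; field_simp
      rw [e2]
      have hb2 : b = 1 - a := by linarith
      subst hb2
      constructor <;> nlinarith
    have hmv := (convex_segment (𝕜 := ℝ) z1 z).norm_image_sub_le_of_norm_deriv_le (𝕜 := ℂ) (f := f) (C := ‖z‖ ^ m / c)
      (fun y hy => (hf.1.2.1 y (hnp y (hseg y hy).1)).differentiableAt)
      (fun y hy => (hdb y (hseg y hy).1).trans (by gcongr; exact (hseg y hy).2))
      (left_mem_segment ℝ z1 z) (right_mem_segment ℝ z1 z)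
    have hdist : ‖z - z1‖ ≤ ‖z‖ := by
      have e : z - z1 = ((1 - R3 / ‖z‖ : ℝ) : ℂ) * z := by rw [hz1]; push_cast; ring
      have hle : R3 / ‖z‖ ≤ 1 := (div_le_one hz0).2 hz.le
      have hp : 0 < R3 / ‖z‖ := by positivity
      rw [e, norm_mul, Complex.norm_real, Real.norm_of_nonneg (by linarith)]
      nlinarith
    have hB1 := hB z1 (by simp [hz1n])
    have htri : ‖f z‖ ≤ ‖f z - f z1‖ + ‖f z1‖ := by
      have := norm_add_le (f z - f z1) (f z1)
      simpa using this
    have hone : 1 ≤ ‖z‖ ^ (m + 1) := one_le_pow₀ (by linarith)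
    calc ‖f z‖ ≤ ‖z‖ ^ m / c * ‖z - z1‖ + B := by linarith
      _ ≤ ‖z‖ ^ m / c * ‖z‖ + B * ‖z‖ ^ (m + 1) := by
        gcongr
        exact le_mul_of_one_le_right hB0 hone
      _ = _ := by rw [pow_succ]; ring

lemma final_thm
    (f : ℂ → ℂ) (Pf : Set ℂ)
    (hf : TranscMeroPlane f Pf)
    (p q : Polynomial ℂ) (hq : q ≠ 0)
    (hrat : ∀ z, z ∉ Pf → deriv f z ≠ 0 → q.eval z ≠ 0 →
        schwarzian f z = p.eval z / q.eval z) :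
    {z : ℂ | MultiplePoint f z}.Finite ∧ FinitelyManyTranscSing f Pf := by
  constructor
  · refine (Polynomial.rootSet_finite q ℂ).subset fun z hz => ?_
    rw [Polynomial.mem_rootSet]
    exact ⟨hq, by simpa using mult_root f Pf hf p q hrat z hz⟩
  · by_cases h : p = 0 ∨ p.natDegree + 2 ≤ q.natDegree
    · exact (case_two f Pf hf p q hq hrat h).elim
    · push Not at h
      exact count_sing f Pf hf p q h.1 hq hrat (p.natDegree + 2 - q.natDegree) (by omega) (by omega)


/-- converse of Theorem 1.1: if `f` is transcendental meromorphic in the plane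
and `S_f` is a rational function, then `f` has finitely many multiple points and `f⁻¹` has
finitely many transcendental singularities. -/
theorem finitely_many_singularities_of_rational_schwarzian
    (f : ℂ → ℂ) (Pf : Set ℂ)
    (hf : TranscMeroPlane f Pf)
    (p q : Polynomial ℂ) (hq : q ≠ 0)
    (hrat : ∀ z, z ∉ Pf → deriv f z ≠ 0 → q.eval z ≠ 0 →
        schwarzian f z = p.eval z / q.eval z) :
    {z : ℂ | MultiplePoint f z}.Finite ∧ FinitelyManyTranscSing f Pf := by
  exact final_thm f Pf hf p q hq hrat

end
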